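/- arXiv:2211.16709 — 3 statements merged into one kernel-verified Lean document; each statement's English description precedes it below -/
import Mathlib

section
/- Let 1 ≤ m ≤ p ≤ n be integers. For the fermionic Gaussian ensemble with fixed particle number p, the variance of the von Neumann entropy equals V[S] = c₀·ψ₁(m+n−p) − (m+n)·ψ₁(m+n) + n·ψ₁(n) + c₁·ψ₁(p) + c₂·(ψ₀(m+n−p) − ψ₀(p))² + c₃·(ψ₀(m+n−p) − ψ₀(p)) − ψ₀(m+n) + ψ₀(n) + c₄, where c₀ = m(m+n−p)(m²+2mn+n²−np−1)/((m+n−1)(m+n)(m+n+1)), c₁ = m·p·(m²+mn+np−1)/((m+n−1)(m+n)(m+n+1)), c₂ = m·n·p·(m+n−p)/((m+n)·(m+n−1)(m+n)(m+n+1)), c₃ = −m(m+1)(m+n−2p)/((m+n)·(m+n)(m+n+1)), and c₄ = −m(2m+n+2)/((m+n)·(m+n)(m+n+1)). -/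
open MeasureTheory Real Finset

/-- The entropy integrand `v(x) = (1-x)/2 · ln((1-x)/2) + (1+x)/2 · ln((1+x)/2)`. -/
noncomputable def vEnt (x : ℝ) : ℝ :=
  (1 - x) / 2 * Real.log ((1 - x) / 2) + (1 + x) / 2 * Real.log ((1 + x) / 2)

/-- Digamma function at a positive integer: `ψ₀(k) = -γ + Σ_{j=1}^{k-1} 1/j`. -/
noncomputable def psi0 (k : ℕ) : ℝ :=
  -Real.eulerMascheroniConstant + ∑ j ∈ Finset.range (k - 1), 1 / (j + 1 : ℝ)

/-- Trigamma function at a positive integer: `ψ₁(k) = π²/6 - Σ_{j=1}^{k-1} 1/j²`. -/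
noncomputable def psi1 (k : ℕ) : ℝ :=
  Real.pi ^ 2 / 6 - ∑ j ∈ Finset.range (k - 1), 1 / ((j + 1 : ℝ)) ^ 2

/-- The unnormalized fermionic-Gaussian eigenvalue density with fixed particle number `p`. -/
noncomputable def densityB (m n p : ℕ) (x : Fin m → ℝ) : ℝ :=
  if ∀ i, x i ∈ Set.Icc (-1 : ℝ) 1 then
    (∏ q ∈ Finset.univ.filter (fun q : Fin m × Fin m => q.1 < q.2),
      ((x q.1) - (x q.2)) ^ 2) * ∏ i, (1 + x i) ^ (p - m) * (1 - x i) ^ (n - p)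
  else 0

/-- The von Neumann entropy `S(x) = -Σ_i v(x_i)`. -/
noncomputable def entS {m : ℕ} (x : Fin m → ℝ) : ℝ := -∑ i, vEnt (x i)

/-- Ensemble average of `g` with respect to the density `f`. -/
noncomputable def ensembleAvg {m : ℕ} (f : (Fin m → ℝ) → ℝ) (g : (Fin m → ℝ) → ℝ) : ℝ :=
  (∫ x, g x * f x) / (∫ x, f x)

/-- Ensemble variance of `g`: `V[g] = E[g²] − E[g]²`. -/
noncomputable def ensembleVar {m : ℕ} (f : (Fin m → ℝ) → ℝ) (g : (Fin m → ℝ) → ℝ) : ℝ :=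
  ensembleAvg f (fun x => (g x) ^ 2) - (ensembleAvg f g) ^ 2

/-! ### Part 1: determinantal reduction of the multiple integrals -/

/-- matrix element of `g` between `φ j` and `φ k` with weight `ω` -/
noncomputable def mel {m : ℕ} (φ : Fin m → ℝ → ℝ) (ω : ℝ → ℝ) (g : ℝ → ℝ) (j k : Fin m) : ℝ :=
  ∫ x, g x * (φ j x * φ k x * ω x)

theorem det_sq_expand {m : ℕ} (φ : Fin m → ℝ → ℝ) (ω : ℝ → ℝ) (g : Fin m → ℝ → ℝ)
    (x : Fin m → ℝ) :
    (∏ i, g i (x i)) * ((Matrix.det (Matrix.of fun j i => φ j (x i))) ^ 2 * ∏ i, ω (x i)) =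
    ∑ σ : Equiv.Perm (Fin m), ∑ τ : Equiv.Perm (Fin m),
      (((Equiv.Perm.sign σ : ℤ) : ℝ) * ((Equiv.Perm.sign τ : ℤ) : ℝ)) *
        ∏ i, (g i (x i) * (φ (σ i) (x i) * φ (τ i) (x i) * ω (x i))) := by
  rw [Matrix.det_apply', sq, Finset.sum_mul_sum, Finset.sum_mul, Finset.mul_sum]
  refine Finset.sum_congr rfl fun σ _ => ?_
  rw [Finset.sum_mul, Finset.mul_sum]
  refine Finset.sum_congr rfl fun τ _ => ?_
  simp only [Matrix.of_apply, Finset.prod_mul_distrib]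
  ring

theorem det_sq_integral {m : ℕ} (φ : Fin m → ℝ → ℝ) (ω : ℝ → ℝ) (g : Fin m → ℝ → ℝ)
    (hIntg : ∀ i j k, Integrable fun x => g i x * (φ j x * φ k x * ω x)) :
    Integrable (fun x : Fin m → ℝ =>
      (∏ i, g i (x i)) * ((Matrix.det (Matrix.of fun j i => φ j (x i))) ^ 2 * ∏ i, ω (x i))) ∧
    ∫ x : Fin m → ℝ,
      (∏ i, g i (x i)) * ((Matrix.det (Matrix.of fun j i => φ j (x i))) ^ 2 * ∏ i, ω (x i)) =
    ∑ σ : Equiv.Perm (Fin m), ∑ ρ : Equiv.Perm (Fin m),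
      ((Equiv.Perm.sign ρ : ℤ) : ℝ) * ∏ i, mel φ ω (g i) (σ i) (σ (ρ i)) := by
  simp only [det_sq_expand]
  have hI : ∀ σ τ : Equiv.Perm (Fin m), Integrable (fun x : Fin m → ℝ =>
      (((Equiv.Perm.sign σ : ℤ) : ℝ) * ((Equiv.Perm.sign τ : ℤ) : ℝ)) *
        ∏ i, (g i (x i) * (φ (σ i) (x i) * φ (τ i) (x i) * ω (x i)))) := by
    intro σ τ
    refine Integrable.const_mul ?_ _
    exact Integrable.fintype_prod (f := fun i y => g i y * (φ (σ i) y * φ (τ i) y * ω y))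
      (fun i => hIntg i (σ i) (τ i))
  refine ⟨integrable_finsetSum _ fun σ _ => integrable_finsetSum _ fun τ _ => hI σ τ, ?_⟩
  rw [integral_finsetSum _ (fun σ _ => integrable_finsetSum _ fun τ _ => hI σ τ)]
  refine Finset.sum_congr rfl fun σ _ => ?_
  rw [integral_finsetSum _ (fun τ _ => hI σ τ)]
  rw [← Equiv.sum_comp (Equiv.mulLeft σ)]
  refine Finset.sum_congr rfl fun ρ _ => ?_
  rw [integral_const_mul]
  have := integral_fintype_prod_volume_eq_prod (𝕜 := ℝ)
    (fun i y => g i y * (φ (σ i) y * φ ((σ * ρ) i) y * ω y))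
  simp only [Equiv.coe_mulLeft]
  rw [this]
  simp only [mel, Equiv.Perm.sign_mul, Equiv.Perm.coe_mul, Function.comp]
  push_cast
  rw [← mul_assoc, ← Int.cast_mul, ← Units.val_mul, Int.units_mul_self]
  simp

section ortho
variable {m : ℕ} (φ : Fin m → ℝ → ℝ) (ω f : ℝ → ℝ)

theorem perm_sum_one (A : Fin m → Fin m → Fin m → ℝ) (i₀ : Fin m) (σ : Equiv.Perm (Fin m))
    (hA : ∀ i, i ≠ i₀ → ∀ j k, A i j k = if j = k then 1 else 0) :
    ∑ ρ : Equiv.Perm (Fin m), ((Equiv.Perm.sign ρ : ℤ) : ℝ) * ∏ i, A i (σ i) (σ (ρ i)) =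
      A i₀ (σ i₀) (σ i₀) := by
  rw [Finset.sum_eq_single 1]
  · simp only [Equiv.Perm.sign_one, Equiv.Perm.coe_one, id]
    rw [Finset.prod_eq_single i₀]
    · simp
    · intro i _ hi; simp [hA i hi]
    · simp
  · intro ρ _ hρ
    by_contra hne
    apply hρ
    have h1 : ∀ i, i ≠ i₀ → ρ i = i := by
      intro i hi
      by_contra hc
      apply hne
      rw [Finset.prod_eq_zero (Finset.mem_univ i), mul_zero]
      rw [hA i hi, if_neg]
      intro h; exact hc (σ.injective h).symm
    ext i
    by_cases hi : i = i₀
    · subst hi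
      by_contra hc
      have h2 : ρ i ≠ i := fun h => hc (by rw [h]; rfl)
      exact h2 (ρ.injective (h1 _ h2))
    · rw [h1 i hi]; rfl
  · simp

theorem perm_sum_two (A : Fin m → Fin m → Fin m → ℝ) (i₀ j₀ : Fin m) (hij : i₀ ≠ j₀)
    (σ : Equiv.Perm (Fin m))
    (hA : ∀ i, i ≠ i₀ → i ≠ j₀ → ∀ j k, A i j k = if j = k then 1 else 0) :
    ∑ ρ : Equiv.Perm (Fin m), ((Equiv.Perm.sign ρ : ℤ) : ℝ) * ∏ i, A i (σ i) (σ (ρ i)) =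
      A i₀ (σ i₀) (σ i₀) * A j₀ (σ j₀) (σ j₀) - A i₀ (σ i₀) (σ j₀) * A j₀ (σ j₀) (σ i₀) := by
  have hsw : (1 : Equiv.Perm (Fin m)) ≠ Equiv.swap i₀ j₀ := by
    intro h
    have := congrArg (fun e : Equiv.Perm (Fin m) => e i₀) h
    simp at this
    exact hij this
  rw [← Finset.sum_subset (Finset.subset_univ ({1, Equiv.swap i₀ j₀} : Finset (Equiv.Perm (Fin m))))]
  · rw [Finset.sum_pair hsw]
    have hp : ∀ ρ : Equiv.Perm (Fin m), (∀ i, i ≠ i₀ → i ≠ j₀ → ρ i = i) →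
        ∏ i, A i (σ i) (σ (ρ i)) = A i₀ (σ i₀) (σ (ρ i₀)) * A j₀ (σ j₀) (σ (ρ j₀)) := by
      intro ρ hρ
      rw [← Finset.prod_subset (Finset.subset_univ ({i₀, j₀} : Finset (Fin m)))]
      · rw [Finset.prod_pair hij]
      · intro i _ hi
        simp only [Finset.mem_insert, Finset.mem_singleton, not_or] at hi
        rw [hρ i hi.1 hi.2, hA i hi.1 hi.2]; simp
    rw [hp 1 (by simp), hp (Equiv.swap i₀ j₀) (fun i h1 h2 => Equiv.swap_apply_of_ne_of_ne h1 h2)]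
    rw [Equiv.Perm.sign_swap hij]
    simp
    ring
  · intro ρ _ hρ
    simp only [Finset.mem_insert, Finset.mem_singleton, not_or] at hρ
    by_contra hne
    have h1 : ∀ i, i ≠ i₀ → i ≠ j₀ → ρ i = i := by
      intro i hi hj
      by_contra hc
      apply hne
      rw [Finset.prod_eq_zero (Finset.mem_univ i), mul_zero]
      rw [hA i hi hj, if_neg]
      intro h; exact hc (σ.injective h).symm
    have h2 : ∀ i, i = i₀ ∨ i = j₀ → ρ i = i₀ ∨ ρ i = j₀ := by
      intro i hi
      by_contra hc
      push Not at hc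
      have := ρ.injective (h1 _ hc.1 hc.2)
      rw [this] at hc
      rcases hi with h | h
      · exact hc.1 h
      · exact hc.2 h
    have h3 := h2 i₀ (Or.inl rfl)
    have h4 := h2 j₀ (Or.inr rfl)
    have h5 : ρ i₀ ≠ ρ j₀ := fun h => hij (ρ.injective h)
    rcases h3 with h3 | h3
    · have h4' : ρ j₀ = j₀ := by
        rcases h4 with h | h
        · exact absurd (h3.trans h.symm) h5
        · exact h
      apply hρ.1
      ext i
      by_cases hi : i = i₀
      · subst hi; rw [h3]; rfl
      · by_cases hj : i = j₀
        · subst hj; rw [h4']; rfl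
        · rw [h1 i hi hj]; rfl
    · have h4' : ρ j₀ = i₀ := by
        rcases h4 with h | h
        · exact h
        · exact absurd (h3.trans h.symm) h5
      apply hρ.2
      ext i
      by_cases hi : i = i₀
      · subst hi; rw [h3]; simp
      · by_cases hj : i = j₀
        · subst hj; rw [h4']; simp
        · rw [h1 i hi hj, Equiv.swap_apply_of_ne_of_ne hi hj]

theorem norm_integral
    (hI0 : ∀ j k, Integrable fun x => φ j x * φ k x * ω x)
    (horth : ∀ j k, ∫ x, φ j x * φ k x * ω x = if j = k then 1 else 0) :
    ∫ x : Fin m → ℝ, ((Matrix.det (Matrix.of fun j i => φ j (x i))) ^ 2 * ∏ i, ω (x i)) =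
      (Nat.factorial m : ℝ) := by
  have h := (det_sq_integral φ ω (fun _ _ => 1) (by intro i j k; simpa using hI0 j k)).2
  simp only [Finset.prod_const_one, one_mul] at h
  rw [h]
  have hmel : ∀ j k, mel φ ω (fun _ => 1) j k = if j = k then 1 else 0 := by
    intro j k; simpa [mel] using horth j k
  have : ∀ σ : Equiv.Perm (Fin m), ∑ ρ : Equiv.Perm (Fin m),
      ((Equiv.Perm.sign ρ : ℤ) : ℝ) * ∏ i, mel φ ω (fun _ => 1) (σ i) (σ (ρ i)) = 1 := by
    intro σ
    rcases Nat.eq_zero_or_pos m with h0 | h0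
    · subst h0; simp
    · have := perm_sum_one (fun _ => mel φ ω (fun _ => 1)) ⟨0, h0⟩ σ (fun i _ => hmel)
      rw [this, hmel]; simp
  simp only [this]
  simp [Fintype.card_perm]

theorem prod_single (i₀ : Fin m) (g : ℝ → ℝ) (x : Fin m → ℝ) :
    ∏ i, (if i = i₀ then g else fun _ => 1) (x i) = g (x i₀) := by
  rw [Finset.prod_eq_single i₀]
  · simp
  · intro i _ hi; simp [hi]
  · simp

theorem one_integral
    (hI0 : ∀ j k, Integrable fun x => φ j x * φ k x * ω x)
    (horth : ∀ j k, ∫ x, φ j x * φ k x * ω x = if j = k then 1 else 0)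
    (g : ℝ → ℝ) (hg : ∀ j k, Integrable fun x => g x * (φ j x * φ k x * ω x))
    (i₀ : Fin m) :
    Integrable (fun x : Fin m → ℝ =>
      g (x i₀) * ((Matrix.det (Matrix.of fun j i => φ j (x i))) ^ 2 * ∏ i, ω (x i))) ∧
    ∫ x : Fin m → ℝ,
      g (x i₀) * ((Matrix.det (Matrix.of fun j i => φ j (x i))) ^ 2 * ∏ i, ω (x i)) =
      ∑ σ : Equiv.Perm (Fin m), mel φ ω g (σ i₀) (σ i₀) := by
  have h := det_sq_integral φ ω (fun i => if i = i₀ then g else fun _ => 1) (by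
    intro i j k
    by_cases hi : i = i₀
    · simpa [hi] using hg j k
    · simpa [hi] using hI0 j k)
  simp only [prod_single] at h
  refine ⟨h.1, ?_⟩
  rw [h.2]
  refine Finset.sum_congr rfl fun σ _ => ?_
  rw [perm_sum_one (fun i => mel φ ω (if i = i₀ then g else fun _ => 1)) i₀ σ]
  · simp
  · intro i hi j k
    simpa [mel, hi] using horth j k

theorem two_integral
    (hI0 : ∀ j k, Integrable fun x => φ j x * φ k x * ω x)
    (horth : ∀ j k, ∫ x, φ j x * φ k x * ω x = if j = k then 1 else 0)
    (g : ℝ → ℝ) (hg : ∀ j k, Integrable fun x => g x * (φ j x * φ k x * ω x))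
    (i₀ j₀ : Fin m) (hij : i₀ ≠ j₀) :
    Integrable (fun x : Fin m → ℝ =>
      g (x i₀) * g (x j₀) *
        ((Matrix.det (Matrix.of fun j i => φ j (x i))) ^ 2 * ∏ i, ω (x i))) ∧
    ∫ x : Fin m → ℝ,
      g (x i₀) * g (x j₀) *
        ((Matrix.det (Matrix.of fun j i => φ j (x i))) ^ 2 * ∏ i, ω (x i)) =
      ∑ σ : Equiv.Perm (Fin m), (mel φ ω g (σ i₀) (σ i₀) * mel φ ω g (σ j₀) (σ j₀)
        - mel φ ω g (σ i₀) (σ j₀) ^ 2) := by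
  have h := det_sq_integral φ ω (fun i => if i = i₀ ∨ i = j₀ then g else fun _ => 1) (by
    intro i j k
    by_cases hi : i = i₀ ∨ i = j₀
    · simpa [hi] using hg j k
    · simpa [hi] using hI0 j k)
  have hp : ∀ x : Fin m → ℝ, ∏ i, (if i = i₀ ∨ i = j₀ then g else fun _ => 1) (x i) =
      g (x i₀) * g (x j₀) := by
    intro x
    rw [← Finset.prod_subset (Finset.subset_univ ({i₀, j₀} : Finset (Fin m)))]
    · rw [Finset.prod_pair hij]; simp
    · intro i _ hi
      simp only [Finset.mem_insert, Finset.mem_singleton] at hi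
      simp [hi]
  simp only [hp] at h
  refine ⟨h.1, ?_⟩
  rw [h.2]
  refine Finset.sum_congr rfl fun σ _ => ?_
  rw [perm_sum_two (fun i => mel φ ω (if i = i₀ ∨ i = j₀ then g else fun _ => 1)) i₀ j₀ hij σ]
  · simp only [true_or, or_true, if_true]
    have : mel φ ω g (σ j₀) (σ i₀) = mel φ ω g (σ i₀) (σ j₀) := by
      unfold mel; congr 1; ext x; ring
    rw [this]; ring
  · intro i hi hj j k
    simpa [mel, hi, hj] using horth j k

theorem sum_perm_one (h : Fin m → ℝ) :
    ∑ i, ∑ σ : Equiv.Perm (Fin m), h (σ i) = (Nat.factorial m : ℝ) * ∑ i, h i := by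
  rw [Finset.sum_comm]
  simp only [Equiv.sum_comp]
  simp [Fintype.card_perm]

theorem sum_perm_two (h : Fin m → Fin m → ℝ) :
    ∑ i, ∑ j, ∑ σ : Equiv.Perm (Fin m), h (σ i) (σ j) =
      (Nat.factorial m : ℝ) * ∑ i, ∑ j, h i j := by
  have : ∀ σ : Equiv.Perm (Fin m), ∑ i, ∑ j, h (σ i) (σ j) = ∑ i, ∑ j, h i j := by
    intro σ
    rw [← Equiv.sum_comp σ (fun i => ∑ j, h i j)]
    refine Finset.sum_congr rfl fun i _ => ?_
    rw [Equiv.sum_comp σ (fun j => h (σ i) j)]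
  calc _ = ∑ i, ∑ σ : Equiv.Perm (Fin m), ∑ j, h (σ i) (σ j) := by
        refine Finset.sum_congr rfl fun i _ => ?_
        rw [Finset.sum_comm]
    _ = ∑ σ : Equiv.Perm (Fin m), ∑ i, ∑ j, h (σ i) (σ j) := by rw [Finset.sum_comm]
    _ = _ := by simp only [this]; simp [Fintype.card_perm]

/-- The determinantal variance formula. -/
theorem det_variance
    (hI0 : ∀ j k, Integrable fun x => φ j x * φ k x * ω x)
    (hI1 : ∀ j k, Integrable fun x => f x * (φ j x * φ k x * ω x))
    (hI2 : ∀ j k, Integrable fun x => f x ^ 2 * (φ j x * φ k x * ω x))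
    (horth : ∀ j k, ∫ x, φ j x * φ k x * ω x = if j = k then 1 else 0) :
    let Dn : (Fin m → ℝ) → ℝ :=
      fun x => (Matrix.det (Matrix.of fun j i => φ j (x i))) ^ 2 * ∏ i, ω (x i)
    (∫ x, (∑ i, f (x i)) ^ 2 * Dn x) / (∫ x, Dn x) -
      ((∫ x, (∑ i, f (x i)) * Dn x) / (∫ x, Dn x)) ^ 2 =
    ∑ j, mel φ ω (fun x => f x ^ 2) j j - ∑ j, ∑ k, mel φ ω f j k ^ 2 := by
  intro Dn
  have hN : ∫ x, Dn x = (Nat.factorial m : ℝ) := norm_integral φ ω hI0 horth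
  have hN0 : (Nat.factorial m : ℝ) ≠ 0 := by positivity
  have h1 : ∫ x, (∑ i, f (x i)) * Dn x = (Nat.factorial m : ℝ) * ∑ j, mel φ ω f j j := by
    simp only [Finset.sum_mul]
    rw [integral_finsetSum _ (fun i _ => (one_integral φ ω hI0 horth f hI1 i).1)]
    rw [← sum_perm_one]
    exact Finset.sum_congr rfl fun i _ => (one_integral φ ω hI0 horth f hI1 i).2
  have h2 : ∫ x, (∑ i, f (x i)) ^ 2 * Dn x = (Nat.factorial m : ℝ) *
      (∑ j, mel φ ω (fun x => f x ^ 2) j j + ∑ j, ∑ k, (mel φ ω f j j * mel φ ω f k k -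
        mel φ ω f j k ^ 2)) := by
    have hI : ∀ i j, Integrable (fun x : Fin m → ℝ => f (x i) * f (x j) * Dn x) := by
      intro i j
      by_cases hij : i = j
      · subst hij
        have := (one_integral φ ω hI0 horth (fun x => f x ^ 2) hI2 i).1
        refine this.congr (Filter.Eventually.of_forall fun x => ?_)
        change f (x i) ^ 2 * Dn x = f (x i) * f (x i) * Dn x
        rw [sq]
      · exact (two_integral φ ω hI0 horth f hI1 i j hij).1
    have e : ∀ x, (∑ i, f (x i)) ^ 2 * Dn x = ∑ i, ∑ j, f (x i) * f (x j) * Dn x := by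
      intro x; rw [sq, Finset.sum_mul_sum, Finset.sum_mul]
      refine Finset.sum_congr rfl fun i _ => ?_
      rw [Finset.sum_mul]
    simp only [e]
    rw [integral_finsetSum _ (fun i _ => integrable_finsetSum _ fun j _ => hI i j)]
    have : ∀ i, ∫ x, ∑ j, f (x i) * f (x j) * Dn x = ∑ σ : Equiv.Perm (Fin m),
        mel φ ω (fun x => f x ^ 2) (σ i) (σ i) + ∑ j, ∑ σ : Equiv.Perm (Fin m),
        (mel φ ω f (σ i) (σ i) * mel φ ω f (σ j) (σ j) - mel φ ω f (σ i) (σ j) ^ 2) := by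
      intro i
      rw [integral_finsetSum _ (fun j _ => hI i j)]
      rw [← Finset.add_sum_erase _ _ (Finset.mem_univ i)]
      rw [← Finset.add_sum_erase (s := Finset.univ) (a := i) (f := fun j => ∑ σ : Equiv.Perm (Fin m),
        (mel φ ω f (σ i) (σ i) * mel φ ω f (σ j) (σ j) - mel φ ω f (σ i) (σ j) ^ 2))
        (Finset.mem_univ i)]
      have e1 := (one_integral φ ω hI0 horth (fun x => f x ^ 2) hI2 i).2
      have e2 : ∫ x, f (x i) * f (x i) * Dn x = ∑ σ : Equiv.Perm (Fin m),
        mel φ ω (fun x => f x ^ 2) (σ i) (σ i) := by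
        rw [← e1]; congr 1; ext x; rw [sq]
      rw [e2]
      congr 1
      have e3 : ∑ σ : Equiv.Perm (Fin m),
        (mel φ ω f (σ i) (σ i) * mel φ ω f (σ i) (σ i) - mel φ ω f (σ i) (σ i) ^ 2) = 0 := by
        apply Finset.sum_eq_zero; intro σ _; ring
      rw [e3, zero_add]
      refine Finset.sum_congr rfl fun j hj => ?_
      exact (two_integral φ ω hI0 horth f hI1 i j (Finset.ne_of_mem_erase hj).symm).2
    simp only [this]
    rw [Finset.sum_add_distrib, sum_perm_one (fun j => mel φ ω (fun x => f x ^ 2) j j),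
      sum_perm_two (fun j k => mel φ ω f j j * mel φ ω f k k - mel φ ω f j k ^ 2), mul_add]
  rw [hN, h1, h2, mul_div_cancel_left₀ _ hN0, mul_div_cancel_left₀ _ hN0]
  simp only [Finset.sum_sub_distrib]
  rw [sq (∑ j, mel φ ω f j j), Finset.sum_mul_sum]
  ring

end ortho

/-! ### Part 2: one dimensional integrals with Jacobi weights -/

/-- The Jacobi weight on `(0,1)`. -/
noncomputable def wt (a b t : ℝ) : ℝ := t ^ a * (1 - t) ^ b

/-- Integral of `g` against the Jacobi weight. -/
noncomputable def II (a b : ℝ) (g : ℝ → ℝ) : ℝ := ∫ t in Set.Ioo (0 : ℝ) 1, g t * wt a b t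

/-- Functions on `(0,1)` with at most logarithmic-type growth at the end points. -/
def Tame (g : ℝ → ℝ) : Prop :=
  AEStronglyMeasurable g (volume.restrict (Set.Ioo (0 : ℝ) 1)) ∧
  ∀ δ > 0, ∃ C, ∀ t ∈ Set.Ioo (0 : ℝ) 1, |g t| ≤ C * wt (-δ) (-δ) t

theorem wt_pos {a b t : ℝ} (ht : t ∈ Set.Ioo (0 : ℝ) 1) : 0 < wt a b t :=
  mul_pos (rpow_pos_of_pos ht.1 _) (rpow_pos_of_pos (by linarith [ht.2]) _)

theorem wt_mul {a b c d t : ℝ} (ht : t ∈ Set.Ioo (0 : ℝ) 1) :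
    wt a b t * wt c d t = wt (a + c) (b + d) t := by
  unfold wt
  rw [rpow_add ht.1, rpow_add (by linarith [ht.2] : 0 < 1 - t)]; ring

theorem wt_anti {a b c d t : ℝ} (ht : t ∈ Set.Ioo (0 : ℝ) 1) (hac : a ≤ c) (hbd : b ≤ d) :
    wt c d t ≤ wt a b t := by
  unfold wt
  have h1 : 0 < 1 - t := by linarith [ht.2]
  have h2 : 1 - t ≤ 1 := by linarith [ht.1]
  exact mul_le_mul (rpow_le_rpow_of_exponent_ge ht.1 ht.2.le hac)
    (rpow_le_rpow_of_exponent_ge h1 h2 hbd) (rpow_pos_of_pos h1 _).le (rpow_pos_of_pos ht.1 _).le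

theorem wt_cont {a b : ℝ} : ContinuousOn (wt a b) (Set.Ioo (0 : ℝ) 1) := by
  intro t ht
  apply ContinuousAt.continuousWithinAt
  unfold wt
  have h1 : 1 - t ≠ 0 := by linarith [ht.2]
  exact (continuousAt_rpow_const t a (Or.inl ht.1.ne')).mul
    (ContinuousAt.rpow_const (by fun_prop) (Or.inl h1))

theorem wt_meas {a b : ℝ} :
    AEStronglyMeasurable (wt a b) (volume.restrict (Set.Ioo (0 : ℝ) 1)) :=
  wt_cont.aestronglyMeasurable measurableSet_Ioo

theorem wt_integrable {a b : ℝ} (ha : -1 < a) (hb : -1 < b) :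
    IntegrableOn (wt a b) (Set.Ioo (0 : ℝ) 1) := by
  have h := (Complex.betaIntegral_convergent (u := ((a + 1 : ℝ) : ℂ)) (v := ((b + 1 : ℝ) : ℂ))
    (by simp; linarith) (by simp; linarith))
  rw [intervalIntegrable_iff_integrableOn_Ioo_of_le zero_le_one] at h
  refine h.norm.congr ?_
  refine (ae_restrict_iff' measurableSet_Ioo).2 (Filter.Eventually.of_forall fun t ht => ?_)
  have h1 : 0 < 1 - t := by linarith [ht.2]
  simp only [norm_mul]
  rw [Complex.norm_cpow_eq_rpow_re_of_pos ht.1]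
  have e : (1 - (t : ℂ)) = ((1 - t : ℝ) : ℂ) := by push_cast; ring
  rw [e, Complex.norm_cpow_eq_rpow_re_of_pos h1]
  simp [wt]

theorem Tame.integrable {g : ℝ → ℝ} (hg : Tame g) {a b : ℝ} (ha : -1 < a) (hb : -1 < b) :
    IntegrableOn (fun t => g t * wt a b t) (Set.Ioo (0 : ℝ) 1) := by
  obtain ⟨δ, hδ, h1, h2⟩ : ∃ δ > 0, -1 < a - δ ∧ -1 < b - δ := by
    refine ⟨min (a + 1) (b + 1) / 2, ?_, ?_, ?_⟩
    · have : 0 < min (a + 1) (b + 1) := lt_min (by linarith) (by linarith)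
      linarith
    · have := min_le_left (a + 1) (b + 1); linarith
    · have := min_le_right (a + 1) (b + 1); linarith
  obtain ⟨C, hC⟩ := hg.2 δ hδ
  refine Integrable.mono' ((wt_integrable h1 h2).const_mul C) (hg.1.mul wt_meas) ?_
  refine (ae_restrict_iff' measurableSet_Ioo).2 (Filter.Eventually.of_forall fun t ht => ?_)
  rw [norm_mul, Real.norm_eq_abs, Real.norm_eq_abs, abs_of_pos (wt_pos ht)]
  calc |g t| * wt a b t ≤ C * wt (-δ) (-δ) t * wt a b t :=
        mul_le_mul_of_nonneg_right (hC t ht) (wt_pos ht).le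
    _ = _ := by rw [mul_assoc, wt_mul ht]; ring_nf

theorem Tame.add {g h : ℝ → ℝ} (hg : Tame g) (hh : Tame h) : Tame (fun t => g t + h t) := by
  refine ⟨hg.1.add hh.1, fun δ hδ => ?_⟩
  obtain ⟨C, hC⟩ := hg.2 δ hδ
  obtain ⟨D, hD⟩ := hh.2 δ hδ
  refine ⟨C + D, fun t ht => ?_⟩
  have := abs_add_le (g t) (h t)
  linarith [hC t ht, hD t ht, add_mul C D (wt (-δ) (-δ) t)]

theorem Tame.mul {g h : ℝ → ℝ} (hg : Tame g) (hh : Tame h) : Tame (fun t => g t * h t) := by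
  refine ⟨hg.1.mul hh.1, fun δ hδ => ?_⟩
  obtain ⟨C, hC⟩ := hg.2 (δ / 2) (by linarith)
  obtain ⟨D, hD⟩ := hh.2 (δ / 2) (by linarith)
  refine ⟨C * D, fun t ht => ?_⟩
  rw [abs_mul]
  calc |g t| * |h t| ≤ (C * wt (-(δ/2)) (-(δ/2)) t) * (D * wt (-(δ/2)) (-(δ/2)) t) :=
        mul_le_mul (hC t ht) (hD t ht) (abs_nonneg _) ((abs_nonneg _).trans (hC t ht))
    _ = C * D * (wt (-(δ/2)) (-(δ/2)) t * wt (-(δ/2)) (-(δ/2)) t) := by ring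
    _ = _ := by rw [wt_mul ht]; ring_nf

theorem Tame.of_continuousOn {g : ℝ → ℝ} (hg : ContinuousOn g (Set.Icc 0 1)) : Tame g := by
  refine ⟨(hg.mono Set.Ioo_subset_Icc_self).aestronglyMeasurable measurableSet_Ioo,
    fun δ hδ => ?_⟩
  obtain ⟨C, hC⟩ := isCompact_Icc.exists_bound_of_continuousOn hg
  refine ⟨|C|, fun t ht => ?_⟩
  have h1 : 1 ≤ wt (-δ) (-δ) t := by
    have := wt_anti (a := -δ) (b := -δ) (c := 0) (d := 0) ht (by linarith) (by linarith)
    simpa [wt] using this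
  have h2 := hC t (Set.Ioo_subset_Icc_self ht)
  rw [Real.norm_eq_abs] at h2
  nlinarith [le_abs_self C, abs_nonneg C]

theorem Tame.const (c : ℝ) : Tame (fun _ => c) := Tame.of_continuousOn continuousOn_const

theorem Tame.id' : Tame (fun t => t) := Tame.of_continuousOn continuousOn_id

theorem Tame.poly (q : Polynomial ℝ) : Tame (fun t => q.eval t) :=
  Tame.of_continuousOn q.continuous.continuousOn

theorem Tame.sub {g h : ℝ → ℝ} (hg : Tame g) (hh : Tame h) : Tame (fun t => g t - h t) := by
  have := hg.add ((Tame.const (-1)).mul hh)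
  convert this using 2; ring

theorem Tame.log : Tame (fun t => Real.log t) := by
  refine ⟨?_, fun δ hδ => ⟨1 / δ, fun t ht => ?_⟩⟩
  · exact (Real.measurable_log).aestronglyMeasurable
  · have h := abs_log_mul_self_rpow_lt t δ ht.1 ht.2.le hδ
    rw [abs_mul, abs_of_pos (rpow_pos_of_pos ht.1 _)] at h
    have h2 : |Real.log t| ≤ 1 / δ * t ^ (-δ) := by
      rw [rpow_neg ht.1.le, ← div_eq_mul_inv, le_div_iff₀ (rpow_pos_of_pos ht.1 _)]
      exact h.le
    have h3 : t ^ (-δ) ≤ wt (-δ) (-δ) t := by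
      have := wt_anti (a := -δ) (b := -δ) (c := -δ) (d := 0) ht le_rfl (by linarith)
      simpa [wt] using this
    have : 0 < 1 / δ := by positivity
    exact h2.trans (mul_le_mul_of_nonneg_left h3 this.le)

theorem Tame.log' : Tame (fun t => Real.log (1 - t)) := by
  refine ⟨?_, fun δ hδ => ?_⟩
  · exact (Real.measurable_log.comp (measurable_const.sub measurable_id)).aestronglyMeasurable
  · obtain ⟨C, hC⟩ := Tame.log.2 δ hδ
    refine ⟨C, fun t ht => ?_⟩
    have := hC (1 - t) ⟨by linarith [ht.2], by linarith [ht.1]⟩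
    simpa [wt, mul_comm] using this

theorem Tame.congr {g h : ℝ → ℝ} (hg : Tame g) (e : ∀ t, g t = h t) : Tame h := by
  have : g = h := funext e
  rwa [← this]

theorem II_congr {a b : ℝ} {g h : ℝ → ℝ} (e : ∀ t ∈ Set.Ioo (0 : ℝ) 1, g t = h t) :
    II a b g = II a b h := by
  unfold II
  refine setIntegral_congr_fun measurableSet_Ioo fun t ht => ?_
  simp only [e t ht]

theorem II_add {a b : ℝ} (ha : -1 < a) (hb : -1 < b) {g h : ℝ → ℝ} (hg : Tame g) (hh : Tame h) :
    II a b (fun t => g t + h t) = II a b g + II a b h := by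
  unfold II
  rw [← integral_add (hg.integrable ha hb) (hh.integrable ha hb)]
  congr 1; ext t; ring

theorem II_smul {a b : ℝ} (c : ℝ) (g : ℝ → ℝ) :
    II a b (fun t => c * g t) = c * II a b g := by
  unfold II
  rw [← integral_const_mul]
  congr 1; ext t; ring

theorem II_sum {a b : ℝ} (ha : -1 < a) (hb : -1 < b) {ι : Type*} (s : Finset ι)
    (g : ι → ℝ → ℝ) (hg : ∀ i ∈ s, Tame (g i)) :
    II a b (fun t => ∑ i ∈ s, g i t) = ∑ i ∈ s, II a b (g i) := by
  unfold II
  rw [← integral_finsetSum _ (fun i hi => (hg i hi).integrable ha hb)]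
  congr 1; ext t; rw [Finset.sum_mul]

theorem II_shift (a b : ℝ) (g : ℝ → ℝ) :
    II (a + 1) b g = II a b (fun t => t * g t) := by
  unfold II
  refine setIntegral_congr_fun measurableSet_Ioo fun t ht => ?_
  simp only [wt]
  rw [rpow_add ht.1, rpow_one]; ring

theorem II_shift' (a b : ℝ) (g : ℝ → ℝ) :
    II a (b + 1) g = II a b (fun t => (1 - t) * g t) := by
  unfold II
  refine setIntegral_congr_fun measurableSet_Ioo fun t ht => ?_
  simp only [wt]
  rw [rpow_add (by linarith [ht.2] : 0 < 1 - t), rpow_one]; ring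

/-- derivative of the weight exponent -/
noncomputable def lg (u v t : ℝ) : ℝ := u * Real.log t + v * Real.log (1 - t)

theorem Tame.lg (u v : ℝ) : Tame (lg u v) :=
  ((Tame.const u).mul Tame.log).add ((Tame.const v).mul Tame.log')

theorem II_hasDerivAt {a b : ℝ} (ha : -1 < a) (hb : -1 < b) (u v : ℝ) {g : ℝ → ℝ} (hg : Tame g) :
    HasDerivAt (fun τ : ℝ => II (a + τ * u) (b + τ * v) g) (II a b (fun t => g t * lg u v t)) 0 := by
  obtain ⟨δ, hδ, h1, h2⟩ : ∃ δ > 0, -1 < a - 2 * δ ∧ -1 < b - 2 * δ := by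
    refine ⟨min (a + 1) (b + 1) / 4, ?_, ?_, ?_⟩
    · have : 0 < min (a + 1) (b + 1) := lt_min (by linarith) (by linarith)
      linarith
    · have := min_le_left (a + 1) (b + 1); linarith
    · have := min_le_right (a + 1) (b + 1); linarith
  obtain ⟨C, hC⟩ := (hg.mul (Tame.lg u v)).2 δ hδ
  set ε := δ / (|u| + |v| + 1) with hε
  have hK : 0 < |u| + |v| + 1 := by positivity
  have hε0 : 0 < ε := by positivity
  have hεu : ∀ τ ∈ Metric.ball (0:ℝ) ε, -δ ≤ τ * u ∧ -δ ≤ τ * v := by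
    intro τ hτ
    have h3 : |τ| < ε := by simpa using hτ
    have h4 : |τ| * (|u| + |v| + 1) < δ := by
      rw [hε, lt_div_iff₀ hK] at h3; exact h3
    have h5 : |τ * u| ≤ δ := by rw [abs_mul]; nlinarith [abs_nonneg τ, abs_nonneg u, abs_nonneg v]
    have h6 : |τ * v| ≤ δ := by rw [abs_mul]; nlinarith [abs_nonneg τ, abs_nonneg u, abs_nonneg v]
    exact ⟨(abs_le.1 h5).1, (abs_le.1 h6).1⟩
  have key := (hasDerivAt_integral_of_dominated_loc_of_deriv_le
    (μ := volume.restrict (Set.Ioo (0:ℝ) 1)) (x₀ := (0:ℝ)) (s := Metric.ball 0 ε)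
    (F := fun τ t => g t * wt (a + τ * u) (b + τ * v) t)
    (F' := fun τ t => g t * lg u v t * wt (a + τ * u) (b + τ * v) t)
    (bound := fun t => C * wt (a - 2 * δ) (b - 2 * δ) t)
    (Metric.ball_mem_nhds 0 hε0) ?_ ?_ ?_ ?_ ?_ ?_).2
  · simpa [II] using key
  · exact Filter.Eventually.of_forall fun τ => hg.1.mul wt_meas
  · have := hg.integrable ha hb
    simp only [zero_mul, add_zero]
    exact this
  · exact (hg.1.mul (Tame.lg u v).1).mul wt_meas
  · refine (ae_restrict_iff' measurableSet_Ioo).2 (Filter.Eventually.of_forall fun t ht τ hτ => ?_)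
    have h3 := hεu τ hτ
    rw [norm_mul, Real.norm_eq_abs, Real.norm_eq_abs, abs_of_pos (wt_pos ht)]
    have hC' := hC t ht
    have hC0 : 0 ≤ C * wt (-δ) (-δ) t := (abs_nonneg _).trans hC'
    calc |g t * lg u v t| * wt (a + τ * u) (b + τ * v) t
        ≤ (C * wt (-δ) (-δ) t) * wt (a - δ) (b - δ) t :=
          mul_le_mul hC' (wt_anti ht (by linarith [h3.1]) (by linarith [h3.2])) (wt_pos ht).le hC0
      _ = _ := by rw [mul_assoc, wt_mul ht]; ring_nf
  · exact (wt_integrable h1 h2).const_mul C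
  · refine (ae_restrict_iff' measurableSet_Ioo).2 (Filter.Eventually.of_forall fun t ht τ hτ => ?_)
    have ht1 : 0 < 1 - t := by linarith [ht.2]
    have e1 : HasDerivAt (fun τ : ℝ => t ^ (a + τ * u)) (t ^ (a + τ * u) * (u * Real.log t)) τ := by
      have := (((hasDerivAt_id τ).mul_const u).const_add a).const_rpow ht.1
      refine this.congr_deriv ?_
      simp only [id]; ring
    have e2 : HasDerivAt (fun τ : ℝ => (1 - t) ^ (b + τ * v))
        ((1 - t) ^ (b + τ * v) * (v * Real.log (1 - t))) τ := by
      have := (((hasDerivAt_id τ).mul_const v).const_add b).const_rpow ht1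
      refine this.congr_deriv ?_
      simp only [id]; ring
    have := (e1.mul e2).const_mul (g t)
    refine this.congr_deriv ?_
    simp only [wt, lg]; ring

theorem II_parts {a b : ℝ} (ha : -1 < a) (hb : -1 < b) {h h' : ℝ → ℝ}
    (hc : ContinuousOn h (Set.Icc 0 1)) (hd : ∀ t ∈ Set.Ioo (0:ℝ) 1, HasDerivAt h (h' t) t)
    (hh' : Tame h') (q : Polynomial ℝ) :
    II a b (fun t => h' t * (t * (1 - t) * q.eval t)) +
    II a b (fun t => h t * (t * (1 - t) * q.derivative.eval t +
      ((a + 1) - (a + b + 2) * t) * q.eval t)) = 0 := by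
  have hh := Tame.of_continuousOn hc
  have T1 : Tame (fun t => h' t * (t * (1 - t) * q.eval t)) :=
    hh'.mul ((Tame.id'.mul ((Tame.const 1).sub Tame.id')).mul (Tame.poly q))
  have T2 : Tame (fun t => h t * (t * (1 - t) * q.derivative.eval t +
      ((a + 1) - (a + b + 2) * t) * q.eval t)) :=
    hh.mul (((Tame.id'.mul ((Tame.const 1).sub Tame.id')).mul (Tame.poly _)).add
      (((Tame.const _).sub ((Tame.const _).mul Tame.id')).mul (Tame.poly q)))
  rw [← II_add ha hb T1 T2]
  have hI := (T1.add T2).integrable ha hb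
  unfold II
  rw [← integral_Ioc_eq_integral_Ioo, ← intervalIntegral.integral_of_le zero_le_one]
  rw [intervalIntegral.integral_eq_sub_of_hasDerivAt_of_le zero_le_one
    (f := fun t => h t * (t ^ (a + 1) * (1 - t) ^ (b + 1)) * q.eval t)]
  · have ha' : a + 1 ≠ 0 := by linarith
    have hb' : b + 1 ≠ 0 := by linarith
    simp [zero_rpow ha', zero_rpow hb']
  · refine (hc.mul ?_).mul q.continuous.continuousOn
    apply Continuous.continuousOn
    exact (continuous_rpow_const (by linarith)).mul
      ((continuous_rpow_const (by linarith)).comp (by fun_prop : Continuous fun t : ℝ => 1 - t))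
  · intro t ht
    have ht1 : 0 < 1 - t := by linarith [ht.2]
    have e1 : HasDerivAt (fun t : ℝ => t ^ (a + 1)) ((a + 1) * t ^ a) t := by
      have := Real.hasDerivAt_rpow_const (x := t) (p := a + 1) (Or.inl ht.1.ne')
      simpa using this
    have e2 : HasDerivAt (fun t : ℝ => (1 - t) ^ (b + 1)) (-((b + 1) * (1 - t) ^ b)) t := by
      have := ((hasDerivAt_id t).const_sub 1).rpow_const (p := b + 1) (Or.inl ht1.ne')
      refine this.congr_deriv ?_
      simp only [id, add_sub_cancel_right]; ring
    have := ((hd t ht).mul (e1.mul e2)).mul (q.hasDerivAt t)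
    refine this.congr_deriv ?_
    simp only [wt, Pi.mul_apply]
    rw [rpow_add ht.1, rpow_one, rpow_add ht1, rpow_one]
    ring
  · rw [intervalIntegrable_iff_integrableOn_Ioo_of_le zero_le_one]
    exact hI

theorem II_pos {a b : ℝ} (ha : -1 < a) (hb : -1 < b) : 0 < II a b (fun _ => 1) := by
  unfold II
  rw [setIntegral_pos_iff_support_of_nonneg_ae]
  · have : Function.support (fun t => (1:ℝ) * wt a b t) ∩ Set.Ioo (0:ℝ) 1 = Set.Ioo 0 1 := by
      ext t
      simp only [Set.mem_inter_iff, Function.mem_support, and_iff_right_iff_imp]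
      intro ht
      have := wt_pos (a := a) (b := b) ht
      rw [one_mul]; exact this.ne'
    rw [this]; simp
  · refine (ae_restrict_iff' measurableSet_Ioo).2 (Filter.Eventually.of_forall fun t ht => ?_)
    simpa using (wt_pos ht).le
  · simpa using (Tame.const 1).integrable ha hb

/-! ### Part 3: Jacobi polynomials on `(0,1)` -/

/-- Mean of the sum of the points. -/
noncomputable def Xm (a b : ℝ) (j : ℕ) : ℝ := j * (j + a) / (2 * j + a + b)

/-- Diagonal recurrence coefficient. -/
noncomputable def al (a b : ℝ) (j : ℕ) : ℝ := Xm a b (j + 1) - Xm a b j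

/-- Off-diagonal recurrence coefficient. -/
noncomputable def be (a b : ℝ) (j : ℕ) : ℝ :=
  j * (j + a) * (j + b) * (j + a + b) / ((2 * j + a + b) ^ 2 * ((2 * j + a + b) ^ 2 - 1))

/-- Monic Jacobi polynomials on `(0,1)`. -/
noncomputable def PP (a b : ℝ) : ℕ → Polynomial ℝ
  | 0 => 1
  | 1 => Polynomial.X - Polynomial.C (al a b 0)
  | (j + 2) => (Polynomial.X - Polynomial.C (al a b (j + 1))) * PP a b (j + 1) -
      Polynomial.C (be a b (j + 1)) * PP a b j

/-- Evaluation of the Jacobi polynomials. -/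
noncomputable def pe (a b : ℝ) (j : ℕ) (t : ℝ) : ℝ := (PP a b j).eval t

theorem be_zero (a b : ℝ) : be a b 0 = 0 := by simp [be]

theorem Xm_zero (a b : ℝ) : Xm a b 0 = 0 := by simp [Xm]

theorem pe_zero (a b t : ℝ) : pe a b 0 t = 1 := by simp [pe, PP]

theorem pe_rec (a b : ℝ) (j : ℕ) (t : ℝ) :
    t * pe a b j t = pe a b (j + 1) t + al a b j * pe a b j t + be a b j * pe a b (j - 1) t := by
  cases j with
  | zero => simp [pe, PP, be_zero]
  | succ j =>
    simp only [pe, PP, Polynomial.eval_sub, Polynomial.eval_mul, Polynomial.eval_X,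
      Polynomial.eval_C, Nat.add_sub_cancel]
    ring

theorem be_pos {a b : ℝ} (ha : -(1/2) < a) (hb : -(1/2) < b) (j : ℕ) : 0 < be a b (j + 1) := by
  unfold be
  have hj : (0 : ℝ) ≤ j := Nat.cast_nonneg j
  push_cast
  have h1 : 0 < (j + 1 + a : ℝ) := by linarith
  have h2 : 0 < (j + 1 + b : ℝ) := by linarith
  have h3 : 0 < (j + 1 + a + b : ℝ) := by linarith
  have h4 : 1 < (2 * (j + 1) + a + b : ℝ) := by linarith
  have h5 : 0 < (2 * (j + 1) + a + b : ℝ) ^ 2 - 1 := by nlinarith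
  positivity

theorem two_al {a b : ℝ} (ha : -(1/2) < a) (hb : -(1/2) < b) (j : ℕ) :
    (2 * j + a + b) * al a b j =
      (2 * j + a + b) * ((j + 1) * (j + 1 + a) / (2 * j + 2 + a + b)) - j * (j + a) := by
  unfold al Xm
  rcases Nat.eq_zero_or_pos j with h | h
  · subst h; simp
  · have hj : (1 : ℝ) ≤ j := by exact_mod_cast h
    have h1 : (2 * j + a + b : ℝ) ≠ 0 := by linarith
    have h2 : (2 * j + 2 + a + b : ℝ) ≠ 0 := by linarith
    have h3 : (2 * (j + 1) + a + b : ℝ) ≠ 0 := by linarith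
    push_cast
    field_simp

theorem pe_B_alg (t p0 p1 : ℝ) {x y σ A1 A2 B1 B2 : ℝ} (s1 : σ - 1 ≠ 0) (s2 : σ ≠ 0) (s3 : σ + 1 ≠ 0)
    (s4 : σ + 2 ≠ 0) (s5 : σ + 3 ≠ 0) (s6 : σ + 4 ≠ 0)
    (g1 : A1 = (x + 1) * (y + 1) / (σ + 2) - x * y / σ)
    (g2 : A2 = (x + 2) * (y + 2) / (σ + 4) - (x + 1) * (y + 1) / (σ + 2))
    (g3 : B1 = x * y * (σ - y) * (σ - x) / (σ ^ 2 * ((σ + 1) * (σ - 1))))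
    (g4 : B2 = (x + 1) * (y + 1) * (σ - y + 1) * (σ - x + 1) /
      ((σ + 2) ^ 2 * ((σ + 3) * (σ + 1)))) :
    2 * t * (1 - t) * p1
      + (t - A1) * (-(2 * σ + 2) * ((t - A1) * p1 - B1 * p0)
        + (σ * t - (σ * ((x + 1) * (y + 1) / (σ + 2)) - x * y)) * p1)
      - B1 * (-(2 * σ - 2) * p1
        + ((σ - 2) * t - ((σ - 2) * (x * y / σ) - (x - 1) * (y - 1))) * p0)
      = -(2 * σ + 6) * ((t - A2) * ((t - A1) * p1 - B1 * p0) - B2 * p1) +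
        ((σ + 2) * t - ((σ + 2) * ((x + 2) * (y + 2) / (σ + 4)) - (x + 1) * (y + 1))) *
          ((t - A1) * p1 - B1 * p0) := by
  have c0 : (t - A1) * (2 * σ + 2) - ((σ - 2) * t - ((σ - 2) * (x * y / σ) - (x - 1) * (y - 1)))
      = (2 * σ + 6) * (t - A2) -
        ((σ + 2) * t - ((σ + 2) * ((x + 2) * (y + 2) / (σ + 4)) - (x + 1) * (y + 1))) := by
    rw [g1, g2]; field_simp; ring
  have c1 : 2 * t * (1 - t) - (2 * σ + 2) * (t - A1) ^ 2
      + (σ * t - (σ * ((x + 1) * (y + 1) / (σ + 2)) - x * y)) * (t - A1) + B1 * (2 * σ - 2)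
      = -(2 * σ + 6) * (t - A2) * (t - A1) + (2 * σ + 6) * B2 +
        ((σ + 2) * t - ((σ + 2) * ((x + 2) * (y + 2) / (σ + 4)) - (x + 1) * (y + 1))) * (t - A1) := by
    rw [g1, g2, g3, g4]; field_simp; ring
  linear_combination p1 * c1 + B1 * p0 * c0

theorem pe_B {a b : ℝ} (ha : -(1/2) < a) (hb : -(1/2) < b) (t : ℝ) (j : ℕ) :
    2 * t * (1 - t) * (PP a b j).derivative.eval t + ((a + 1) - (a + b + 2) * t) * pe a b j t
      = -(4 * j + 2 * a + 2 * b + 2) * pe a b (j + 1) t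
        + ((2 * j + a + b) * t - (2 * j + a + b) * al a b j) * pe a b j t := by
  induction j using Nat.strong_induction_on with
  | _ j ih =>
  match j, ih with
  | 0, _ =>
    have h2 : (2 + a + b : ℝ) ≠ 0 := by linarith
    rw [two_al ha hb]
    simp [pe, PP, al, Xm]
    field_simp
    ring
  | 1, _ =>
    have h2 : (2 + a + b : ℝ) ≠ 0 := by linarith
    have h3 : (4 + a + b : ℝ) ≠ 0 := by linarith
    have h4 : (2 * 2 + a + b : ℝ) ≠ 0 := by linarith
    have h5 : ((2 + a + b) ^ 2 - 1 : ℝ) ≠ 0 := by nlinarith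
    have h6 : (2 * (1 + 1) + a + b : ℝ) ≠ 0 := by linarith
    have h7 : (a + b + 4 : ℝ) ≠ 0 := by linarith
    have h8 : (1 + a + b : ℝ) ≠ 0 := by linarith
    have h9 : (3 + a + b : ℝ) ≠ 0 := by linarith
    have a0 : al a b 0 = (1 + a) / (2 + a + b) := by simp [al, Xm]
    have a1 : al a b 1 = 2 * (2 + a) / (4 + a + b) - (1 + a) / (2 + a + b) := by
      simp only [al, Xm]; norm_num
    have b1 : be a b 1 = (1 + a) * (1 + b) * (1 + a + b) /
        ((2 + a + b) ^ 2 * ((1 + a + b) * (3 + a + b))) := by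
      simp only [be]; norm_num; congr 1; ring
    simp only [pe, PP, Polynomial.eval_sub, Polynomial.eval_mul, Polynomial.eval_X,
      Polynomial.eval_C, Polynomial.derivative_sub, Polynomial.derivative_X,
      Polynomial.derivative_C, Polynomial.eval_one, Polynomial.eval_zero]
    rw [a0, a1, b1]
    field_simp
    ring
  | j + 2, ih =>
    have i0 := ih j (by omega)
    have i1 := ih (j + 1) (by omega)
    have hj : (0 : ℝ) ≤ j := Nat.cast_nonneg j
    have r1 : pe a b (j + 2) t = (t - al a b (j + 1)) * pe a b (j + 1) t -
        be a b (j + 1) * pe a b j t := by simp [pe, PP]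
    have r2 : pe a b (j + 2 + 1) t = (t - al a b (j + 2)) * pe a b (j + 2) t -
        be a b (j + 2) * pe a b (j + 1) t := by simp [pe, PP]
    have d1 : (PP a b (j + 2)).derivative.eval t = pe a b (j + 1) t +
        (t - al a b (j + 1)) * (PP a b (j + 1)).derivative.eval t
        - be a b (j + 1) * (PP a b j).derivative.eval t := by
      simp [pe, PP]
    rw [two_al ha hb] at i0 i1 ⊢
    rw [d1, r2]
    have hs0 : 0 < (2 * j + 2 + a + b : ℝ) := by linarith
    have e1 : al a b (j + 1) = (j + 2) * (j + 2 + a) / (2 * j + 4 + a + b)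
        - (j + 1) * (j + 1 + a) / (2 * j + 2 + a + b) := by
      simp only [al, Xm]; push_cast; ring_nf
    have e2 : al a b (j + 2) = (j + 3) * (j + 3 + a) / (2 * j + 6 + a + b)
        - (j + 2) * (j + 2 + a) / (2 * j + 4 + a + b) := by
      simp only [al, Xm]; push_cast; ring_nf
    have e3 : be a b (j + 1) = (j + 1) * (j + 1 + a) * (j + 1 + b) * (j + 1 + a + b) /
        ((2 * j + 2 + a + b) ^ 2 * ((2 * j + 3 + a + b) * (2 * j + 1 + a + b))) := by
      simp only [be]; push_cast; congr 1; ring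
    have e4 : be a b (j + 2) = (j + 2) * (j + 2 + a) * (j + 2 + b) * (j + 2 + a + b) /
        ((2 * j + 4 + a + b) ^ 2 * ((2 * j + 5 + a + b) * (2 * j + 3 + a + b))) := by
      simp only [be]; push_cast; congr 1; ring
    have n1 : (2 * j + 1 + a + b : ℝ) ≠ 0 := by linarith
    have n2 : (2 * j + 2 + a + b : ℝ) ≠ 0 := by linarith
    have n3 : (2 * j + 3 + a + b : ℝ) ≠ 0 := by linarith
    have n4 : (2 * j + 4 + a + b : ℝ) ≠ 0 := by linarith
    have n5 : (2 * j + 5 + a + b : ℝ) ≠ 0 := by linarith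
    have n6 : (2 * j + 6 + a + b : ℝ) ≠ 0 := by linarith
    rw [r1] at i1 ⊢
    push_cast at i0 i1 ⊢
    generalize pe a b (j + 1) t = p1 at *
    generalize pe a b j t = p0 at *
    generalize (PP a b j).derivative.eval t = D0 at *
    generalize (PP a b (j + 1)).derivative.eval t = D1 at *
    have k1 : (2 * (j + 1 + a / 2 + b / 2) : ℝ) = 2 * j + 2 + a + b := by ring
    have f1 : (2 * (j + 1) + 2 + a + b : ℝ) = 2 * j + 4 + a + b := by ring
    have f2 : (2 * (j + 2) + 2 + a + b : ℝ) = 2 * j + 6 + a + b := by ring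
    rw [f1] at i1
    rw [f2]
    have main : 2 * t * (1 - t) * p1
        + (t - al a b (j+1)) * (-(4 * (j + 1) + 2 * a + 2 * b + 2) *
            ((t - al a b (j+1)) * p1 - be a b (j+1) * p0)
          + ((2 * (j + 1) + a + b) * t - ((2 * (j + 1) + a + b) * ((j + 1 + 1) * (j + 1 + 1 + a) /
            (2 * j + 4 + a + b)) - (j + 1) * (j + 1 + a))) * p1)
        - be a b (j+1) * (-(4 * j + 2 * a + 2 * b + 2) * p1
          + ((2 * j + a + b) * t - ((2 * j + a + b) * ((j + 1) * (j + 1 + a) /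
            (2 * j + 2 + a + b)) - j * (j + a))) * p0)
        = -(4 * (j + 2) + 2 * a + 2 * b + 2) *
          ((t - al a b (j + 2)) * ((t - al a b (j+1)) * p1 - be a b (j+1) * p0)
            - be a b (j + 2) * p1) +
          ((2 * (j + 2) + a + b) * t - ((2 * (j + 2) + a + b) * ((j + 2 + 1) * (j + 2 + 1 + a) /
            (2 * j + 6 + a + b)) - (j + 2) * (j + 2 + a))) *
            ((t - al a b (j+1)) * p1 - be a b (j+1) * p0) := by
      have e1' : al a b (j + 1) = ((j + 1) + 1) * ((j + 1 + a) + 1) / ((2 * j + 2 + a + b) + 2)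
          - (j + 1) * (j + 1 + a) / (2 * j + 2 + a + b) := by rw [e1]; ring_nf
      have e2' : al a b (j + 2) = ((j + 1) + 2) * ((j + 1 + a) + 2) / ((2 * j + 2 + a + b) + 4)
          - ((j + 1) + 1) * ((j + 1 + a) + 1) / ((2 * j + 2 + a + b) + 2) := by rw [e2]; ring_nf
      have k := pe_B_alg t p0 p1 (x := j + 1) (y := j + 1 + a) (σ := 2 * j + 2 + a + b)
        (by convert n1 using 1; ring) n2 (by convert n3 using 1; ring)
        (by convert n4 using 1; ring) (by convert n5 using 1; ring) (by convert n6 using 1; ring)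
        e1' e2' (B1 := be a b (j + 1)) (B2 := be a b (j + 2)) (by rw [e3]; ring_nf)
        (by rw [e4]; ring_nf)
      generalize al a b (j + 1) = A1 at *
      generalize al a b (j + 2) = A2 at *
      generalize be a b (j + 1) = B1 at *
      generalize be a b (j + 2) = B2 at *
      clear e1 e2 e3 e4 e1' e2' i0 i1
      ring_nf at k ⊢
      exact k
    linear_combination main + (t - al a b (j+1)) * i1 - be a b (j+1) * i0

/-! ### Part 4: orthogonality and matrix elements -/

theorem pe_B' {a b : ℝ} (ha : -(1/2) < a) (hb : -(1/2) < b) (t : ℝ) (j : ℕ) :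
    2 * t * (1 - t) * (PP a b j).derivative.eval t + ((a + 1) - (a + b + 2) * t) * pe a b j t
      = -(2 * j + a + b + 2) * pe a b (j + 1) t
        + (2 * j + a + b) * be a b j * pe a b (j - 1) t := by
  rw [pe_B ha hb]
  linear_combination (2 * j + a + b) * pe_rec a b j t

theorem pe_A {a b : ℝ} (ha : -(1/2) < a) (hb : -(1/2) < b) (t : ℝ) (j : ℕ) :
    t * (1 - t) * (PP a b j).derivative.derivative.eval t +
      ((a + 1) - (a + b + 2) * t) * (PP a b j).derivative.eval t
      = -(j * (j + a + b + 1)) * pe a b j t := by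
  induction j using Nat.strong_induction_on with
  | _ j ih =>
  match j, ih with
  | 0, _ => simp [PP]
  | 1, _ =>
    have h2 : (2 + a + b : ℝ) ≠ 0 := by linarith
    simp [pe, PP, al, Xm]
    field_simp
    ring
  | j + 2, ih =>
    have i0 := ih j (by omega)
    have i1 := ih (j + 1) (by omega)
    have hB := pe_B' ha hb t (j + 1)
    have r1 : pe a b (j + 2) t = (t - al a b (j + 1)) * pe a b (j + 1) t -
        be a b (j + 1) * pe a b j t := by simp [pe, PP]
    have d1 : (PP a b (j + 2)).derivative.eval t = pe a b (j + 1) t +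
        (t - al a b (j + 1)) * (PP a b (j + 1)).derivative.eval t
        - be a b (j + 1) * (PP a b j).derivative.eval t := by
      simp [pe, PP]
    have d2 : (PP a b (j + 2)).derivative.derivative.eval t =
        2 * (PP a b (j + 1)).derivative.eval t +
        (t - al a b (j + 1)) * (PP a b (j + 1)).derivative.derivative.eval t
        - be a b (j + 1) * (PP a b j).derivative.derivative.eval t := by
      simp [PP]; ring
    rw [d1, d2]
    simp only [Nat.add_sub_cancel] at hB
    rw [show j + 1 + 1 = j + 2 from rfl, r1] at hB
    rw [r1]
    push_cast at *
    linear_combination hB + (t - al a b (j+1)) * i1 - be a b (j+1) * i0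

/-- Matrix elements in the monic orthogonal basis. -/
noncomputable def ip (a b : ℝ) (g : ℝ → ℝ) (j k : ℕ) : ℝ :=
  II a b (fun t => g t * (pe a b j t * pe a b k t))

/-- Squared norms. -/
noncomputable def hh (a b : ℝ) (j : ℕ) : ℝ := ip a b (fun _ => 1) j j

theorem Tame.pe (a b : ℝ) (j : ℕ) : Tame (pe a b j) := Tame.poly (PP a b j)

theorem Tame.ip {g : ℝ → ℝ} (hg : Tame g) (a b : ℝ) (j k : ℕ) :
    Tame (fun t => g t * (_root_.pe a b j t * _root_.pe a b k t)) :=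
  hg.mul ((Tame.pe a b j).mul (Tame.pe a b k))

theorem ip_comm (a b : ℝ) (g : ℝ → ℝ) (j k : ℕ) : ip a b g j k = ip a b g k j := by
  unfold ip
  refine II_congr fun t _ => ?_
  ring

theorem ip_add {a b : ℝ} (ha : -(1/2) < a) (hb : -(1/2) < b) {g h : ℝ → ℝ} (hg : Tame g)
    (hh : Tame h) (j k : ℕ) :
    ip a b (fun t => g t + h t) j k = ip a b g j k + ip a b h j k := by
  unfold ip
  rw [← II_add (by linarith) (by linarith) (hg.ip a b j k) (hh.ip a b j k)]
  refine II_congr fun t _ => ?_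
  ring

theorem ip_smul (a b c : ℝ) (g : ℝ → ℝ) (j k : ℕ) :
    ip a b (fun t => c * g t) j k = c * ip a b g j k := by
  unfold ip
  rw [← II_smul]
  refine II_congr fun t _ => ?_
  ring

theorem ip_congr {a b : ℝ} {g h : ℝ → ℝ} (e : ∀ t ∈ Set.Ioo (0 : ℝ) 1, g t = h t) (j k : ℕ) :
    ip a b g j k = ip a b h j k := by
  unfold ip
  refine II_congr fun t ht => ?_
  rw [e t ht]

theorem ip_rec {a b : ℝ} (ha : -(1/2) < a) (hb : -(1/2) < b) {g : ℝ → ℝ} (hg : Tame g)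
    (j k : ℕ) :
    ip a b (fun t => t * g t) j k =
      ip a b g (j + 1) k + al a b j * ip a b g j k + be a b j * ip a b g (j - 1) k := by
  unfold ip
  rw [← II_smul, ← II_smul, ← II_add (by linarith) (by linarith) (hg.ip a b _ k)
    ((Tame.const _).mul (hg.ip a b _ k)), ← II_add (by linarith) (by linarith)
    ((hg.ip a b _ k).add ((Tame.const _).mul (hg.ip a b _ k)))
    ((Tame.const _).mul (hg.ip a b _ k))]
  refine II_congr fun t _ => ?_
  have := pe_rec a b j t
  linear_combination g t * pe a b k t * this

theorem ip_orth {a b : ℝ} (ha : -(1/2) < a) (hb : -(1/2) < b) {j k : ℕ} (hjk : j ≠ k) :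
    ip a b (fun _ => 1) j k = 0 := by
  have key : ∀ j k, II a b (fun t => (PP a b k).derivative.eval t *
      (t * (1 - t) * (PP a b j).derivative.eval t)) =
      (j * (j + a + b + 1)) * ip a b (fun _ => 1) j k := by
    intro j k
    have h1 := II_parts (a := a) (b := b) (by linarith) (by linarith)
      (h := fun t => (PP a b k).eval t) (h' := fun t => (PP a b k).derivative.eval t)
      (PP a b k).continuous.continuousOn (fun t _ => (PP a b k).hasDerivAt t)
      (Tame.poly _) (PP a b j).derivative
    have h2 : II a b (fun t => (PP a b k).eval t *
        (t * (1 - t) * (PP a b j).derivative.derivative.eval t +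
          ((a + 1) - (a + b + 2) * t) * (PP a b j).derivative.eval t)) =
        -(j * (j + a + b + 1)) * ip a b (fun _ => 1) j k := by
      unfold ip
      rw [← II_smul]
      refine II_congr fun t _ => ?_
      rw [pe_A ha hb]
      simp only [pe]; ring
    rw [h2] at h1
    linarith
  have h1 := key j k
  have h2 := key k j
  have h3 : II a b (fun t => (PP a b k).derivative.eval t *
      (t * (1 - t) * (PP a b j).derivative.eval t)) = II a b (fun t => (PP a b j).derivative.eval t *
      (t * (1 - t) * (PP a b k).derivative.eval t)) := by
    refine II_congr fun t _ => ?_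
    ring
  rw [h1, h2, ip_comm a b _ k j] at h3
  have h4 : ((j : ℝ) - k) * (j + k + a + b + 1) * ip a b (fun _ => 1) j k = 0 := by
    linear_combination h3
  have h5 : (j : ℝ) - k ≠ 0 := by
    rw [sub_ne_zero]; exact_mod_cast hjk
  have h6 : (j + k + a + b + 1 : ℝ) ≠ 0 := by
    have := Nat.cast_nonneg (α := ℝ) j
    have := Nat.cast_nonneg (α := ℝ) k
    linarith
  rcases mul_eq_zero.1 h4 with h | h
  · exact absurd h (mul_ne_zero h5 h6)
  · exact h

theorem ip_one {a b : ℝ} (ha : -(1/2) < a) (hb : -(1/2) < b) (j k : ℕ) :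
    ip a b (fun _ => 1) j k = if j = k then hh a b j else 0 := by
  split_ifs with h
  · rw [← h, hh]
  · exact ip_orth ha hb h

theorem hh_zero (a b : ℝ) : hh a b 0 = II a b (fun _ => 1) := by
  unfold hh ip
  refine II_congr fun t _ => ?_
  simp [pe_zero]

theorem hh_succ {a b : ℝ} (ha : -(1/2) < a) (hb : -(1/2) < b) (j : ℕ) :
    hh a b (j + 1) = be a b (j + 1) * hh a b j := by
  have h1 := ip_rec ha hb (Tame.const 1) j (j + 1)
  have h2 := ip_rec ha hb (Tame.const 1) (j + 1) j
  rw [ip_comm, h1] at h2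
  simp only [ip_one ha hb] at h2
  simp at h2
  rcases j with - | j
  · simp at h2; exact h2
  · simp [show ¬ (j + 1 + 1 = j) by omega] at h2
    exact h2

theorem hh_pos {a b : ℝ} (ha : -(1/2) < a) (hb : -(1/2) < b) (j : ℕ) : 0 < hh a b j := by
  induction j with
  | zero => rw [hh_zero]; exact II_pos (by linarith) (by linarith)
  | succ j ih => rw [hh_succ ha hb]; exact mul_pos (be_pos ha hb j) ih

/-- Mean of a linear statistic. -/
noncomputable def Em (a b : ℝ) (m : ℕ) (g : ℝ → ℝ) : ℝ :=
  ∑ j ∈ range m, ip a b g j j / hh a b j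

/-- Double sum entering the covariance. -/
noncomputable def Dm (a b : ℝ) (m : ℕ) (g k : ℝ → ℝ) : ℝ :=
  ∑ i ∈ range m, ∑ j ∈ range m, ip a b g i j * ip a b k i j / (hh a b i * hh a b j)

/-- Covariance of two linear statistics. -/
noncomputable def Cv (a b : ℝ) (m : ℕ) (g k : ℝ → ℝ) : ℝ :=
  Em a b m (fun t => g t * k t) - Dm a b m g k

/-- Boundary form. -/
noncomputable def Wm (a b : ℝ) (m : ℕ) (g k : ℝ → ℝ) : ℝ :=
  ∑ i ∈ range (m + 1), (ip a b g (m + 1) i * ip a b k m i - ip a b g m i * ip a b k (m + 1) i) /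
    (hh a b i * hh a b m)

theorem green {a b : ℝ} (ha : -(1/2) < a) (hb : -(1/2) < b) (u v τu τv : ℕ → ℝ)
    (hu : ∀ k, τu k = u (k + 1) + al a b k * u k + be a b k * u (k - 1))
    (hv : ∀ k, τv k = v (k + 1) + al a b k * v k + be a b k * v (k - 1)) (m : ℕ) :
    ∑ k ∈ range (m + 1), (τu k * v k - u k * τv k) / hh a b k =
      (u (m + 1) * v m - u m * v (m + 1)) / hh a b m := by
  induction m with
  | zero => simp [hu, hv, be_zero]; congr 1; ring
  | succ m ih =>
    rw [sum_range_succ, ih, hu, hv, hh_succ ha hb]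
    have h1 := (hh_pos ha hb m).ne'
    have h2 := (be_pos ha hb m).ne'
    simp only [Nat.add_sub_cancel]
    field_simp
    ring

theorem ip_rec' {a b : ℝ} (ha : -(1/2) < a) (hb : -(1/2) < b) {g : ℝ → ℝ} (hg : Tame g)
    (j k : ℕ) :
    ip a b (fun t => t * g t) k j =
      ip a b g k (j + 1) + al a b j * ip a b g k j + be a b j * ip a b g k (j - 1) := by
  rw [ip_comm, ip_rec ha hb hg, ip_comm a b g k, ip_comm a b g k, ip_comm a b g k]

theorem Dm_shift {a b : ℝ} (ha : -(1/2) < a) (hb : -(1/2) < b) {g k : ℝ → ℝ} (hg : Tame g)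
    (hk : Tame k) (m : ℕ) :
    Dm a b (m + 1) (fun t => t * g t) k - Dm a b (m + 1) g (fun t => t * k t) =
      Wm a b m g k := by
  unfold Dm Wm
  rw [sum_comm, sum_comm (f := fun i j => ip a b g i j * _ / _), ← sum_sub_distrib]
  refine sum_congr rfl fun i _ => ?_
  rw [← sum_sub_distrib]
  have := green ha hb (fun j => ip a b g j i) (fun j => ip a b k j i)
    (fun j => ip a b (fun t => t * g t) j i) (fun j => ip a b (fun t => t * k t) j i)
    (fun j => ip_rec ha hb hg j i) (fun j => ip_rec ha hb hk j i) m
  rw [show ∀ x y z : ℝ, x / (y * z) = x / z / y from fun x y z => by rw [mul_comm, div_div],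
    ← this, sum_div]
  refine sum_congr rfl fun j _ => ?_
  have h1 := (hh_pos ha hb i).ne'
  have h2 := (hh_pos ha hb j).ne'
  field_simp

theorem Wm_shift {a b : ℝ} (ha : -(1/2) < a) (hb : -(1/2) < b) {g k : ℝ → ℝ} (hg : Tame g)
    (hk : Tame k) (m : ℕ) :
    Wm a b m (fun t => t * g t) k - Wm a b m g (fun t => t * k t) =
      (ip a b g (m+1) (m+1) * ip a b k m m - ip a b g (m+1) m * ip a b k m (m+1)
      - ip a b g m (m+1) * ip a b k (m+1) m + ip a b g m m * ip a b k (m+1) (m+1)) /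
        (hh a b m) ^ 2 := by
  have e1 := green ha hb (fun j => ip a b g (m+1) j) (fun j => ip a b k m j)
    (fun j => ip a b (fun t => t * g t) (m+1) j) (fun j => ip a b (fun t => t * k t) m j)
    (fun j => ip_rec' ha hb hg j _) (fun j => ip_rec' ha hb hk j _) m
  have e2 := green ha hb (fun j => ip a b g m j) (fun j => ip a b k (m+1) j)
    (fun j => ip a b (fun t => t * g t) m j) (fun j => ip a b (fun t => t * k t) (m+1) j)
    (fun j => ip_rec' ha hb hg j _) (fun j => ip_rec' ha hb hk j _) m
  have h0 := (hh_pos ha hb m).ne'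
  have : Wm a b m (fun t => t * g t) k - Wm a b m g (fun t => t * k t) =
      (∑ j ∈ range (m + 1), (ip a b (fun t => t * g t) (m+1) j * ip a b k m j -
        ip a b g (m+1) j * ip a b (fun t => t * k t) m j) / hh a b j) / hh a b m -
      (∑ j ∈ range (m + 1), (ip a b (fun t => t * g t) m j * ip a b k (m+1) j -
        ip a b g m j * ip a b (fun t => t * k t) (m+1) j) / hh a b j) / hh a b m := by
    unfold Wm
    rw [sum_div, sum_div, ← sum_sub_distrib, ← sum_sub_distrib]
    refine sum_congr rfl fun j _ => ?_
    have h1 := (hh_pos ha hb j).ne'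
    field_simp
    ring
  rw [this, e1, e2]
  field_simp
  ring

theorem Wm_anti (a b : ℝ) (m : ℕ) (g k : ℝ → ℝ) : Wm a b m g k = - Wm a b m k g := by
  unfold Wm
  rw [← sum_neg_distrib]
  refine sum_congr rfl fun i _ => ?_
  ring

theorem Em_congr {a b : ℝ} {m : ℕ} {g h : ℝ → ℝ} (e : ∀ t ∈ Set.Ioo (0:ℝ) 1, g t = h t) :
    Em a b m g = Em a b m h := by
  unfold Em
  exact sum_congr rfl fun j _ => by rw [ip_congr e]

theorem Em_add {a b : ℝ} (ha : -(1/2) < a) (hb : -(1/2) < b) {g h : ℝ → ℝ} (hg : Tame g)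
    (hh : Tame h) (m : ℕ) :
    Em a b m (fun t => g t + h t) = Em a b m g + Em a b m h := by
  unfold Em
  rw [← sum_add_distrib]
  exact sum_congr rfl fun j _ => by rw [ip_add ha hb hg hh, add_div]

theorem Em_smul (a b c : ℝ) (g : ℝ → ℝ) (m : ℕ) :
    Em a b m (fun t => c * g t) = c * Em a b m g := by
  unfold Em
  rw [mul_sum]
  exact sum_congr rfl fun j _ => by rw [ip_smul, mul_div_assoc]

theorem Cv_congr {a b : ℝ} {m : ℕ} {g h k : ℝ → ℝ} (e : ∀ t ∈ Set.Ioo (0:ℝ) 1, g t = h t) :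
    Cv a b m g k = Cv a b m h k := by
  unfold Cv Dm
  rw [Em_congr (h := fun t => h t * k t) (fun t ht => by rw [e t ht])]
  simp only [ip_congr e]

theorem Cv_comm (a b : ℝ) (m : ℕ) (g k : ℝ → ℝ) : Cv a b m g k = Cv a b m k g := by
  unfold Cv Dm
  rw [Em_congr (h := fun t => k t * g t) (fun t ht => mul_comm _ _)]
  simp only [mul_comm (ip a b g _ _)]

theorem Cv_add {a b : ℝ} (ha : -(1/2) < a) (hb : -(1/2) < b) {g h k : ℝ → ℝ} (hg : Tame g)
    (hh : Tame h) (hk : Tame k) (m : ℕ) :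
    Cv a b m (fun t => g t + h t) k = Cv a b m g k + Cv a b m h k := by
  unfold Cv
  rw [Em_congr (h := fun t => g t * k t + h t * k t) (fun t ht => add_mul _ _ _),
    Em_add ha hb (hg.mul hk) (hh.mul hk)]
  have : Dm a b m (fun t => g t + h t) k = Dm a b m g k + Dm a b m h k := by
    unfold Dm
    simp only [← sum_add_distrib, ip_add ha hb hg hh, add_mul, add_div]
  rw [this]; ring

theorem Cv_smul (a b c : ℝ) (g k : ℝ → ℝ) (m : ℕ) :
    Cv a b m (fun t => c * g t) k = c * Cv a b m g k := by
  unfold Cv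
  rw [Em_congr (h := fun t => c * (g t * k t)) (fun t ht => mul_assoc _ _ _), Em_smul]
  have : Dm a b m (fun t => c * g t) k = c * Dm a b m g k := by
    unfold Dm
    simp only [mul_sum, ip_smul, mul_assoc, mul_div_assoc]
  rw [this]; ring

theorem Cv_shift {a b : ℝ} (ha : -(1/2) < a) (hb : -(1/2) < b) {g k : ℝ → ℝ} (hg : Tame g)
    (hk : Tame k) (m : ℕ) :
    Cv a b (m + 1) (fun t => t * g t) k = Cv a b (m + 1) g (fun t => t * k t) - Wm a b m g k := by
  rw [← Dm_shift ha hb hg hk]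
  unfold Cv
  rw [Em_congr (h := fun t => g t * (t * k t)) (fun t ht => by ring)]
  ring

theorem Cv_one {a b : ℝ} (ha : -(1/2) < a) (hb : -(1/2) < b) (k : ℝ → ℝ) (m : ℕ) :
    Cv a b m (fun _ => 1) k = 0 := by
  unfold Cv Em Dm
  rw [sub_eq_zero]
  refine sum_congr rfl fun i hi => ?_
  rw [sum_eq_single i]
  · rw [ip_one ha hb]
    have h1 := (hh_pos ha hb i).ne'
    simp; field_simp
  · intro j _ hj
    rw [ip_orth ha hb hj.symm]; simp
  · intro h; exact absurd hi h

theorem Wm_one {a b : ℝ} (ha : -(1/2) < a) (hb : -(1/2) < b) (k : ℝ → ℝ) (m : ℕ) :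
    Wm a b m (fun _ => 1) k = - ip a b k m (m + 1) / hh a b m := by
  unfold Wm
  rw [sum_eq_single m]
  · rw [ip_one ha hb, ip_one ha hb, ip_comm a b k m (m+1)]
    have h1 := (hh_pos ha hb m).ne'
    simp; field_simp
  · intro j hj hj2
    have : j < m + 1 := by simpa using hj
    rw [ip_orth ha hb hj2.symm, ip_orth ha hb (by omega)]; simp
  · simp

/-- `Cov(t,k)`. -/
theorem Cv_t {a b : ℝ} (ha : -(1/2) < a) (hb : -(1/2) < b) {k : ℝ → ℝ} (hk : Tame k) (m : ℕ) :
    Cv a b (m + 1) (fun t => t) k = ip a b k m (m + 1) / hh a b m := by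
  have := Cv_shift ha hb (Tame.const 1) hk m
  rw [Cv_one ha hb, Wm_one ha hb] at this
  rw [Cv_congr (h := fun t => t * 1) (fun t _ => by ring), this]
  ring

/-- `Cov(t^2,k)`. -/
theorem Cv_tt {a b : ℝ} (ha : -(1/2) < a) (hb : -(1/2) < b) {k : ℝ → ℝ} (hk : Tame k) (m : ℕ) :
    Cv a b (m + 1) (fun t => t * t) k = 2 * Cv a b (m + 1) (fun t => t) (fun t => t * k t)
      - be a b (m + 1) * (ip a b k (m+1) (m+1) / hh a b (m+1) + ip a b k m m / hh a b m) := by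
  rw [Cv_shift ha hb Tame.id' hk]
  have h2 := Wm_shift ha hb (Tame.const 1) hk m
  rw [Wm_one ha hb, ip_one ha hb, ip_one ha hb, ip_one ha hb, ip_one ha hb] at h2
  have h3 : Wm a b m (fun t => t) k = Wm a b m (fun t => t * 1) k := by
    congr 1; ext t; ring
  have h4 := Cv_t ha hb (Tame.id'.mul hk) m
  have h1 := (hh_pos ha hb m).ne'
  have h5 := (be_pos ha hb m).ne'
  rw [h3, eq_add_of_sub_eq h2, h4]
  simp [hh_succ ha hb]
  field_simp
  ring

/-- Polarisation. -/
theorem Cv_pol {a b : ℝ} (ha : -(1/2) < a) (hb : -(1/2) < b) {k : ℝ → ℝ} (hk : Tame k) (m : ℕ) :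
    Cv a b (m + 1) (fun t => t * k t) (fun t => t * k t) =
      Cv a b (m + 1) (fun t => t * (t * k t)) k
      + be a b (m + 1) * (ip a b k (m+1) (m+1) / hh a b (m+1) * (ip a b k m m / hh a b m))
      - (ip a b k m (m+1) / hh a b m) ^ 2 := by
  rw [Cv_shift ha hb (Tame.id'.mul hk) hk]
  have h2 := Wm_shift ha hb hk hk m
  rw [Wm_anti a b m k, ip_comm a b k (m+1) m] at h2
  have h1 := (hh_pos ha hb m).ne'
  have h5 := (be_pos ha hb m).ne'
  have h3 : Wm a b m (fun t => t * k t) k = (ip a b k (m+1) (m+1) * ip a b k m m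
     - ip a b k m (m+1) * ip a b k m (m+1)) / hh a b m ^ 2 := by
    linear_combination h2 / 2
  rw [h3, hh_succ ha hb]
  field_simp
  ring

/-- Loop equation. -/
theorem loop {a b : ℝ} (ha : -(1/2) < a) (hb : -(1/2) < b) {h h' : ℝ → ℝ}
    (hc : ContinuousOn h (Set.Icc 0 1)) (hd : ∀ t ∈ Set.Ioo (0:ℝ) 1, HasDerivAt h (h' t) t)
    (hh' : Tame h') (m : ℕ) :
    Em a b (m + 1) (fun t => t * (1 - t) * h' t) =
      (2 * m + 2 + a + b) * (ip a b h m (m + 1) / hh a b m) := by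
  have T := Tame.of_continuousOn hc
  have key : ∀ j, ip a b (fun t => t * (1 - t) * h' t) j j =
      (2 * j + a + b + 2) * ip a b h j (j + 1) - (2 * j + a + b) * be a b j * ip a b h j (j - 1) := by
    intro j
    have h1 := II_parts (a := a) (b := b) (by linarith) (by linarith) hc hd hh'
      (PP a b j * PP a b j)
    have h2 : II a b (fun t => h t * (t * (1 - t) * (PP a b j * PP a b j).derivative.eval t +
      ((a + 1) - (a + b + 2) * t) * (PP a b j * PP a b j).eval t)) =
        -(2 * j + a + b + 2) * ip a b h j (j + 1) +
        (2 * j + a + b) * be a b j * ip a b h j (j - 1) := by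
      unfold ip
      rw [← II_smul, ← II_smul, ← II_add (by linarith) (by linarith)
        ((Tame.const _).mul (T.ip a b j (j+1))) ((Tame.const _).mul (T.ip a b j (j-1)))]
      refine II_congr fun t _ => ?_
      have := pe_B' ha hb t j
      simp only [Polynomial.derivative_mul, Polynomial.eval_add, Polynomial.eval_mul]
      simp only [pe] at this ⊢
      linear_combination h t * (PP a b j).eval t * this
    rw [h2] at h1
    have h3 : ip a b (fun t => t * (1 - t) * h' t) j j =
        II a b (fun t => h' t * (t * (1 - t) * (PP a b j * PP a b j).eval t)) := by
      unfold ip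
      refine II_congr fun t _ => ?_
      simp only [Polynomial.eval_mul, pe]; ring
    rw [h3]; linarith
  induction m with
  | zero => 
    simp only [Em, sum_range_succ, range_zero, sum_empty, key]
    simp [be_zero]; ring
  | succ m ih =>
    have : Em a b (m + 1 + 1) (fun t => t * (1 - t) * h' t) =
      Em a b (m + 1) (fun t => t * (1 - t) * h' t) +
        ip a b (fun t => t * (1 - t) * h' t) (m + 1) (m + 1) / hh a b (m + 1) := by
      simp only [Em, sum_range_succ]
    rw [this, ih, key, hh_succ ha hb]
    have h1 := (hh_pos ha hb m).ne'
    have h5 := (be_pos ha hb m).ne'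
    simp only [Nat.add_sub_cancel]
    rw [ip_comm a b h (m+1) m]
    push_cast
    field_simp
    ring

/-! ### Part 5: derivatives with respect to the weight exponents -/

/-- coefficientwise derivative of a family of polynomials at `0` -/
def CDer (R : ℝ → Polynomial ℝ) (Q : Polynomial ℝ) : Prop :=
  ∀ i, HasDerivAt (fun τ => (R τ).coeff i) (Q.coeff i) 0

theorem CDer.sub {R S : ℝ → Polynomial ℝ} {Q T : Polynomial ℝ} (h1 : CDer R Q) (h2 : CDer S T) :
    CDer (fun τ => R τ - S τ) (Q - T) := by
  intro i
  simp only [Polynomial.coeff_sub]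
  exact (h1 i).sub (h2 i)

theorem CDer.mul {R S : ℝ → Polynomial ℝ} {Q T : Polynomial ℝ} (h1 : CDer R Q) (h2 : CDer S T) :
    CDer (fun τ => R τ * S τ) (Q * S 0 + R 0 * T) := by
  intro i
  simp only [Polynomial.coeff_add, Polynomial.coeff_mul, ← sum_add_distrib]
  exact HasDerivAt.fun_sum fun x _ => (h1 x.1).mul (h2 x.2)

theorem CDer.const (q : Polynomial ℝ) : CDer (fun _ => q) 0 := by
  intro i; simpa using hasDerivAt_const (0:ℝ) (q.coeff i)

theorem CDer.C {f : ℝ → ℝ} {f' : ℝ} (h : HasDerivAt f f' 0) :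
    CDer (fun τ => Polynomial.C (f τ)) (Polynomial.C f') := by
  intro i
  simp only [Polynomial.coeff_C]
  split_ifs
  · exact h
  · exact hasDerivAt_const _ _

theorem path_deriv (a u : ℝ) : HasDerivAt (fun τ : ℝ => a + τ * u) u 0 := by
  have := ((hasDerivAt_id (0:ℝ)).mul_const u).const_add a
  simpa using this

/-- derivative of `Xm` -/
theorem Xm_deriv {a b : ℝ} (ha : -(1/2) < a) (hb : -(1/2) < b) (u v : ℝ) (j : ℕ) :
    HasDerivAt (fun τ : ℝ => Xm (a + τ * u) (b + τ * v) j)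
      (j * u / (2 * j + a + b) - j * (j + a) * (u + v) / (2 * j + a + b) ^ 2) 0 := by
  rcases Nat.eq_zero_or_pos j with h | h
  · subst h; simpa [Xm] using hasDerivAt_const (0:ℝ) (0:ℝ)
  · have hj : (1 : ℝ) ≤ j := by exact_mod_cast h
    have h1 : (2 * j + a + b : ℝ) ≠ 0 := by linarith
    unfold Xm
    have hA := path_deriv a u
    have hB := path_deriv b v
    have hN := (hA.const_add (j:ℝ)).const_mul (j:ℝ)
    have hD := (hA.const_add (2 * j : ℝ)).add hB
    have := hN.div hD (by simpa using h1)
    refine this.congr_deriv ?_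
    simp
    field_simp

/-- logarithmic derivative of `be` -/
noncomputable def rr (a b u v : ℝ) (i : ℕ) : ℝ :=
  u / (i + a) + v / (i + b) + (u + v) *
    (1 / (i + a + b) - 2 / (2 * i + a + b) - 1 / (2 * i + a + b + 1) - 1 / (2 * i + a + b - 1))

theorem be_deriv {a b : ℝ} (ha : -(1/2) < a) (hb : -(1/2) < b) (u v : ℝ) (j : ℕ) :
    HasDerivAt (fun τ : ℝ => be (a + τ * u) (b + τ * v) (j + 1))
      (be a b (j + 1) * rr a b u v (j + 1)) 0 := by
  have hj : (0 : ℝ) ≤ j := Nat.cast_nonneg j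
  unfold be rr
  push_cast
  obtain ⟨x, hx⟩ : ∃ x : ℝ, x = j + 1 := ⟨_, rfl⟩
  rw [← hx]
  have hx1 : 1 ≤ x := by rw [hx]; linarith
  have h1 : (x + a : ℝ) ≠ 0 := by linarith
  have h2 : (x + b : ℝ) ≠ 0 := by linarith
  have h3 : (x + a + b : ℝ) ≠ 0 := by linarith
  have h4 : (2 * x + a + b : ℝ) ≠ 0 := by linarith
  have h5 : (2 * x + a + b + 1 : ℝ) ≠ 0 := by linarith
  have h6 : (2 * x + a + b - 1 : ℝ) ≠ 0 := by linarith
  have h7 : ((2 * x + a + b) ^ 2 - 1 : ℝ) = (2 * x + a + b + 1) * (2 * x + a + b - 1) := by ring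
  have hA := path_deriv a u
  have hB := path_deriv b v
  have hN := (((hA.const_add x).const_mul x).mul (hB.const_add x)).mul ((hA.const_add x).add hB)
  have hs := (hA.const_add (2 * x)).add hB
  have hD := (hs.pow 2).mul ((hs.pow 2).sub_const 1)
  have key := hN.div hD (by
    simp only [Pi.mul_apply, Pi.pow_apply, Pi.add_apply, zero_mul, add_zero]
    rw [h7]
    exact mul_ne_zero (pow_ne_zero _ h4) (mul_ne_zero h5 h6))
  refine HasDerivAt.congr_deriv (f' := _) key ?_
  simp only [Pi.mul_apply, Pi.pow_apply, Pi.add_apply, zero_mul, add_zero]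
  rw [h7]
  generalize 2 * x + a + b = s at *
  generalize x + a + b = r at *
  generalize x + a = p at *
  generalize x + b = q at *
  clear key hD hs hN
  field_simp
  ring

theorem degree_C_mul_le' (c : ℝ) (q : Polynomial ℝ) : (Polynomial.C c * q).degree ≤ q.degree := by
  rw [← Polynomial.smul_eq_C_mul]; exact Polynomial.degree_smul_le _ _

theorem PP_degree (a b : ℝ) (j : ℕ) : (PP a b j).degree = j := by
  induction j using Nat.strong_induction_on with
  | _ j ih =>
  match j, ih with
  | 0, _ => simp [PP]
  | 1, _ => simp [PP]
  | j + 2, ih =>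
    have i0 := ih j (by omega)
    have i1 := ih (j + 1) (by omega)
    have e1 : ((Polynomial.X - Polynomial.C (al a b (j + 1))) * PP a b (j + 1)).degree
        = ((j + 2 : ℕ) : WithBot ℕ) := by
      rw [Polynomial.degree_mul, i1, Polynomial.degree_X_sub_C]
      norm_cast; omega
    rw [PP, Polynomial.degree_sub_eq_left_of_degree_lt, e1]
    rw [e1]
    refine lt_of_le_of_lt (degree_C_mul_le' _ _) ?_
    rw [i0]; norm_cast; omega

theorem PP_deriv {a b : ℝ} (ha : -(1/2) < a) (hb : -(1/2) < b) (u v : ℝ) (j : ℕ) :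
    ∃ Q : Polynomial ℝ, Q.degree < j ∧ CDer (fun τ => PP (a + τ * u) (b + τ * v) j) Q := by
  have hal : ∀ j, ∃ c, HasDerivAt (fun τ : ℝ => al (a + τ * u) (b + τ * v) j) c 0 := fun j =>
    ⟨_, (Xm_deriv ha hb u v (j + 1)).sub (Xm_deriv ha hb u v j)⟩
  induction j using Nat.strong_induction_on with
  | _ j ih =>
  match j, ih with
  | 0, _ => exact ⟨0, by simp, by simpa only [PP] using CDer.const 1⟩
  | 1, _ =>
    obtain ⟨c, hc⟩ := hal 0
    refine ⟨0 - Polynomial.C c, ?_, ?_⟩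
    · rw [zero_sub, Polynomial.degree_neg]
      exact lt_of_le_of_lt Polynomial.degree_C_le (by norm_num)
    · simpa only [PP] using (CDer.const Polynomial.X).sub (CDer.C hc)
  | j + 2, ih =>
    obtain ⟨Q0, d0, h0⟩ := ih j (by omega)
    obtain ⟨Q1, d1, h1⟩ := ih (j + 1) (by omega)
    obtain ⟨c, hc⟩ := hal (j + 1)
    have := (((CDer.const Polynomial.X).sub (CDer.C hc)).mul h1).sub
      ((CDer.C (be_deriv ha hb u v j)).mul h0)
    refine ⟨_, ?_, by simpa only [PP] using this⟩
    have M : ∀ q : Polynomial ℝ, q.degree < ((j + 2 : ℕ) : WithBot ℕ) ↔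
      q ∈ Polynomial.degreeLT ℝ (j + 2) := fun q => Polynomial.mem_degreeLT.symm
    have L : ∀ (c : ℝ) (q : Polynomial ℝ), q.degree < ((j + 2 : ℕ) : WithBot ℕ) →
        (Polynomial.C c * q).degree < ((j + 2 : ℕ) : WithBot ℕ) := fun c q h =>
      lt_of_le_of_lt (degree_C_mul_le' _ _) h
    have lt0 : (j : WithBot ℕ) < ((j + 2 : ℕ) : WithBot ℕ) := by norm_cast; omega
    have lt1 : ((j + 1 : ℕ) : WithBot ℕ) < ((j + 2 : ℕ) : WithBot ℕ) := by norm_cast; omega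
    have X1 : (Polynomial.X * Q1).degree < ((j + 2 : ℕ) : WithBot ℕ) := by
      by_cases hQ : Q1 = 0
      · rw [hQ, mul_zero, Polynomial.degree_zero]; exact WithBot.bot_lt_coe _
      rw [Polynomial.degree_mul, Polynomial.degree_X, Polynomial.degree_eq_natDegree hQ]
      rw [Polynomial.degree_eq_natDegree hQ] at d1
      norm_cast at d1 ⊢
      omega
    rw [M]
    simp only [zero_sub, neg_mul, sub_mul]
    refine sub_mem (add_mem (neg_mem ?_) (sub_mem ?_ ?_)) (add_mem ?_ ?_) <;> rw [← M]
    · exact L _ _ (by rw [PP_degree]; exact lt1)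
    · exact X1
    · exact L _ _ (d1.trans lt1)
    · exact L _ _ (by rw [PP_degree]; exact lt0)
    · exact L _ _ (d0.trans lt0)

theorem II_poly_deriv {a b : ℝ} (ha : -(1/2) < a) (hb : -(1/2) < b) (u v : ℝ) {g : ℝ → ℝ}
    (hg : Tame g) {R : ℝ → Polynomial ℝ} {Q : Polynomial ℝ} (hR : CDer R Q) (N : ℕ)
    (hN : ∀ τ, (R τ).degree < N) (hQ : Q.degree < N) :
    HasDerivAt (fun τ : ℝ => II (a + τ * u) (b + τ * v) (fun t => g t * (R τ).eval t))
      (II a b (fun t => g t * Q.eval t) + II a b (fun t => g t * lg u v t * (R 0).eval t)) 0 := by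
  have Tm : ∀ i : ℕ, Tame (fun t => t ^ i) := fun i => by
    simpa using Tame.poly (Polynomial.X ^ i)
  have ev : ∀ (q : Polynomial ℝ) (t : ℝ), q.degree < N →
      q.eval t = ∑ i ∈ range N, q.coeff i * t ^ i := by
    intro q t h
    rcases Nat.eq_zero_or_pos N with h0 | h0
    · subst h0
      have : q = 0 := by simpa using h
      simp [this]
    · have hn : q.natDegree < N := by
        by_cases hq : q = 0
        · rw [hq, Polynomial.natDegree_zero]; exact h0
        · exact (Polynomial.natDegree_lt_iff_degree_lt hq).2 h
      exact Polynomial.eval_eq_sum_range' hn t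
  have ex : ∀ (c d : ℝ) (_ : -1 < c) (_ : -1 < d) (k : ℝ → ℝ) (_ : Tame k) (q : Polynomial ℝ)
      (_ : q.degree < N), II c d (fun t => k t * q.eval t) =
        ∑ i ∈ range N, q.coeff i * II c d (fun t => k t * t ^ i) := by
    intro c d hc hd k hk q hq
    simp only [← II_smul]
    rw [← II_sum hc hd]
    · refine II_congr fun t _ => ?_
      rw [ev q t hq, mul_sum]
      exact sum_congr rfl fun i _ => by ring
    · intro i _
      exact (Tame.const _).mul (hk.mul (Tm i))
  have ha1 : -1 < a := by linarith
  have hb1 : -1 < b := by linarith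
  rw [ex a b ha1 hb1 g hg Q hQ, ex a b ha1 hb1 _ (hg.mul (Tame.lg u v)) _ (hN 0),
    ← sum_add_distrib]
  have key : HasDerivAt (fun τ : ℝ => ∑ i ∈ range N, (R τ).coeff i *
      II (a + τ * u) (b + τ * v) (fun t => g t * t ^ i))
      (∑ i ∈ range N, (Q.coeff i * II a b (fun t => g t * t ^ i) +
        (R 0).coeff i * II a b (fun t => g t * lg u v t * t ^ i))) 0 := by
    refine HasDerivAt.fun_sum fun i _ => ?_
    have h2 := (hR i).mul (II_hasDerivAt ha1 hb1 u v (hg.mul (Tm i)))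
    refine h2.congr_deriv ?_
    simp only [zero_mul, add_zero]
    congr 2
    refine II_congr fun t _ => ?_
    ring
  refine key.congr_of_eventuallyEq ?_
  have hA : ∀ᶠ τ in nhds (0:ℝ), -1 < a + τ * u :=
    (path_deriv a u).continuousAt.eventually (lt_mem_nhds (by simpa using ha1))
  have hB : ∀ᶠ τ in nhds (0:ℝ), -1 < b + τ * v :=
    (path_deriv b v).continuousAt.eventually (lt_mem_nhds (by simpa using hb1))
  filter_upwards [hA, hB] with τ h1 h2
  exact ex _ _ h1 h2 g hg _ (hN τ)

/-- expansion of low degree polynomials in the orthogonal basis -/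
theorem expand (a b : ℝ) (j : ℕ) : ∀ Q : Polynomial ℝ, Q.degree < j →
    ∃ c : ℕ → ℝ, ∀ t, Q.eval t = ∑ i ∈ range j, c i * pe a b i t := by
  induction j with
  | zero =>
    intro Q h
    have : Q = 0 := by simpa using h
    exact ⟨0, by simp [this]⟩
  | succ j ih =>
    intro Q h
    have hd : (Q - Polynomial.C (Q.coeff j / (PP a b j).coeff j) * PP a b j).degree < j := by
      have h0 : (PP a b j).coeff j ≠ 0 := by
        have := PP_degree a b j
        exact Polynomial.coeff_ne_zero_of_eq_degree this
      rw [Polynomial.degree_lt_iff_coeff_zero]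
      intro i hi
      rcases Nat.eq_or_lt_of_le hi with h1 | h1
      · subst h1
        simp; field_simp; simp
      · have e1 : Q.coeff i = 0 := (Polynomial.degree_lt_iff_coeff_zero _ _).1 h i h1
        have e2 : (PP a b j).coeff i = 0 :=
          Polynomial.coeff_eq_zero_of_degree_lt (by rw [PP_degree]; exact_mod_cast h1)
        simp [e1, e2]
    obtain ⟨c, hc⟩ := ih _ hd
    refine ⟨fun i => if i = j then Q.coeff j / (PP a b j).coeff j else c i, fun t => ?_⟩
    rw [sum_range_succ]
    beta_reduce
    have := hc t
    simp only [Polynomial.eval_sub, Polynomial.eval_mul, Polynomial.eval_C] at this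
    rw [if_pos rfl]
    have e : ∑ i ∈ range j, (if i = j then Q.coeff j / (PP a b j).coeff j else c i) * pe a b i t
        = ∑ i ∈ range j, c i * pe a b i t :=
      sum_congr rfl fun i hi => by rw [if_neg (by simp at hi; omega)]
    rw [e, ← this]
    simp only [pe]; ring

theorem ip_deriv {a b : ℝ} (ha : -(1/2) < a) (hb : -(1/2) < b) (u v : ℝ) {g : ℝ → ℝ}
    (hg : Tame g) {j k : ℕ} {Qj Qk : Polynomial ℝ} (dj : Qj.degree < j) (dk : Qk.degree < k)
    (hj : CDer (fun τ => PP (a + τ * u) (b + τ * v) j) Qj)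
    (hk : CDer (fun τ => PP (a + τ * u) (b + τ * v) k) Qk) :
    HasDerivAt (fun τ : ℝ => ip (a + τ * u) (b + τ * v) g j k)
      (II a b (fun t => g t * (Qj.eval t * pe a b k t)) + II a b (fun t => g t * (pe a b j t * Qk.eval t))
        + ip a b (fun t => g t * lg u v t) j k) 0 := by
  have hjk := hj.mul hk
  have lt1 : (j : WithBot ℕ) + k < ((j + k + 1 : ℕ) : WithBot ℕ) := by norm_cast; omega
  have d1 : (Qj * PP (a + 0 * u) (b + 0 * v) k).degree < ((j + k + 1 : ℕ) : WithBot ℕ) := by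
    rw [Polynomial.degree_mul, PP_degree]
    exact lt_of_le_of_lt (add_le_add_left dj.le _) lt1
  have d2 : (PP (a + 0 * u) (b + 0 * v) j * Qk).degree < ((j + k + 1 : ℕ) : WithBot ℕ) := by
    rw [Polynomial.degree_mul, PP_degree]
    exact lt_of_le_of_lt (add_le_add_right dk.le _) lt1
  have key := II_poly_deriv ha hb u v hg hjk (j + k + 1)
    (fun τ => by rw [Polynomial.degree_mul, PP_degree, PP_degree]; exact lt1)
    (lt_of_le_of_lt (Polynomial.degree_add_le _ _) (max_lt d1 d2))
  simp only [Polynomial.eval_mul, Polynomial.eval_add, zero_mul, add_zero] at key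
  refine HasDerivAt.congr_deriv (f' := _) key ?_
  rw [← II_add (by linarith) (by linarith) (hg.mul ((Tame.poly Qj).mul (Tame.pe a b k)))
    (hg.mul ((Tame.pe a b j).mul (Tame.poly Qk)))]
  congr 1
  refine II_congr fun t _ => ?_
  simp only [pe]; ring

theorem Q_coeff {a b : ℝ} (ha : -(1/2) < a) (hb : -(1/2) < b) (u v : ℝ) {j : ℕ}
    {Qj : Polynomial ℝ} (dj : Qj.degree < j)
    (hj : CDer (fun τ => PP (a + τ * u) (b + τ * v) j) Qj) (t : ℝ) :
    Qj.eval t = ∑ i ∈ range j, (-(ip a b (lg u v) j i / hh a b i)) * pe a b i t := by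
  have ha1 : -1 < a := by linarith
  have hb1 : -1 < b := by linarith
  -- inner products with the basis
  have inn : ∀ (k : ℕ) (c : ℕ → ℝ) (n : ℕ) (q : Polynomial ℝ)
      (_ : ∀ t, q.eval t = ∑ i ∈ range n, c i * pe a b i t),
      II a b (fun t => 1 * (q.eval t * pe a b k t)) = if k < n then c k * hh a b k else 0 := by
    intro k c n q hq
    have : II a b (fun t => 1 * (q.eval t * pe a b k t)) =
        ∑ i ∈ range n, c i * ip a b (fun _ => 1) i k := by
      unfold ip
      simp only [← II_smul]
      rw [← II_sum ha1 hb1]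
      · refine II_congr fun t _ => ?_
        rw [hq t, sum_mul, mul_sum]
        exact sum_congr rfl fun i _ => by ring
      · intro i _
        exact (Tame.const _).mul ((Tame.const 1).ip a b i k)
    rw [this]
    split_ifs with h
    · rw [sum_eq_single k]
      · rfl
      · intro i _ hi
        rw [ip_orth ha hb hi, mul_zero]
      · intro h'; simp at h'; omega
    · refine sum_eq_zero fun i hi => ?_
      simp at hi
      rw [ip_orth ha hb (by omega), mul_zero]
  obtain ⟨c, hc⟩ := expand a b j Qj dj
  rw [hc t]
  refine sum_congr rfl fun i hi => ?_
  congr 1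
  have hij : i < j := by simpa using hi
  obtain ⟨Qi, di, hi'⟩ := PP_deriv ha hb u v i
  obtain ⟨d, hd⟩ := expand a b i Qi di
  have h1 := ip_deriv ha hb u v (Tame.const 1) dj di hj hi'
  have h2 : HasDerivAt (fun τ : ℝ => ip (a + τ * u) (b + τ * v) (fun _ => 1) j i) 0 0 := by
    refine (hasDerivAt_const (0:ℝ) (0:ℝ)).congr_of_eventuallyEq ?_
    have hA : ∀ᶠ τ in nhds (0:ℝ), -(1/2) < a + τ * u :=
      (path_deriv a u).continuousAt.eventually (lt_mem_nhds (by simpa using ha))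
    have hB : ∀ᶠ τ in nhds (0:ℝ), -(1/2) < b + τ * v :=
      (path_deriv b v).continuousAt.eventually (lt_mem_nhds (by simpa using hb))
    filter_upwards [hA, hB] with τ h1 h2
    exact ip_orth h1 h2 hij.ne'
  have h3 := h1.unique h2
  rw [inn i c j Qj hc, if_pos hij] at h3
  have h4 : II a b (fun t => 1 * (pe a b j t * Qi.eval t)) = 0 := by
    have := inn j d i Qi hd
    rw [if_neg (by omega)] at this
    rw [← this]
    refine II_congr fun t _ => ?_
    ring
  rw [h4] at h3
  have h5 : ip a b (fun t => 1 * lg u v t) j i = ip a b (lg u v) j i :=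
    ip_congr (fun t _ => one_mul _) j i
  rw [h5] at h3
  have h6 := (hh_pos ha hb i).ne'
  field_simp
  linarith

theorem ip_diag_deriv {a b : ℝ} (ha : -(1/2) < a) (hb : -(1/2) < b) (u v : ℝ) {g : ℝ → ℝ}
    (hg : Tame g) (j : ℕ) :
    HasDerivAt (fun τ : ℝ => ip (a + τ * u) (b + τ * v) g j j)
      (ip a b (fun t => g t * lg u v t) j j
        - 2 * ∑ i ∈ range j, ip a b g j i * ip a b (lg u v) j i / hh a b i) 0 := by
  obtain ⟨Q, dQ, hQ⟩ := PP_deriv ha hb u v j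
  refine (ip_deriv ha hb u v hg dQ dQ hQ hQ).congr_deriv ?_
  have e1 : II a b (fun t => g t * (pe a b j t * Q.eval t)) =
      II a b (fun t => g t * (Q.eval t * pe a b j t)) := II_congr fun t _ => by ring
  have e2 : II a b (fun t => g t * (pe a b j t * Q.eval t)) =
      - ∑ i ∈ range j, ip a b g j i * ip a b (lg u v) j i / hh a b i := by
    have : ∀ t, g t * (pe a b j t * Q.eval t) = ∑ i ∈ range j,
        (-(ip a b (lg u v) j i / hh a b i)) * (g t * (pe a b j t * pe a b i t)) := by
      intro t
      rw [Q_coeff ha hb u v dQ hQ t, mul_sum, mul_sum]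
      exact sum_congr rfl fun i _ => by ring
    simp only [this]
    rw [II_sum (by linarith) (by linarith) _ _ (fun i _ => (Tame.const _).mul (hg.ip a b j i)),
      ← sum_neg_distrib]
    refine sum_congr rfl fun i _ => ?_
    rw [II_smul]
    unfold ip
    ring
  rw [← e1, e2]; ring

theorem hh_deriv {a b : ℝ} (ha : -(1/2) < a) (hb : -(1/2) < b) (u v : ℝ) (j : ℕ) :
    HasDerivAt (fun τ : ℝ => hh (a + τ * u) (b + τ * v) j) (ip a b (lg u v) j j) 0 := by
  refine (ip_diag_deriv ha hb u v (Tame.const 1) j).congr_deriv ?_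
  rw [sum_eq_zero, ip_congr (h := lg u v) (fun t _ => one_mul _)]
  · ring
  · intro i hi
    rw [ip_orth ha hb (by simp at hi; omega)]; simp

/-- The derivative of a mean is a covariance. -/
theorem Em_deriv {a b : ℝ} (ha : -(1/2) < a) (hb : -(1/2) < b) (u v : ℝ) {g : ℝ → ℝ}
    (hg : Tame g) (m : ℕ) :
    HasDerivAt (fun τ : ℝ => Em (a + τ * u) (b + τ * v) m g) (Cv a b m g (lg u v)) 0 := by
  have h1 : ∀ j, HasDerivAt (fun τ : ℝ => ip (a + τ * u) (b + τ * v) g j j /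
      hh (a + τ * u) (b + τ * v) j) (ip a b (fun t => g t * lg u v t) j j / hh a b j
        - 2 * ∑ i ∈ range j, ip a b g j i * ip a b (lg u v) j i / (hh a b j * hh a b i)
        - ip a b g j j * ip a b (lg u v) j j / (hh a b j * hh a b j)) 0 := by
    intro j
    have h0 := (hh_pos ha hb j).ne'
    have := (ip_diag_deriv ha hb u v hg j).div (hh_deriv ha hb u v j) (by simpa using h0)
    refine this.congr_deriv ?_
    simp only [zero_mul, add_zero]
    have e : ∑ i ∈ range j, ip a b g j i * ip a b (lg u v) j i / (hh a b j * hh a b i) =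
      (∑ i ∈ range j, ip a b g j i * ip a b (lg u v) j i / hh a b i) / hh a b j := by
      rw [sum_div]
      refine sum_congr rfl fun i _ => ?_
      rw [div_div, mul_comm (hh a b j)]
    rw [e]
    field_simp
  have h2 := HasDerivAt.fun_sum (u := range m) fun j _ => h1 j
  refine HasDerivAt.congr_deriv (f' := _) h2 ?_
  clear h1 h2
  unfold Cv
  induction m with
  | zero => simp [Em, Dm]
  | succ m ih =>
    rw [sum_range_succ, ih]
    have e1 : Em a b (m + 1) (fun t => g t * lg u v t) = Em a b m (fun t => g t * lg u v t) +
        ip a b (fun t => g t * lg u v t) m m / hh a b m := by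
      simp only [Em, sum_range_succ]
    have e2 : Dm a b (m + 1) g (lg u v) = Dm a b m g (lg u v) +
        2 * ∑ i ∈ range m, ip a b g m i * ip a b (lg u v) m i / (hh a b m * hh a b i) +
        ip a b g m m * ip a b (lg u v) m m / (hh a b m * hh a b m) := by
      simp only [Dm, sum_range_succ, sum_add_distrib]
      have : ∑ i ∈ range m, ip a b g i m * ip a b (lg u v) i m / (hh a b i * hh a b m) =
        ∑ i ∈ range m, ip a b g m i * ip a b (lg u v) m i / (hh a b m * hh a b i) :=
        sum_congr rfl fun i _ => by
          rw [ip_comm a b g i m, ip_comm a b (lg u v) i m, mul_comm (hh a b i)]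
      rw [this]; ring
    rw [e1, e2]; ring

/-! ### Part 6: explicit formulas for means and covariances -/

theorem ev_dom {a b : ℝ} (ha : -(1/2) < a) (hb : -(1/2) < b) (u v : ℝ) :
    ∀ᶠ τ in nhds (0:ℝ), -(1/2) < a + τ * u ∧ -(1/2) < b + τ * v := by
  have hA : ∀ᶠ τ in nhds (0:ℝ), -(1/2) < a + τ * u :=
    (path_deriv a u).continuousAt.eventually (lt_mem_nhds (by simpa using ha))
  have hB : ∀ᶠ τ in nhds (0:ℝ), -(1/2) < b + τ * v :=
    (path_deriv b v).continuousAt.eventually (lt_mem_nhds (by simpa using hb))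
  exact hA.and hB

/-- If two functions of the exponents agree on the domain, so do their derivatives. -/
theorem deriv_eq_of_dom {a b : ℝ} (ha : -(1/2) < a) (hb : -(1/2) < b) {u v : ℝ}
    {F H : ℝ → ℝ → ℝ} (e : ∀ x y : ℝ, -(1/2) < x → -(1/2) < y → F x y = H x y) {f' h' : ℝ}
    (hF : HasDerivAt (fun τ : ℝ => F (a + τ * u) (b + τ * v)) f' 0)
    (hH : HasDerivAt (fun τ : ℝ => H (a + τ * u) (b + τ * v)) h' 0) : f' = h' := by
  refine hF.unique (hH.congr_of_eventuallyEq ?_)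
  filter_upwards [ev_dom ha hb u v] with τ h
  exact e _ _ h.1 h.2

/-- normalised diagonal matrix elements of the logarithms -/
noncomputable def lm (a b u v : ℝ) (j : ℕ) : ℝ := ip a b (lg u v) j j / hh a b j

theorem lm_lin {a b : ℝ} (ha : -(1/2) < a) (hb : -(1/2) < b) (u v : ℝ) (j : ℕ) :
    lm a b u v j = u * lm a b 1 0 j + v * lm a b 0 1 j := by
  unfold lm
  have : ip a b (lg u v) j j = u * ip a b (lg 1 0) j j + v * ip a b (lg 0 1) j j := by
    rw [← ip_smul, ← ip_smul, ← ip_add ha hb ((Tame.const u).mul (Tame.lg 1 0))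
      ((Tame.const v).mul (Tame.lg 0 1))]
    refine ip_congr (fun t _ => ?_) j j
    simp only [lg]; ring
  rw [this]; ring

theorem lm_succ {a b : ℝ} (ha : -(1/2) < a) (hb : -(1/2) < b) (u v : ℝ) (j : ℕ) :
    lm a b u v (j + 1) = lm a b u v j + rr a b u v (j + 1) := by
  have h1 := hh_deriv ha hb u v (j + 1)
  have h2 := (be_deriv ha hb u v j).mul (hh_deriv ha hb u v j)
  have h3 := deriv_eq_of_dom (F := fun x y => hh x y (j + 1))
    (H := fun x y => be x y (j + 1) * hh x y j) ha hb (fun x y hx hy => hh_succ hx hy j) h1 h2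
  unfold lm
  have e1 := (hh_pos ha hb j).ne'
  have e2 := (be_pos ha hb j).ne'
  rw [h3, hh_succ ha hb]
  simp only [zero_mul, add_zero]
  field_simp
  ring

/-- second order data of the base level -/
noncomputable def KK (a b u v u' v' : ℝ) : ℝ :=
  II a b (fun t => lg u v t * lg u' v' t) / II a b (fun _ => 1)
    - II a b (lg u v) / II a b (fun _ => 1) * (II a b (lg u' v') / II a b (fun _ => 1))

theorem lm_zero (a b u v : ℝ) : lm a b u v 0 = II a b (lg u v) / II a b (fun _ => 1) := by
  unfold lm
  rw [hh_zero]
  congr 1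
  unfold ip
  refine II_congr fun t _ => ?_
  simp [pe_zero]

theorem lm_zero_deriv {a b : ℝ} (ha : -(1/2) < a) (hb : -(1/2) < b) (u v u' v' : ℝ) :
    HasDerivAt (fun τ : ℝ => lm (a + τ * u') (b + τ * v') u v 0) (KK a b u v u' v') 0 := by
  simp only [lm_zero]
  have h0 : II a b (fun _ => 1) ≠ 0 := (II_pos (by linarith) (by linarith)).ne'
  have h1 := II_hasDerivAt (a := a) (b := b) (by linarith) (by linarith) u' v' (Tame.lg u v)
  have h2 := II_hasDerivAt (a := a) (b := b) (by linarith) (by linarith) u' v' (Tame.const 1)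
  refine (h1.div h2 (by simpa using h0)).congr_deriv ?_
  simp only [zero_mul, add_zero, one_mul, KK]
  field_simp

/-- derivative of `rr` -/
noncomputable def qq (a b u v u' v' : ℝ) (i : ℕ) : ℝ :=
  -(u * u' / (i + a) ^ 2) - v * v' / (i + b) ^ 2 + (u + v) * (u' + v') *
    (-(1 / (i + a + b) ^ 2) + 2 / (2 * i + a + b) ^ 2 + 1 / (2 * i + a + b + 1) ^ 2
      + 1 / (2 * i + a + b - 1) ^ 2)

theorem inv_path {f : ℝ → ℝ} {f' x : ℝ} (c : ℝ) (hf : HasDerivAt f f' 0) (h0 : f 0 = x) (hx : x ≠ 0) :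
    HasDerivAt (fun τ => c / f τ) (-(c * f' / x ^ 2)) 0 := by
  refine ((hasDerivAt_const (0:ℝ) c).div hf (by rw [h0]; exact hx)).congr_deriv ?_
  rw [h0]; ring

theorem rr_deriv {a b : ℝ} (ha : -(1/2) < a) (hb : -(1/2) < b) (u v u' v' : ℝ) (j : ℕ) :
    HasDerivAt (fun τ : ℝ => rr (a + τ * u') (b + τ * v') u v (j + 1))
      (qq a b u v u' v' (j + 1)) 0 := by
  have hj : (0 : ℝ) ≤ j := Nat.cast_nonneg j
  have hA := path_deriv a u'
  have hB := path_deriv b v'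
  unfold rr qq
  push_cast
  obtain ⟨x, hx⟩ : ∃ x : ℝ, x = j + 1 := ⟨_, rfl⟩
  rw [← hx]
  have hx1 : 1 ≤ x := by rw [hx]; linarith
  have h1 : (x + a : ℝ) ≠ 0 := by linarith
  have h2 : (x + b : ℝ) ≠ 0 := by linarith
  have h3 : (x + a + b : ℝ) ≠ 0 := by linarith
  have h4 : (2 * x + a + b : ℝ) ≠ 0 := by linarith
  have h5 : (2 * x + a + b + 1 : ℝ) ≠ 0 := by linarith
  have h6 : (2 * x + a + b - 1 : ℝ) ≠ 0 := by linarith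
  have hs := (hA.const_add (2 * x)).fun_add hB
  have k1 := inv_path u (hA.const_add x) (by simp) h1
  have k2 := inv_path v (hB.const_add x) (by simp) h2
  have k3 := inv_path 1 ((hA.const_add x).fun_add hB) (by simp) h3
  have k4 := inv_path 2 hs (by simp) h4
  have k5 := inv_path 1 (hs.add_const 1) (by simp) h5
  have k6 := inv_path 1 (hs.sub_const 1) (by simp) h6
  refine ((k1.fun_add k2).fun_add ((((k3.fun_sub k4).fun_sub k5).fun_sub k6).const_mul (u + v))).congr_deriv ?_
  ring

theorem lm_deriv {a b : ℝ} (ha : -(1/2) < a) (hb : -(1/2) < b) (u v u' v' : ℝ) (j : ℕ) :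
    HasDerivAt (fun τ : ℝ => lm (a + τ * u') (b + τ * v') u v j)
      (KK a b u v u' v' + ∑ i ∈ range j, qq a b u v u' v' (i + 1)) 0 := by
  induction j with
  | zero => simpa using lm_zero_deriv ha hb u v u' v'
  | succ j ih =>
    have := ih.fun_add (rr_deriv ha hb u v u' v' j)
    rw [sum_range_succ, ← add_assoc]
    refine this.congr_of_eventuallyEq ?_
    filter_upwards [ev_dom ha hb u' v'] with τ h
    exact lm_succ h.1 h.2 u v j

/-- derivative of `lm` -/
noncomputable def dl (a b u v u' v' : ℝ) (j : ℕ) : ℝ :=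
  KK a b u v u' v' + ∑ i ∈ range j, qq a b u v u' v' (i + 1)

/-- derivative of `Xm` -/
noncomputable def dX (a b u v : ℝ) (j : ℕ) : ℝ :=
  j * u / (2 * j + a + b) - j * (j + a) * (u + v) / (2 * j + a + b) ^ 2

theorem Em_t {a b : ℝ} (ha : -(1/2) < a) (hb : -(1/2) < b) (m : ℕ) :
    Em a b m (fun t => t) = Xm a b m := by
  have : ∀ j, ip a b (fun t => t) j j / hh a b j = Xm a b (j + 1) - Xm a b j := by
    intro j
    have h := ip_rec ha hb (Tame.const 1) j j
    rw [ip_congr (h := fun t => t) (fun t _ => mul_one t)] at h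
    rw [h, ip_orth ha hb (by omega), ip_one ha hb, if_pos rfl]
    have h0 := (hh_pos ha hb j).ne'
    have h1 : be a b j * ip a b (fun _ => 1) (j - 1) j = 0 := by
      rcases j with - | j
      · simp [be_zero]
      · rw [ip_orth ha hb (by omega), mul_zero]
    rw [h1, al]
    field_simp
    ring
  unfold Em
  simp only [this]
  rw [sum_range_sub, Xm_zero, sub_zero]

theorem Cv_t_lg {a b : ℝ} (ha : -(1/2) < a) (hb : -(1/2) < b) (u v : ℝ) (m : ℕ) :
    Cv a b m (fun t => t) (lg u v) = dX a b u v m :=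
  deriv_eq_of_dom ha hb (F := fun x y => Em x y m (fun t => t)) (H := fun x y => Xm x y m)
    (fun _ _ hx hy => Em_t hx hy m) (Em_deriv ha hb u v Tame.id' m) (Xm_deriv ha hb u v m)

theorem ip_lg_off {a b : ℝ} (ha : -(1/2) < a) (hb : -(1/2) < b) (u v : ℝ) (m : ℕ) :
    ip a b (lg u v) m (m + 1) / hh a b m = dX a b u v (m + 1) := by
  rw [← Cv_t ha hb (Tame.lg u v), Cv_t_lg ha hb]

theorem Tame.tt : Tame (fun t => t * (1 - t)) := Tame.id'.mul ((Tame.const 1).sub Tame.id')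

theorem Em_tt {a b : ℝ} (ha : -(1/2) < a) (hb : -(1/2) < b) (m : ℕ) :
    Em a b (m + 1) (fun t => t * (1 - t)) = (2 * m + 2 + a + b) * be a b (m + 1) := by
  have h := loop ha hb (h := fun t => t) (h' := fun _ => 1) continuousOn_id
    (fun t _ => hasDerivAt_id t) (Tame.const 1) m
  rw [Em_congr (h := fun t => t * (1 - t)) (fun t _ => mul_one _)] at h
  rw [h]
  congr 1
  have h := ip_rec ha hb (Tame.const 1) m (m + 1)
  rw [ip_congr (h := fun t => t) (fun t _ => mul_one t)] at h
  rw [h, ip_orth ha hb (show m ≠ m + 1 by omega), ip_one ha hb, if_pos rfl,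
    ip_orth ha hb (show m - 1 ≠ m + 1 by omega), hh_succ ha hb]
  have h0 := (hh_pos ha hb m).ne'
  field_simp
  ring

theorem Cv_tt_G {a b : ℝ} (ha : -(1/2) < a) (hb : -(1/2) < b) (m : ℕ) :
    Cv a b (m + 1) (fun t => t * (1 - t)) (lg 1 (-1)) =
      (2 * m + 2 + a + b) * (be a b (m + 1) * rr a b 1 (-1) (m + 1)) := by
  refine deriv_eq_of_dom ha hb (F := fun x y => Em x y (m + 1) (fun t => t * (1 - t)))
    (H := fun x y => (2 * m + 2 + x + y) * be x y (m + 1))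
    (fun _ _ hx hy => Em_tt hx hy m) (Em_deriv ha hb 1 (-1) Tame.tt (m + 1)) ?_
  have h1 := ((path_deriv a 1).const_add (2 * m + 2 : ℝ)).fun_add (path_deriv b (-1))
  refine (h1.mul (be_deriv ha hb 1 (-1) m)).congr_deriv ?_
  simp

/-- the entropy function -/
noncomputable def fe (t : ℝ) : ℝ := t * Real.log t + (1 - t) * Real.log (1 - t)

theorem fe_cont : Continuous fe := by
  unfold fe
  exact Real.continuous_mul_log.add
    (Real.continuous_mul_log.comp (by fun_prop : Continuous fun t : ℝ => 1 - t))

theorem fe_eq (t : ℝ) : fe t = t * lg 1 (-1) t + lg 0 1 t := by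
  simp only [fe, lg]; ring

theorem fe_deriv {t : ℝ} (ht : t ∈ Set.Ioo (0:ℝ) 1) : HasDerivAt fe (lg 1 (-1) t) t := by
  have h1 : t ≠ 0 := ht.1.ne'
  have h2 : 1 - t ≠ 0 := by linarith [ht.2]
  have k1 := Real.hasDerivAt_mul_log h1
  have k2 : HasDerivAt (fun t : ℝ => 1 - t) (-1) t := by
    simpa using (hasDerivAt_id t).const_sub 1
  have k3 := (Real.hasDerivAt_mul_log h2).comp t k2
  refine (k1.add k3).congr_deriv ?_
  simp only [lg]; ring

theorem Tame.fe : Tame fe := Tame.of_continuousOn fe_cont.continuousOn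

theorem be_rr {a b : ℝ} (ha : -(1/2) < a) (hb : -(1/2) < b) (m : ℕ) :
    be a b (m + 1) * rr a b 1 (-1) (m + 1) = (m + 1) * (m + 1 + a + b) * (b - a) /
      ((2 * m + 2 + a + b) ^ 2 * ((2 * m + 2 + a + b) ^ 2 - 1)) := by
  have hj : (0 : ℝ) ≤ m := Nat.cast_nonneg m
  unfold be rr
  push_cast
  have h1 : (m + 1 + a : ℝ) ≠ 0 := by linarith
  have h2 : (m + 1 + b : ℝ) ≠ 0 := by linarith
  have h4 : (2 * m + 2 + a + b : ℝ) ≠ 0 := by linarith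
  have h5 : ((2 * m + 2 + a + b) ^ 2 - 1 : ℝ) ≠ 0 := by nlinarith
  rw [show (2 * (m + 1) + a + b : ℝ) = 2 * m + 2 + a + b by ring]
  have : (1 : ℝ) + -1 = 0 := by ring
  rw [this, zero_mul, add_zero]
  generalize 2 * m + 2 + a + b = s at *
  field_simp
  ring

/-- (C) -/
theorem Em_ttG {a b : ℝ} (ha : -(1/2) < a) (hb : -(1/2) < b) (m : ℕ) :
    Em a b (m + 1) (fun t => t * (1 - t) * lg 1 (-1) t) =
      (m + 1) * (b - a) / (2 * (2 * m + 2 + a + b))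
      - (m + 1) * (m + 1 + a + b) * (b - a) / (2 * ((2 * m + 2 + a + b) ^ 2 - 1))
      + (2 * m + 2 + a + b) / 2 * (be a b (m + 1) * (lm a b 1 (-1) (m + 1) + lm a b 1 (-1) m)) := by
  have hj : (0 : ℝ) ≤ m := Nat.cast_nonneg m
  have TG := Tame.lg 1 (-1)
  rw [loop ha hb fe_cont.continuousOn (fun t ht => fe_deriv ht) TG, ← Cv_t ha hb Tame.fe]
  have e1 : Cv a b (m + 1) (fun t => t) fe = Cv a b (m + 1) (fun t => t) (fun t => t * lg 1 (-1) t)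
      + Cv a b (m + 1) (fun t => t) (lg 0 1) := by
    rw [Cv_comm, Cv_congr (fun t _ => fe_eq t), Cv_add ha hb (Tame.id'.mul TG) (Tame.lg 0 1) Tame.id',
      Cv_comm, Cv_comm a b _ (lg 0 1)]
  have e2 := Cv_tt ha hb TG m
  have e3 : Cv a b (m + 1) (fun t => t) (lg 1 (-1)) = Cv a b (m + 1) (fun t => t * t) (lg 1 (-1)) +
      Cv a b (m + 1) (fun t => t * (1 - t)) (lg 1 (-1)) := by
    rw [← Cv_add ha hb (Tame.id'.mul Tame.id') Tame.tt TG]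
    refine Cv_congr fun t _ => ?_
    ring
  rw [Cv_t_lg ha hb, Cv_tt_G ha hb, be_rr ha hb] at e3
  rw [Cv_t_lg ha hb] at e1
  unfold dX at e1 e3
  unfold lm
  rw [e1]
  have h4 : (2 * m + 2 + a + b : ℝ) ≠ 0 := by linarith
  have h5 : ((2 * m + 2 + a + b) ^ 2 - 1 : ℝ) ≠ 0 := by nlinarith
  push_cast at e3 ⊢
  rw [show (2 * (m + 1) + a + b : ℝ) = 2 * m + 2 + a + b by ring] at e3 ⊢
  have e4 : Cv a b (m + 1) (fun t => t) (fun t => t * lg 1 (-1) t) =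
    (Cv a b (m + 1) (fun t => t * t) (lg 1 (-1)) + be a b (m + 1) *
      (ip a b (lg 1 (-1)) (m+1) (m+1) / hh a b (m+1) + ip a b (lg 1 (-1)) m m / hh a b m)) / 2 := by
    linarith
  rw [e4, ← sub_eq_of_eq_add e3]
  generalize ip a b (lg 1 (-1)) (m+1) (m+1) / hh a b (m+1) + ip a b (lg 1 (-1)) m m / hh a b m = Z
  generalize be a b (m + 1) = B
  obtain ⟨s, hs⟩ : ∃ s, s = 2 * m + 2 + a + b := ⟨_, rfl⟩
  rw [← hs] at h4 h5 ⊢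
  have hb' : b = s - 2 * m - 2 - a := by rw [hs]; ring
  subst hb'
  field_simp
  ring

theorem Cv_ttG {a b : ℝ} (ha : -(1/2) < a) (hb : -(1/2) < b) (m : ℕ) :
    Cv a b (m + 1) (fun t => t * (1 - t) * lg 1 (-1) t) (lg 1 (-1)) =
      -((m + 1) / (2 * m + 2 + a + b)) + (m + 1) * (m + 1 + a + b) / ((2 * m + 2 + a + b) ^ 2 - 1)
      + (2 * m + 2 + a + b) / 2 * (be a b (m + 1) * rr a b 1 (-1) (m + 1) *
        (lm a b 1 (-1) (m + 1) + lm a b 1 (-1) m) + be a b (m + 1) *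
        (dl a b 1 (-1) 1 (-1) (m + 1) + dl a b 1 (-1) 1 (-1) m)) := by
  refine deriv_eq_of_dom ha hb (F := fun x y => Em x y (m + 1) (fun t => t * (1 - t) * lg 1 (-1) t))
    (fun _ _ hx hy => Em_ttG hx hy m) (Em_deriv ha hb 1 (-1) (Tame.tt.mul (Tame.lg 1 (-1))) (m + 1)) ?_
  have es : ∀ τ : ℝ, 2 * (m:ℝ) + 2 + (a + τ * 1) + (b + τ * (-1)) = 2 * m + 2 + a + b := by
    intro τ; ring
  have es2 : ∀ τ : ℝ, (m:ℝ) + 1 + (a + τ * 1) + (b + τ * (-1)) = m + 1 + a + b := by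
    intro τ; ring
  simp only [es, es2]
  have hd : HasDerivAt (fun τ : ℝ => (b + τ * (-1)) - (a + τ * 1)) (-2) 0 := by
    refine ((path_deriv b (-1)).fun_sub (path_deriv a 1)).congr_deriv ?_
    norm_num
  have k1 := (hd.const_mul (m + 1 : ℝ)).div_const (2 * (2 * m + 2 + a + b))
  have k2 := (hd.const_mul ((m + 1) * (m + 1 + a + b) : ℝ)).div_const
    (2 * ((2 * m + 2 + a + b) ^ 2 - 1))
  have k3 := ((be_deriv ha hb 1 (-1) m).fun_mul ((lm_deriv ha hb 1 (-1) 1 (-1) (m + 1)).fun_add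
    (lm_deriv ha hb 1 (-1) 1 (-1) m))).const_mul ((2 * m + 2 + a + b) / 2)
  refine ((k1.fun_sub k2).fun_add k3).congr_deriv ?_
  simp only [zero_mul, add_zero, dl]
  have h0 : ∀ x y : ℝ, x * -2 / (2 * y) = -(x / y) := by
    intro x y
    rw [mul_comm x, mul_div_mul_comm]; norm_num
  rw [h0, h0]
  ring

/-- (B) -/
theorem Em_fe {a b : ℝ} (ha : -(1/2) < a) (hb : -(1/2) < b) (m : ℕ) :
    Em a b m fe = ∑ j ∈ range m, (al a b j * lm a b 1 0 j + (1 - al a b j) * lm a b 0 1 j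
      + j / (2 * j + a + b) + (j + 1) / (2 * j + 2 + a + b)) := by
  unfold Em
  refine sum_congr rfl fun j _ => ?_
  have TG := Tame.lg 1 (-1)
  have e1 : ip a b fe j j = ip a b (fun t => t * lg 1 (-1) t) j j + ip a b (lg 0 1) j j := by
    rw [← ip_add ha hb (Tame.id'.mul TG) (Tame.lg 0 1)]
    exact ip_congr (fun t _ => fe_eq t) j j
  have h0 := (hh_pos ha hb j).ne'
  have o1 := ip_lg_off ha hb 1 (-1) j
  have o2 : be a b j * ip a b (lg 1 (-1)) (j - 1) j / hh a b j = dX a b 1 (-1) j := by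
    rcases j with - | j
    · simp [be_zero, dX]
    · have := ip_lg_off ha hb 1 (-1) j
      rw [← this, hh_succ ha hb]
      have h1 := (hh_pos ha hb j).ne'
      have h2 := (be_pos ha hb j).ne'
      simp only [Nat.add_sub_cancel]
      field_simp
  have e3 := lm_lin ha hb 1 (-1) j
  rw [e1, ip_rec ha hb TG, ip_comm a b _ (j + 1) j, add_div, add_div, add_div, o1, o2,
    mul_div_assoc]
  have e4 : ip a b (lg 1 (-1)) j j / hh a b j = lm a b 1 (-1) j := rfl
  have e5 : ip a b (lg 0 1) j j / hh a b j = lm a b 0 1 j := rfl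
  rw [e4, e5, e3]
  simp only [dX]
  push_cast
  ring_nf

theorem Cv_fe {a b : ℝ} (ha : -(1/2) < a) (hb : -(1/2) < b) (m : ℕ) :
    Cv a b m fe (lg 1 1) = ∑ j ∈ range m, (
      (dX a b 1 1 (j + 1) - dX a b 1 1 j) * (lm a b 1 0 j - lm a b 0 1 j)
      + al a b j * dl a b 1 0 1 1 j + (1 - al a b j) * dl a b 0 1 1 1 j
      - 2 * j / (2 * j + a + b) ^ 2 - 2 * (j + 1) / (2 * j + 2 + a + b) ^ 2) := by
  refine deriv_eq_of_dom ha hb (F := fun x y => Em x y m fe)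
    (fun _ _ hx hy => Em_fe hx hy m) (Em_deriv ha hb 1 1 Tame.fe m) ?_
  refine HasDerivAt.fun_sum fun j _ => ?_
  have hal : HasDerivAt (fun τ : ℝ => al (a + τ * 1) (b + τ * 1) j)
    (dX a b 1 1 (j + 1) - dX a b 1 1 j) 0 :=
    (Xm_deriv ha hb 1 1 (j + 1)).sub (Xm_deriv ha hb 1 1 j)
  have hj : (0 : ℝ) ≤ j := Nat.cast_nonneg j
  have hs := ((path_deriv a 1).const_add (2 * j : ℝ)).fun_add (path_deriv b 1)
  have hs2 := ((path_deriv a 1).const_add (2 * j + 2 : ℝ)).fun_add (path_deriv b 1)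
  have k1 : HasDerivAt (fun τ : ℝ => (j : ℝ) / (2 * j + (a + τ * 1) + (b + τ * 1)))
      (- (j * (1 + 1) / (2 * j + a + b) ^ 2)) 0 := by
    rcases Nat.eq_zero_or_pos j with h | h
    · subst h; simpa using hasDerivAt_const (0:ℝ) (0:ℝ)
    · have hj : (1 : ℝ) ≤ j := by exact_mod_cast h
      exact inv_path (j:ℝ) hs (by simp) (by linarith)
  have k2 := inv_path (j + 1 : ℝ) hs2 (x := 2 * j + 2 + a + b) (by simp) (by linarith)
  refine ((((hal.fun_mul (lm_deriv ha hb 1 0 1 1 j)).fun_add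
    ((hal.const_sub 1).fun_mul (lm_deriv ha hb 0 1 1 1 j))).fun_add k1).fun_add k2).congr_deriv ?_
  simp only [zero_mul, add_zero, dl]
  ring

/-- (A) -/
theorem Cv_LM {a b : ℝ} (ha : -(1/2) < a) (hb : -(1/2) < b) (m : ℕ) :
    Cv a b m (lg 1 0) (lg 0 1) = ∑ j ∈ range m, dl a b 1 0 0 1 j := by
  refine deriv_eq_of_dom ha hb (F := fun x y => Em x y m (lg 1 0))
    (H := fun x y => ∑ j ∈ range m, lm x y 1 0 j)
    (fun _ _ hx hy => rfl) (Em_deriv ha hb 0 1 (Tame.lg 1 0) m) ?_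
  exact HasDerivAt.fun_sum fun j _ => lm_deriv ha hb 1 0 0 1 j

/-- The variance in terms of explicit quantities. -/
theorem Cv_main {a b : ℝ} (ha : -(1/2) < a) (hb : -(1/2) < b) (m : ℕ) :
    Cv a b (m + 1) fe fe = be a b (m + 1) * (lm a b 1 (-1) (m + 1) * lm a b 1 (-1) m)
      - dX a b 1 (-1) (m + 1) ^ 2
      - Cv a b (m + 1) (fun t => t * (1 - t) * lg 1 (-1) t) (lg 1 (-1))
      + Cv a b (m + 1) fe (lg 1 1) - Cv a b (m + 1) (lg 1 0) (lg 0 1) := by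
  have TG := Tame.lg 1 (-1)
  have TM := Tame.lg 0 1
  have TL := Tame.lg 1 0
  have TtG := Tame.id'.mul TG
  have hpol := Cv_pol ha hb TG m
  rw [ip_lg_off ha hb] at hpol
  have s1 : ∀ k, Tame k → Cv a b (m+1) fe k = Cv a b (m+1) (fun t => t * lg 1 (-1) t) k +
      Cv a b (m+1) (lg 0 1) k := by
    intro k hk
    rw [← Cv_add ha hb TtG TM hk]
    exact Cv_congr fun t _ => fe_eq t
  have s2 : Cv a b (m+1) (fun t => t * (t * lg 1 (-1) t)) (lg 1 (-1)) =
      Cv a b (m+1) (fun t => t * lg 1 (-1) t) (lg 1 (-1)) -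
      Cv a b (m+1) (fun t => t * (1 - t) * lg 1 (-1) t) (lg 1 (-1)) := by
    rw [eq_sub_iff_add_eq, ← Cv_add ha hb (Tame.id'.mul TtG) (Tame.tt.mul TG) TG]
    refine Cv_congr fun t _ => ?_
    ring
  have s3 : ∀ (u v : ℝ) (k : ℝ → ℝ), Tame k → Cv a b (m+1) k (lg u v) =
      u * Cv a b (m+1) k (lg 1 0) + v * Cv a b (m+1) k (lg 0 1) := by
    intro u v k hk
    rw [Cv_comm a b _ k (lg 1 0), Cv_comm a b _ k (lg 0 1), ← Cv_smul, ← Cv_smul,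
      ← Cv_add ha hb ((Tame.const u).mul TL) ((Tame.const v).mul TM) hk, Cv_comm]
    refine Cv_congr fun t _ => ?_
    simp only [lg]; ring
  rw [s1 fe Tame.fe, Cv_comm a b _ _ fe, Cv_comm a b _ _ fe, s1 _ TtG, s1 _ TM, s1 _ (Tame.lg 1 1),
    hpol, s2, s3 1 1 _ TtG, s3 1 1 _ TM, s3 1 (-1) _ TtG, Cv_comm a b _ (lg 0 1) (lg 1 0),
    Cv_comm a b _ (lg 0 1) (fun t => t * lg 1 (-1) t)]
  unfold lm
  ring

theorem II_pow_one {a : ℝ} (ha : -(1/2) < a) : II a 0 (fun _ => 1) = 1 / (a + 1) := by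
  unfold II wt
  rw [← integral_Ioc_eq_integral_Ioo, ← intervalIntegral.integral_of_le zero_le_one]
  simp only [one_mul, rpow_zero, mul_one]
  rw [integral_rpow (Or.inl (by linarith))]
  rw [one_rpow, zero_rpow (by linarith)]; ring

theorem II_pow_log {a : ℝ} (ha : -(1/2) < a) : II a 0 (lg 1 0) = -(1 / (a + 1) ^ 2) := by
  have h1 := II_hasDerivAt (a := a) (b := 0) (by linarith) (by norm_num) 1 0 (Tame.const 1)
  have h2 : HasDerivAt (fun τ : ℝ => 1 / (a + τ * 1 + 1)) (-(1 * 1 / (a + 1) ^ 2)) 0 :=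
    inv_path 1 ((path_deriv a 1).add_const 1) (by simp) (by linarith)
  have h3 := deriv_eq_of_dom (F := fun x _ => II x 0 (fun _ => 1)) (H := fun x _ => 1 / (x + 1))
    (b := 0) (v := 0) ha (by norm_num) (fun x y hx hy => II_pow_one hx) (by simpa using h1) h2
  simp only [one_mul] at h3
  rw [← h3]

theorem II_pow_logsq {a : ℝ} (ha : -(1/2) < a) :
    II a 0 (fun t => lg 1 0 t * lg 1 0 t) = 2 / (a + 1) ^ 3 := by
  have h1 := II_hasDerivAt (a := a) (b := 0) (by linarith) (by norm_num) 1 0 (Tame.lg 1 0)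
  have h2 : HasDerivAt (fun τ : ℝ => -(1 / (a + τ * 1 + 1) ^ 2))
      (-(-(1 * (2 * (a + 1)) / ((a + 1) ^ 2) ^ 2))) 0 := by
    refine (inv_path 1 (x := (a + 1) ^ 2) ((((path_deriv a 1).add_const 1).fun_pow 2).congr_deriv ?_)
      (by simp) (by have : a + 1 ≠ 0 := by linarith
                    positivity)).fun_neg
    simp
  have h3 := deriv_eq_of_dom (F := fun x _ => II x 0 (lg 1 0)) (H := fun x _ => -(1 / (x + 1) ^ 2))
    (b := 0) (v := 0) ha (by norm_num) (fun x y hx hy => II_pow_log hx) (by simpa using h1) h2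
  rw [h3]
  have : a + 1 ≠ 0 := by linarith
  field_simp

theorem II_refl (g : ℝ → ℝ) : II 0 0 g = II 0 0 (fun t => g (1 - t)) := by
  unfold II wt
  simp only [rpow_zero, mul_one]
  rw [← integral_Ioc_eq_integral_Ioo, ← integral_Ioc_eq_integral_Ioo,
    ← intervalIntegral.integral_of_le zero_le_one, ← intervalIntegral.integral_of_le zero_le_one]
  rw [intervalIntegral.integral_comp_sub_left (fun x => g x) 1]
  simp

theorem hasSum_base : HasSum (fun n : ℕ => 1 / ((n + 1 : ℝ) * (n + 2) ^ 2)) (2 - π ^ 2 / 6) := by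
  have h1 : HasSum (fun n : ℕ => 1 / ((n : ℝ) + 2) ^ 2) (π ^ 2 / 6 - 1) := by
    have := (hasSum_nat_add_iff' 2).2 hasSum_zeta_two
    simpa [Finset.sum_range_succ] using this
  have h2 : HasSum (fun n : ℕ => 1 / ((n : ℝ) + 1) - 1 / ((n : ℝ) + 2)) 1 := by
    rw [hasSum_iff_tendsto_nat_of_nonneg]
    · have e : ∀ n : ℕ, ∑ i ∈ range n, (1 / ((i : ℝ) + 1) - 1 / ((i : ℝ) + 2))
          = 1 - 1 / ((n : ℝ) + 1) := by
        intro n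
        have := Finset.sum_range_sub' (fun i : ℕ => 1 / ((i : ℝ) + 1)) n
        simp only [Nat.cast_add, Nat.cast_one, Nat.cast_zero, zero_add, div_one] at this
        rw [← this]
        refine Finset.sum_congr rfl fun i _ => ?_
        rw [add_assoc]; norm_num
      simp only [e]
      simpa using (tendsto_one_div_add_atTop_nhds_zero_nat (𝕜 := ℝ)).const_sub 1
    · intro n
      have : 1 / ((n : ℝ) + 2) ≤ 1 / ((n : ℝ) + 1) := by gcongr; norm_num
      linarith
  have h3 := h2.sub h1
  have e : (2 - π ^ 2 / 6) = 1 - (π ^ 2 / 6 - 1) := by ring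
  rw [e]
  refine h3.congr_fun ?_
  intro n
  have h1 : (n : ℝ) + 1 ≠ 0 := by positivity
  have h2 : (n : ℝ) + 2 ≠ 0 := by positivity
  field_simp
  ring

theorem II_loglog : II 0 0 (fun t => lg 1 0 t * lg 0 1 t) = 2 - π ^ 2 / 6 := by
  have key := hasSum_integral_of_summable_integral_norm
    (μ := volume.restrict (Set.Ioo (0:ℝ) 1))
    (F := fun (n : ℕ) (t : ℝ) => -(t ^ (n + 1) * Real.log t / (n + 1)))
  have hIntg : ∀ n : ℕ, IntegrableOn (fun t : ℝ => t ^ (n + 1) * Real.log t) (Set.Ioo 0 1) := by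
    intro n
    have := ((Tame.poly (Polynomial.X ^ (n + 1))).mul Tame.log).integrable
      (a := 0) (b := 0) (by norm_num) (by norm_num)
    simpa [wt] using this
  have hval : ∀ n : ℕ, ∫ t in Set.Ioo (0:ℝ) 1, t ^ (n + 1) * Real.log t = -(1 / (n + 2 : ℝ) ^ 2) := by
    intro n
    have := II_pow_log (a := (n + 1 : ℕ)) (by push_cast; linarith [(Nat.cast_nonneg n : (0:ℝ) ≤ n)])
    unfold II wt lg at this
    simp only [rpow_zero, rpow_natCast, one_mul, zero_mul, add_zero, mul_one] at this
    simp only [mul_comm (Real.log _)] at this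
    rw [this]; push_cast; ring
  have hval' : ∀ n : ℕ, ∫ t in Set.Ioo (0:ℝ) 1, -(t ^ (n + 1) * Real.log t / (n + 1))
      = 1 / ((n + 1 : ℝ) * (n + 2) ^ 2) := by
    intro n
    rw [integral_neg, integral_div, hval]
    have h1 : (n : ℝ) + 1 ≠ 0 := by positivity
    have h2 : (n : ℝ) + 2 ≠ 0 := by positivity
    field_simp
  have hnorm : ∀ n : ℕ, ∫ t in Set.Ioo (0:ℝ) 1, ‖-(t ^ (n + 1) * Real.log t / (n + 1))‖
      = 1 / ((n + 1 : ℝ) * (n + 2) ^ 2) := by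
    intro n
    rw [← hval' n]
    refine setIntegral_congr_fun measurableSet_Ioo fun t ht => ?_
    rw [Real.norm_of_nonneg]
    have h1 : 0 ≤ t ^ (n + 1) := pow_nonneg ht.1.le _
    have h2 : Real.log t ≤ 0 := Real.log_nonpos ht.1.le ht.2.le
    have h3 : (0:ℝ) ≤ n + 1 := by positivity
    have := div_nonneg (mul_nonneg h1 (neg_nonneg.2 h2)) h3
    rw [mul_neg, neg_div] at this
    exact this
  have k2 := key (fun n => ((hIntg n).div_const _).neg) (by simp only [hnorm]; exact hasSum_base.summable)
  simp only [hval'] at k2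
  have k3 := k2.unique hasSum_base
  rw [← k3]
  unfold II
  refine setIntegral_congr_fun measurableSet_Ioo fun t ht => ?_
  have hs := (hasSum_pow_div_log_of_abs_lt_one (x := t) (by rw [abs_of_pos ht.1]; exact ht.2)).mul_right
    (-Real.log t)
  have := hs.tsum_eq
  simp only [lg, wt, rpow_zero]
  have e : ∀ n : ℕ, -(t ^ (n + 1) * Real.log t / (n + 1)) = t ^ (n + 1) / (n + 1) * -Real.log t := by
    intro n; ring
  simp only [e]
  rw [this]; ring

theorem lm_base (u v : ℝ) : lm 0 0 u v 0 = -u - v := by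
  rw [lm_lin (by norm_num) (by norm_num), lm_zero, lm_zero, II_pow_one (by norm_num)]
  have h1 := II_pow_log (a := 0) (by norm_num)
  have h2 : II 0 0 (lg 0 1) = II 0 0 (lg 1 0) := by
    rw [II_refl (lg 0 1)]
    refine II_congr fun t _ => ?_
    simp [lg]
  rw [h2, h1]; norm_num; ring

theorem KK_base (u v u' v' : ℝ) :
    KK 0 0 u v u' v' = u * u' + v * v' + (u * v' + u' * v) * (1 - π ^ 2 / 6) := by
  unfold KK
  have hl : ∀ u v, II 0 0 (lg u v) = -u - v := by
    intro u v
    rw [← lm_base, lm_zero, II_pow_one (by norm_num)]; norm_num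
  have h1 := II_pow_logsq (a := 0) (by norm_num)
  have h2 : II 0 0 (fun t => lg 0 1 t * lg 0 1 t) = II 0 0 (fun t => lg 1 0 t * lg 1 0 t) := by
    rw [II_refl (fun t => lg 0 1 t * lg 0 1 t)]
    refine II_congr fun t _ => ?_
    simp [lg]
  have h3 := II_loglog
  have h4 : II 0 0 (fun t => lg u v t * lg u' v' t) =
      u * u' * II 0 0 (fun t => lg 1 0 t * lg 1 0 t) + v * v' * II 0 0 (fun t => lg 0 1 t * lg 0 1 t)
       + (u * v' + u' * v) * II 0 0 (fun t => lg 1 0 t * lg 0 1 t) := by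
    have T1 := (Tame.const (u * u')).mul ((Tame.lg 1 0).mul (Tame.lg 1 0))
    have T2 := (Tame.const (v * v')).mul ((Tame.lg 0 1).mul (Tame.lg 0 1))
    have T3 := (Tame.const (u * v' + u' * v)).mul ((Tame.lg 1 0).mul (Tame.lg 0 1))
    rw [← II_smul, ← II_smul, ← II_smul, ← II_add (by norm_num) (by norm_num) T1 T2,
      ← II_add (by norm_num) (by norm_num) (T1.add T2) T3]
    refine II_congr fun t _ => ?_
    simp only [lg]; ring
  rw [h4, h2, h1, h3, hl, hl, II_pow_one (by norm_num)]
  norm_num; ring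

theorem II_one_succ {a b : ℝ} (ha : -(1/2) < a) (hb : -(1/2) < b) :
    II (a + 1) b (fun _ => 1) = (a + 1) / (a + b + 2) * II a b (fun _ => 1) := by
  have h := II_parts (a := a) (b := b) (by linarith) (by linarith) (h := fun _ => 1) (h' := fun _ => 0)
    continuousOn_const (fun t _ => hasDerivAt_const _ _) (Tame.const 0) 1
  have e0 : II a b (fun t => (0:ℝ) * (t * (1 - t) * (1 : Polynomial ℝ).eval t)) = 0 := by
    unfold II; simp
  rw [e0, zero_add] at h
  have e1 : II a b (fun t => (1:ℝ) * (t * (1 - t) * (1 : Polynomial ℝ).derivative.eval t +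
      ((a + 1) - (a + b + 2) * t) * (1 : Polynomial ℝ).eval t)) =
      (a + 1) * II a b (fun _ => 1) + (-(a + b + 2)) * II a b (fun t => t * 1) := by
    rw [← II_smul, ← II_smul, ← II_add (by linarith) (by linarith)
      ((Tame.const _).mul (Tame.const 1)) ((Tame.const _).mul (Tame.id'.mul (Tame.const 1)))]
    refine II_congr fun t _ => ?_
    simp; ring
  rw [e1] at h
  rw [II_shift]
  have : a + b + 2 ≠ 0 := by linarith
  rw [div_mul_eq_mul_div, eq_div_iff this]
  linarith

theorem II_one_succ' {a b : ℝ} (ha : -(1/2) < a) (hb : -(1/2) < b) :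
    II a (b + 1) (fun _ => 1) = (b + 1) / (a + b + 2) * II a b (fun _ => 1) := by
  have h1 := II_one_succ ha hb
  have h2 : II a (b + 1) (fun _ => 1) + II (a + 1) b (fun _ => 1) = II a b (fun _ => 1) := by
    rw [II_shift, II_shift', ← II_add (by linarith) (by linarith)
      (((Tame.const 1).sub Tame.id').mul (Tame.const 1)) (Tame.id'.mul (Tame.const 1))]
    refine II_congr fun t _ => ?_
    ring
  have h3 : II a (b + 1) (fun _ => 1) = II a b (fun _ => 1) - II (a + 1) b (fun _ => 1) := by linarith
  rw [h3, h1]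
  have : a + b + 2 ≠ 0 := by linarith
  field_simp; ring

theorem lm_shift {a b : ℝ} (ha : -(1/2) < a) (hb : -(1/2) < b) (u v : ℝ) :
    lm (a + 1) b u v 0 = lm a b u v 0 + u / (a + 1) - (u + v) / (a + b + 2) := by
  have hA := path_deriv a u
  have hB := path_deriv b v
  have s1 : a + 1 ≠ 0 := by linarith
  have s2 : a + b + 2 ≠ 0 := by linarith
  have h1 := II_hasDerivAt (a := a + 1) (b := b) (by linarith) (by linarith) u v (Tame.const 1)
  have h2 := II_hasDerivAt (a := a) (b := b) (by linarith) (by linarith) u v (Tame.const 1)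
  have h4 := ((hA.add_const 1).fun_div ((hA.fun_add hB).add_const 2) (by simpa using s2)).fun_mul h2
  have h3 := deriv_eq_of_dom (F := fun x y => II (x + 1) y (fun _ => 1))
    (H := fun x y => (x + 1) / (x + y + 2) * II x y (fun _ => 1)) ha hb
    (fun x y hx hy => II_one_succ hx hy) (by simpa only [add_right_comm] using h1) h4
  have h5 := II_one_succ ha hb
  have p0 : II a b (fun _ => 1) ≠ 0 := (II_pos (by linarith) (by linarith)).ne'
  rw [lm_zero, lm_zero, h5]
  simp only [one_mul, zero_mul, add_zero] at h3
  have h6 : II (a + 1) b (lg u v) = _ := h3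
  have e : II a b (fun t => lg u v t) = II a b (lg u v) := rfl
  rw [h6, e]
  field_simp
  ring

theorem lm_shift' {a b : ℝ} (ha : -(1/2) < a) (hb : -(1/2) < b) (u v : ℝ) :
    lm a (b + 1) u v 0 = lm a b u v 0 + v / (b + 1) - (u + v) / (a + b + 2) := by
  have hA := path_deriv a u
  have hB := path_deriv b v
  have s1 : b + 1 ≠ 0 := by linarith
  have s2 : a + b + 2 ≠ 0 := by linarith
  have h1 := II_hasDerivAt (a := a) (b := b + 1) (by linarith) (by linarith) u v (Tame.const 1)
  have h2 := II_hasDerivAt (a := a) (b := b) (by linarith) (by linarith) u v (Tame.const 1)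
  have h4 := ((hB.add_const 1).fun_div ((hA.fun_add hB).add_const 2) (by simpa using s2)).fun_mul h2
  have h3 := deriv_eq_of_dom (F := fun x y => II x (y + 1) (fun _ => 1))
    (H := fun x y => (y + 1) / (x + y + 2) * II x y (fun _ => 1)) ha hb
    (fun x y hx hy => II_one_succ' hx hy) (by simpa only [add_right_comm] using h1) h4
  have h5 := II_one_succ' ha hb
  have p0 : II a b (fun _ => 1) ≠ 0 := (II_pos (by linarith) (by linarith)).ne'
  rw [lm_zero, lm_zero, h5]
  simp only [one_mul, zero_mul, add_zero] at h3
  have h6 : II a (b + 1) (lg u v) = _ := h3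
  have e : II a b (fun t => lg u v t) = II a b (lg u v) := rfl
  rw [h6, e]
  field_simp
  ring

theorem KK_shift {a b : ℝ} (ha : -(1/2) < a) (hb : -(1/2) < b) (u v u' v' : ℝ) :
    KK (a + 1) b u v u' v' = KK a b u v u' v' - u * u' / (a + 1) ^ 2
      + (u + v) * (u' + v') / (a + b + 2) ^ 2 := by
  have hA := path_deriv a u'
  have hB := path_deriv b v'
  have s1 : a + 1 ≠ 0 := by linarith
  have s2 : a + b + 2 ≠ 0 := by linarith
  have h1 := lm_zero_deriv (a := a + 1) (b := b) (by linarith) (by linarith) u v u' v'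
  have h2 := lm_zero_deriv ha hb u v u' v'
  have h4 := (h2.fun_add (inv_path (x := a + 1) u (hA.add_const 1) (by simp) s1)).fun_sub
    (inv_path (x := a + b + 2) (u + v) ((hA.fun_add hB).add_const 2) (by simp) s2)
  have h3 := deriv_eq_of_dom (F := fun x y => lm (x + 1) y u v 0)
    (H := fun x y => lm x y u v 0 + u / (x + 1) - (u + v) / (x + y + 2)) ha hb
    (fun x y hx hy => lm_shift hx hy u v) (by simpa only [add_right_comm] using h1) h4
  rw [h3]; ring

theorem KK_shift' {a b : ℝ} (ha : -(1/2) < a) (hb : -(1/2) < b) (u v u' v' : ℝ) :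
    KK a (b + 1) u v u' v' = KK a b u v u' v' - v * v' / (b + 1) ^ 2
      + (u + v) * (u' + v') / (a + b + 2) ^ 2 := by
  have hA := path_deriv a u'
  have hB := path_deriv b v'
  have s1 : b + 1 ≠ 0 := by linarith
  have s2 : a + b + 2 ≠ 0 := by linarith
  have h1 := lm_zero_deriv (a := a) (b := b + 1) (by linarith) (by linarith) u v u' v'
  have h2 := lm_zero_deriv ha hb u v u' v'
  have h4 := (h2.fun_add (inv_path (x := b + 1) v (hB.add_const 1) (by simp) s1)).fun_sub
    (inv_path (x := a + b + 2) (u + v) ((hA.fun_add hB).add_const 2) (by simp) s2)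
  have h3 := deriv_eq_of_dom (F := fun x y => lm x (y + 1) u v 0)
    (H := fun x y => lm x y u v 0 + v / (y + 1) - (u + v) / (x + y + 2)) ha hb
    (fun x y hx hy => lm_shift' hx hy u v) (by simpa only [add_right_comm] using h1) h4
  rw [h3]; ring

theorem psi0_succ (k : ℕ) : psi0 (k + 1 + 1) = psi0 (k + 1) + 1 / ((k : ℝ) + 1) := by
  unfold psi0
  simp only [Nat.add_sub_cancel]
  rw [Finset.sum_range_succ]; ring

theorem psi1_succ (k : ℕ) : psi1 (k + 1 + 1) = psi1 (k + 1) - 1 / ((k : ℝ) + 1) ^ 2 := by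
  unfold psi1
  simp only [Nat.add_sub_cancel]
  rw [Finset.sum_range_succ]; ring

theorem nat_dom (A : ℕ) : -(1/2) < (A : ℝ) := by
  have : (0:ℝ) ≤ A := Nat.cast_nonneg A
  linarith

theorem lm_nat_zero (A B : ℕ) (u v : ℝ) :
    lm A B u v 0 = u * psi0 (A + 1) + v * psi0 (B + 1) - (u + v) * psi0 (A + B + 1 + 1) := by
  induction B with
  | zero =>
    induction A with
    | zero =>
      have := lm_base u v
      simp only [Nat.cast_zero, zero_add] at *
      rw [this]
      have := psi0_succ 0
      simp only [zero_add] at this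
      rw [this]; norm_num; ring
    | succ A ih =>
      have := lm_shift (nat_dom A) (nat_dom 0) u v
      push_cast at *
      rw [this, ih]
      simp only [add_zero, zero_add]
      rw [psi0_succ (A + 1), psi0_succ A]; push_cast; ring
  | succ B ih =>
    have := lm_shift' (nat_dom A) (nat_dom B) u v
    push_cast at *
    rw [this, ih]
    rw [psi0_succ B, ← add_assoc A B 1, psi0_succ (A + B + 1)]; push_cast; ring

theorem KK_nat (A B : ℕ) (u v u' v' : ℝ) :
    KK A B u v u' v' = u * u' * psi1 (A + 1) + v * v' * psi1 (B + 1)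
      - (u + v) * (u' + v') * psi1 (A + B + 1 + 1) := by
  induction B with
  | zero =>
    induction A with
    | zero =>
      have := KK_base u v u' v'
      simp only [Nat.cast_zero, zero_add] at *
      rw [this]
      have := psi1_succ 0
      simp only [zero_add] at this
      rw [this]; simp [psi1]; ring
    | succ A ih =>
      have := KK_shift (nat_dom A) (nat_dom 0) u v u' v'
      push_cast at *
      rw [this, ih]
      simp only [add_zero, zero_add]
      rw [psi1_succ (A + 1), psi1_succ A]; push_cast; ring
  | succ B ih =>
    have := KK_shift' (nat_dom A) (nat_dom B) u v u' v'
    push_cast at *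
    rw [this, ih]
    rw [psi1_succ B, ← add_assoc A B 1, psi1_succ (A + B + 1)]; push_cast; ring

theorem lm_nat (A B : ℕ) (u v : ℝ) (j : ℕ) :
    lm A B u v j = u * psi0 (j + A + 1) + v * psi0 (j + B + 1) + (u + v) *
      (psi0 (j + A + B + 1) - psi0 (2 * j + A + B + 1) - psi0 (2 * j + A + B + 1 + 1)) := by
  induction j with
  | zero => rw [lm_nat_zero]; simp only [zero_add, mul_zero]; ring
  | succ j ih =>
    rw [lm_succ (nat_dom A) (nat_dom B), ih]
    have e1 : j + 1 + A + 1 = (j + A) + 1 + 1 := by ring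
    have e2 : j + 1 + B + 1 = (j + B) + 1 + 1 := by ring
    have e3 : j + 1 + A + B + 1 = (j + A + B) + 1 + 1 := by ring
    have e4 : 2 * (j + 1) + A + B + 1 = (2 * j + A + B + 1) + 1 + 1 := by ring
    rw [e1, e2, e3, e4, psi0_succ (j + A), psi0_succ (j + B), psi0_succ (j + A + B),
      psi0_succ (2 * j + A + B + 1 + 1), psi0_succ (2 * j + A + B + 1), psi0_succ (2 * j + A + B)]
    unfold rr
    push_cast
    ring

theorem dl_nat (A B : ℕ) (u v u' v' : ℝ) (j : ℕ) :
    dl A B u v u' v' j = u * u' * psi1 (j + A + 1) + v * v' * psi1 (j + B + 1)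
      + (u + v) * (u' + v') *
      (psi1 (j + A + B + 1) - psi1 (2 * j + A + B + 1) - psi1 (2 * j + A + B + 1 + 1)) := by
  induction j with
  | zero => unfold dl; rw [KK_nat]; simp only [zero_add, mul_zero, range_zero, sum_empty]; ring
  | succ j ih =>
    have : dl A B u v u' v' (j + 1) = dl A B u v u' v' j + qq A B u v u' v' (j + 1) := by
      unfold dl; rw [Finset.sum_range_succ]; ring
    rw [this, ih]
    have e1 : j + 1 + A + 1 = (j + A) + 1 + 1 := by ring
    have e2 : j + 1 + B + 1 = (j + B) + 1 + 1 := by ring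
    have e3 : j + 1 + A + B + 1 = (j + A + B) + 1 + 1 := by ring
    have e4 : 2 * (j + 1) + A + B + 1 = (2 * j + A + B + 1) + 1 + 1 := by ring
    rw [e1, e2, e3, e4, psi1_succ (j + A), psi1_succ (j + B), psi1_succ (j + A + B),
      psi1_succ (2 * j + A + B + 1 + 1), psi1_succ (2 * j + A + B + 1), psi1_succ (2 * j + A + B)]
    unfold qq
    push_cast
    ring

/-- summand of the closed-form sum -/
theorem F_nat (A B : ℕ) (m : ℕ) :
    Cv A B m fe (lg 1 1) - Cv A B m (lg 1 0) (lg 0 1) =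
      Xm A B m * psi1 (m + A + 1) + (m - Xm A B m) * psi1 (m + B + 1)
      + dX A B 1 1 m * (psi0 (m + A + 1) - psi0 (m + B + 1))
      - ((2 * m + A + B) * psi1 (2 * m + A + B + 1) + psi0 (2 * m + A + B + 1))
      + ((m + A + B) * psi1 (m + A + B + 1) + psi0 (m + A + B + 1))
      + 2 * m / (2 * m + A + B) ^ 2 := by
  rw [Cv_fe (nat_dom A) (nat_dom B), Cv_LM (nat_dom A) (nat_dom B), ← Finset.sum_sub_distrib]
  induction m with
  | zero => simp [Xm, dX]
  | succ j ih =>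
    rw [Finset.sum_range_succ, ih]
    simp only [lm_nat, dl_nat]
    have e1 : j + 1 + A + 1 = (j + A) + 1 + 1 := by ring
    have e2 : j + 1 + B + 1 = (j + B) + 1 + 1 := by ring
    have e3 : j + 1 + A + B + 1 = (j + A + B) + 1 + 1 := by ring
    have e4 : 2 * (j + 1) + A + B + 1 = (2 * j + A + B + 1) + 1 + 1 := by ring
    rw [e1, e2, e3, e4, psi1_succ (j + A), psi1_succ (j + B), psi1_succ (j + A + B),
      psi1_succ (2 * j + A + B + 1), psi1_succ (2 * j + A + B),
      psi0_succ (j + A), psi0_succ (j + B), psi0_succ (j + A + B),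
      psi0_succ (2 * j + A + B + 1), psi0_succ (2 * j + A + B)]
    have hj : (0:ℝ) ≤ j := Nat.cast_nonneg j
    have hA : (0:ℝ) ≤ A := Nat.cast_nonneg A
    have hB : (0:ℝ) ≤ B := Nat.cast_nonneg B
    have hX : Xm A B (j + 1) = (j + 1) * (j + 1 + A) / (2 * j + 2 + A + B) := by
      unfold Xm; push_cast; ring_nf
    have hd : dX A B 1 1 (j + 1) = (j + 1) * (B - A) / (2 * j + 2 + A + B) ^ 2 := by
      unfold dX; push_cast
      have : (2 * j + 2 + A + B : ℝ) ≠ 0 := by positivity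
      have h2 : (2 * (j + 1) + A + B : ℝ) = 2 * j + 2 + A + B := by ring
      rw [h2]
      field_simp; ring
    rw [al, hX, hd]
    generalize Xm A B j = X
    generalize dX A B 1 1 j = d
    push_cast
    generalize (2 * (j:ℝ) / (2 * j + A + B) ^ 2) = w
    generalize psi1 _ = q1
    generalize psi1 _ = q2
    generalize psi1 _ = q3
    generalize psi1 _ = q4
    generalize psi0 _ = q5
    generalize psi0 _ = q6
    generalize psi0 _ = q7
    generalize psi0 _ = q8
    generalize (A:ℝ) = a at *
    generalize (B:ℝ) = b at *
    generalize (j:ℝ) = k at *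
    have h1 : (k + a + 1) ≠ 0 := by positivity
    have h2 : (k + b + 1) ≠ 0 := by positivity
    have h3 : (k + a + b + 1) ≠ 0 := by positivity
    have h4 : (2 * k + a + b + 1) ≠ 0 := by positivity
    have h5 : (2 * k + a + b + 1 + 1) ≠ 0 := by positivity
    have h6 : (2 * k + 2 + a + b) ≠ 0 := by positivity
    have h7 : (2 * (k + 1) + a + b) ≠ 0 := by positivity
    have K1 : (k + 1) * (k + 1 + a) / (2 * k + 2 + a + b) * (1 / (k + a + 1) ^ 2)
        + (k + 1 - (k + 1) * (k + 1 + a) / (2 * k + 2 + a + b)) * (1 / (k + b + 1) ^ 2)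
        - (k + 1) * (b - a) / (2 * k + 2 + a + b) ^ 2 * (1 / (k + a + 1) - 1 / (k + b + 1))
        = 4 * (k + 1) / (2 * k + 2 + a + b) ^ 2 := by
      have e : k + 1 + a = k + a + 1 := by ring
      rw [e]
      field_simp
      ring
    have K2 : (2 * k + 2 + a + b) * (1 / (2 * k + a + b + 1) ^ 2 + 1 / (2 * k + 2 + a + b) ^ 2)
        - 1 / (2 * k + a + b + 1) - 1 / (2 * k + 2 + a + b) = 1 / (2 * k + a + b + 1) ^ 2 := by
      field_simp; ring
    have K3 : (k + a + b + 1) * (1 / (k + a + b + 1) ^ 2) = 1 / (k + a + b + 1) := by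
      field_simp
    clear ih hX hd
    linear_combination K1 - K2 + K3

theorem final_alg (M p r D f g : ℝ) (hp : p ≠ 0) (hr : r ≠ 0) (s0 : p + r ≠ 0) (s1 : p + r - 1 ≠ 0)
    (s2 : p + r + 1 ≠ 0) :
    M * p * r * (p + r - M) / ((p + r) ^ 2 * ((p + r - 1) * (p + r + 1))) *
        ((-D + 1 / p - 1 / r) * (-D)) - (M / (p + r)) ^ 2
      - (-(M / (p + r)) + M * (p + r - M) / ((p + r - 1) * (p + r + 1))
        + (p + r) / 2 * (M * (p + r - M) * (r - p) / ((p + r) ^ 2 * ((p + r - 1) * (p + r + 1))) *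
          ((-D + 1 / p - 1 / r) + (-D))
         + M * p * r * (p + r - M) / ((p + r) ^ 2 * ((p + r - 1) * (p + r + 1))) *
          ((f - 1 / p ^ 2 + (g - 1 / r ^ 2)) + (f + g))))
      + (M * p / (p + r) * (f - 1 / p ^ 2) + M * r / (p + r) * (g - 1 / r ^ 2)
        + M * (r - p) / (p + r) ^ 2 * (-D + 1 / p - 1 / r) + 2 * M / (p + r) ^ 2)
    = (M * r * (M ^ 2 + 2 * M * (p + r - M) + (p + r - M) ^ 2 - (p + r - M) * p - 1)
        / ((p + r - 1) * (p + r) * (p + r + 1))) * g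
      + (M * p * (M ^ 2 + M * (p + r - M) + (p + r - M) * p - 1)
        / ((p + r - 1) * (p + r) * (p + r + 1))) * f
      + (M * (p + r - M) * p * r / ((p + r) * ((p + r - 1) * (p + r) * (p + r + 1)))) * D ^ 2
      + (-(M * (M + 1) * (p + r - 2 * p)) / ((p + r) * ((p + r) * (p + r + 1)))) * D
      + (-(M * (2 * M + (p + r - M) + 2)) / ((p + r) * ((p + r) * (p + r + 1)))) := by
  field_simp
  ring

theorem Cv_nat (m n p : ℕ) (hm : 1 ≤ m) (hmp : m ≤ p) (hpn : p ≤ n) :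
    Cv ((p - m : ℕ) : ℝ) ((n - p : ℕ) : ℝ) m fe fe =
      ((m : ℝ) * (m + n - p) * (m ^ 2 + 2 * m * n + n ^ 2 - n * p - 1)
          / ((m + n - 1) * (m + n) * (m + n + 1))) * psi1 (m + n - p)
        - ((m : ℝ) + n) * psi1 (m + n) + (n : ℝ) * psi1 n
        + ((m : ℝ) * p * (m ^ 2 + m * n + n * p - 1)
          / ((m + n - 1) * (m + n) * (m + n + 1))) * psi1 p
        + ((m : ℝ) * n * p * (m + n - p)
          / ((m + n) * ((m + n - 1) * (m + n) * (m + n + 1))))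
          * (psi0 (m + n - p) - psi0 p) ^ 2
        + (-((m : ℝ) * (m + 1) * (m + n - 2 * p))
          / ((m + n) * ((m + n) * (m + n + 1)))) * (psi0 (m + n - p) - psi0 p)
        - psi0 (m + n) + psi0 n
        + (-((m : ℝ) * (2 * m + n + 2)) / ((m + n) * ((m + n) * (m + n + 1)))) := by
  obtain ⟨k, rfl⟩ : ∃ k, m = k + 1 := ⟨m - 1, by omega⟩
  obtain ⟨A, rfl⟩ : ∃ A, p = k + A + 1 := ⟨p - k - 1, by omega⟩
  obtain ⟨B, rfl⟩ : ∃ B, n = k + A + B + 1 := ⟨n - k - A - 1, by omega⟩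
  have n1 : k + A + 1 - (k + 1) = A := by omega
  have n2 : k + A + B + 1 - (k + A + 1) = B := by omega
  have n3 : k + 1 + (k + A + B + 1) - (k + A + 1) = k + B + 1 := by omega
  have n4 : k + 1 + (k + A + B + 1) = 2 * k + A + B + 1 + 1 := by ring
  rw [n3, n4, n1, n2]
  have hk : (0:ℝ) ≤ k := Nat.cast_nonneg k
  have hA : (0:ℝ) ≤ A := Nat.cast_nonneg A
  have hB : (0:ℝ) ≤ B := Nat.cast_nonneg B
  have main := Cv_main (nat_dom A) (nat_dom B) k
  rw [Cv_ttG (nat_dom A) (nat_dom B), be_rr (nat_dom A) (nat_dom B)] at main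
  have hF := F_nat A B (k + 1)
  simp only [lm_nat, dl_nat] at main
  have e1 : k + 1 + A + 1 = (k + A) + 1 + 1 := by ring
  have e2 : k + 1 + B + 1 = (k + B) + 1 + 1 := by ring
  have e3 : k + 1 + A + B + 1 = (k + A + B) + 1 + 1 := by ring
  have e4 : 2 * (k + 1) + A + B + 1 = (2 * k + A + B + 1) + 1 + 1 := by ring
  rw [e1, e2, psi0_succ (k + A), psi0_succ (k + B), psi1_succ (k + A), psi1_succ (k + B)] at main hF
  rw [e3, e4, psi0_succ (k + A + B), psi0_succ (2 * k + A + B + 1),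
    psi1_succ (k + A + B), psi1_succ (2 * k + A + B + 1)] at hF
  have hbe : be A B (k + 1) = (k + 1) * (k + 1 + A) * (k + 1 + B) * (k + 1 + A + B) /
      ((k + 1 + A + (k + 1 + B)) ^ 2 *
        ((k + 1 + A + (k + 1 + B) - 1) * (k + 1 + A + (k + 1 + B) + 1))) := by
    unfold be; push_cast; ring_nf
  have hX : Xm A B (k + 1) = (k + 1) * (k + 1 + A) / (k + 1 + A + (k + 1 + B)) := by
    unfold Xm; push_cast; ring_nf
  have hs : (k + 1 + A + (k + 1 + B) : ℝ) ≠ 0 := by positivity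
  have hX' : ((k + 1 : ℕ) : ℝ) - Xm A B (k + 1) =
      (k + 1) * (k + 1 + B) / (k + 1 + A + (k + 1 + B)) := by
    rw [hX]; push_cast; field_simp; ring
  have h2 : (2 * (k + 1) + A + B : ℝ) = k + 1 + A + (k + 1 + B) := by ring
  have hd : dX A B 1 1 (k + 1) = (k + 1) * (B - A) / (k + 1 + A + (k + 1 + B)) ^ 2 := by
    unfold dX; push_cast
    rw [h2]
    field_simp; ring
  have hd' : dX A B 1 (-1) (k + 1) = (k + 1) / (k + 1 + A + (k + 1 + B)) := by
    unfold dX; push_cast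
    rw [h2]
    ring
  rw [hX', hX, hd] at hF
  rw [hbe, hd'] at main
  rw [add_sub_assoc, hF] at main
  rw [main]
  have fin := final_alg (k + 1) (k + 1 + A) (k + 1 + B) (psi0 (k + B + 1) - psi0 (k + A + 1))
    (psi1 (k + A + 1)) (psi1 (k + B + 1)) (by positivity) (by positivity) (by positivity)
    (by have : (k + 1 + A + (k + 1 + B) - 1 : ℝ) = 2 * k + 1 + A + B := by ring
        rw [this]; positivity) (by positivity)
  push_cast
  generalize psi1 (k + A + 1) = q1 at *
  generalize psi1 (k + B + 1) = q2 at *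
  generalize psi1 (k + A + B + 1) = q3 at *
  generalize psi1 (2 * k + A + B + 1 + 1) = q4 at *
  generalize psi0 (k + A + 1) = q5 at *
  generalize psi0 (k + B + 1) = q6 at *
  generalize psi0 (k + A + B + 1) = q7 at *
  generalize psi0 (2 * k + A + B + 1 + 1) = q8 at *
  clear main hF hX hX' hd hd' hbe
  generalize (A:ℝ) = a at *
  generalize (B:ℝ) = b at *
  generalize (k:ℝ) = k at *
  obtain ⟨P, hP⟩ : ∃ P, P = k + 1 + a := ⟨_, rfl⟩
  obtain ⟨R, hR⟩ : ∃ R, R = k + 1 + b := ⟨_, rfl⟩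
  obtain ⟨M, hM⟩ : ∃ M, M = k + 1 := ⟨_, rfl⟩
  obtain rfl : a = P - M := by linarith
  obtain rfl : b = R - M := by linarith
  obtain rfl : k = M - 1 := by linarith
  have y1 : M - 1 + 1 = M := by ring
  have y2 : M + (P - M) = P := by ring
  have y3 : M + (R - M) = R := by ring
  have y4 : M - 1 + (P - M) + 1 = P := by ring
  have y5 : M - 1 + (R - M) + 1 = R := by ring
  have y6 : P + (R - M) = P + R - M := by ring
  have y7 : M - 1 + (P - M) + (R - M) + 1 = P + R - M := by ring
  have y8 : 2 * (M - 1) + 2 + (P - M) + (R - M) = P + R := by ring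
  have y9 : 2 * (M - 1) + (P - M) + (R - M) + 1 + 1 = P + R := by ring
  have y10 : 2 * M + (P - M) + (R - M) = P + R := by ring
  have y11 : M + (P + R - M) = P + R := by ring
  have y12 : P + R - P = R := by ring
  have y13 : R - M - (P - M) = R - P := by ring
  have y14 : (P + R) ^ 2 - 1 = (P + R - 1) * (P + R + 1) := by ring
  have y15 : M - 1 + (P - M) + (R - M) = P + R - M - 1 := by ring
  have y16 : 2 * (M - 1) + (P - M) + (R - M) + 1 = P + R - 1 := by ring
  have y17 : P + R - 1 + 1 = P + R := by ring
  have y18 : P + R - M - 1 + 1 = P + R - M := by ring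
  simp only [y1, y2, y3, y4, y5, y6, y8, y10, y11, y12, y13, y14, y15, y16, y17, y18] at fin ⊢
  have hn : P + R - M ≠ 0 := by linarith
  have hPR : P + R ≠ 0 := by linarith
  have zz : ∀ x q : ℝ, x ≠ 0 → x * (q - 1 / x ^ 2) = x * q - 1 / x := by
    intro x q hx
    field_simp
  rw [zz _ _ hPR, zz _ _ hn]
  linear_combination fin

theorem PP_monic (a b : ℝ) (j : ℕ) : (PP a b j).Monic := by
  induction j using Nat.strong_induction_on with
  | _ j ih =>
  match j, ih with
  | 0, _ => simp [PP]
  | 1, _ => simpa [PP] using Polynomial.monic_X_sub_C (al a b 0)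
  | j + 2, ih =>
    rw [PP]
    refine Polynomial.Monic.sub_of_left
      ((Polynomial.monic_X_sub_C _).mul (ih (j + 1) (by omega))) ?_
    have hle : (Polynomial.C (be a b (j + 1)) * PP a b j).degree ≤ (PP a b j).degree := by
      rw [← Polynomial.smul_eq_C_mul]; exact Polynomial.degree_smul_le _ _
    refine lt_of_le_of_lt hle ?_
    rw [Polynomial.degree_mul, Polynomial.degree_X_sub_C, PP_degree, PP_degree]
    norm_cast
    omega

/-- Weight on the unit interval. -/
noncomputable def wI (A B : ℕ) (t : ℝ) : ℝ :=
  (Set.Icc (0:ℝ) 1).indicator (fun t => t ^ A * (1 - t) ^ B) t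

theorem wI_core (A B : ℕ) {g : ℝ → ℝ} (hg : Tame g) :
    Integrable (fun t => g t * wI A B t) ∧ ∫ t, g t * wI A B t = II A B g := by
  have e : (fun t => g t * wI A B t) =
      (Set.Icc (0:ℝ) 1).indicator (fun t => g t * (t ^ A * (1 - t) ^ B)) := by
    ext t
    unfold wI
    by_cases h : t ∈ Set.Icc (0:ℝ) 1
    · rw [Set.indicator_of_mem h, Set.indicator_of_mem h]
    · rw [Set.indicator_of_notMem h, Set.indicator_of_notMem h, mul_zero]
  have hw : ∀ t, wt (A:ℝ) (B:ℝ) t = t ^ A * (1 - t) ^ B := by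
    intro t; unfold wt; rw [rpow_natCast, rpow_natCast]
  have hi := hg.integrable (a := A) (b := B) (by linarith [nat_dom A]) (by linarith [nat_dom B])
  simp only [hw] at hi
  constructor
  · rw [e, integrable_indicator_iff measurableSet_Icc, integrableOn_Icc_iff_integrableOn_Ioo]
    exact hi
  · rw [e, integral_indicator measurableSet_Icc, integral_Icc_eq_integral_Ioo]
    unfold II
    simp only [hw]

theorem affine_int (F : ℝ → ℝ) : ∫ x, F ((1 + x) / 2) = 2 * ∫ t, F t := by
  rw [integral_add_left_eq_self (fun y => F (y / 2)) 1, Measure.integral_comp_div]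
  simp

theorem affine_integrable {F : ℝ → ℝ} (h : Integrable F) : Integrable (fun x => F ((1 + x) / 2)) :=
  (h.comp_div (two_ne_zero)).comp_add_left 1

/-- Orthonormal functions. -/
noncomputable def phi (A B : ℕ) (m : ℕ) (j : Fin m) (x : ℝ) : ℝ :=
  (Real.sqrt (hh A B j))⁻¹ * pe A B j ((1 + x) / 2)

/-- Weight in the original variable. -/
noncomputable def om (A B : ℕ) (x : ℝ) : ℝ := 1 / 2 * wI A B ((1 + x) / 2)

theorem phi_core (A B m : ℕ) (j k : Fin m) {g : ℝ → ℝ} (hg : Tame g) :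
    Integrable (fun x => g ((1 + x) / 2) * (phi A B m j x * phi A B m k x * om A B x)) ∧
    ∫ x, g ((1 + x) / 2) * (phi A B m j x * phi A B m k x * om A B x) =
      ip A B g j k / (Real.sqrt (hh A B j) * Real.sqrt (hh A B k)) := by
  obtain ⟨h1, h2⟩ := wI_core A B (hg.mul ((Tame.pe A B j).mul (Tame.pe A B k)))
  set c : ℝ := (Real.sqrt (hh A B j))⁻¹ * (Real.sqrt (hh A B k))⁻¹ * (1 / 2) with hc
  have e : (fun x => g ((1 + x) / 2) * (phi A B m j x * phi A B m k x * om A B x)) =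
      fun x => (fun t => c * (g t * (pe A B j t * pe A B k t) * wI A B t)) ((1 + x) / 2) := by
    ext x
    simp only [phi, om, hc]; ring
  rw [e]
  refine ⟨affine_integrable (h1.const_mul c), ?_⟩
  rw [affine_int (fun t => c * (g t * (pe A B j t * pe A B k t) * wI A B t)),
    integral_const_mul, h2, hc]
  unfold ip
  ring

theorem vEnt_fe (x : ℝ) : vEnt x = fe ((1 + x) / 2) := by
  unfold vEnt fe
  have : 1 - (1 + x) / 2 = (1 - x) / 2 := by ring
  rw [this]; ring

theorem det_var_Cv (A B m : ℕ) :
    ∑ j, mel (phi A B m) (om A B) (fun x => vEnt x ^ 2) j j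
      - ∑ j, ∑ k, mel (phi A B m) (om A B) vEnt j k ^ 2 = Cv A B m fe fe := by
  unfold Cv Em Dm
  have hp : ∀ j, 0 ≤ hh A B j := fun j => (hh_pos (nat_dom A) (nat_dom B) j).le
  rw [Finset.sum_range, Finset.sum_range]
  congr 1
  · refine Finset.sum_congr rfl fun j _ => ?_
    have := (phi_core A B m j j (Tame.fe.mul Tame.fe)).2
    rw [Real.mul_self_sqrt (hp j)] at this
    rw [← this]
    unfold mel
    simp only [vEnt_fe, sq]
  · refine Finset.sum_congr rfl fun j _ => ?_
    rw [Finset.sum_range]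
    refine Finset.sum_congr rfl fun k _ => ?_
    have := (phi_core A B m j k Tame.fe).2
    unfold mel
    simp only [vEnt_fe]
    rw [this, div_pow, mul_pow, Real.sq_sqrt (hp j), Real.sq_sqrt (hp k), sq]

theorem pair_prod {m : ℕ} (F : Fin m → Fin m → ℝ) :
    ∏ q ∈ Finset.univ.filter (fun q : Fin m × Fin m => q.1 < q.2), F q.1 q.2 =
      ∏ i, ∏ j ∈ Ioi i, F i j := by
  rw [Finset.prod_filter, ← Finset.univ_product_univ, Finset.prod_product]
  refine Finset.prod_congr rfl fun i _ => ?_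
  rw [← Finset.prod_filter, Finset.filter_lt_eq_Ioi]

theorem det_phi (A B m : ℕ) (x : Fin m → ℝ) :
    (Matrix.det (Matrix.of fun j i => phi A B m j (x i))) =
      (∏ j : Fin m, (Real.sqrt (hh A B j))⁻¹) *
        ∏ i, ∏ j ∈ Ioi i, ((1 + x j) / 2 - (1 + x i) / 2) := by
  rw [← Matrix.det_vandermonde (fun i => (1 + x i) / 2),
    Matrix.det_eval_matrixOfPolynomials_eq_det_vandermonde _ (fun j : Fin m => PP A B j)
      (fun i => Polynomial.natDegree_eq_of_degree_eq_some (PP_degree _ _ _))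
      (fun i => PP_monic _ _ _)]
  conv_rhs => rw [← Matrix.det_transpose, ← Matrix.det_mul_column]
  rfl

theorem density_eq (m n p : ℕ) : ∃ C : ℝ, C ≠ 0 ∧ ∀ x : Fin m → ℝ, densityB m n p x = C *
    ((Matrix.det (Matrix.of fun j i => phi (p - m) (n - p) m j (x i))) ^ 2
      * ∏ i, om (p - m) (n - p) (x i)) := by
  generalize hA : p - m = A
  generalize hB : n - p = B
  have hp : ∀ j, 0 < hh A B j := fun j => (hh_pos (nat_dom A) (nat_dom B) j)
  refine ⟨(∏ i : Fin m, ∏ j ∈ Ioi i, 4) * (∏ j : Fin m, hh A B j) * ∏ i : Fin m, (2 ^ (A + B + 1)),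
    ?_, ?_⟩
  · have : 0 < (∏ j : Fin m, hh A B j) := Finset.prod_pos fun j _ => hp j
    positivity
  intro x
  unfold densityB
  rw [hA, hB]
  split_ifs with h
  · rw [det_phi, mul_pow, ← Finset.prod_pow, pair_prod (fun i j => (x i - x j) ^ 2)]
    have e1 : ∏ i, ∏ j ∈ Ioi i, (x i - x j) ^ 2 = (∏ i : Fin m, ∏ j ∈ Ioi i, 4) *
        (∏ i, ∏ j ∈ Ioi i, ((1 + x j) / 2 - (1 + x i) / 2)) ^ 2 := by
      rw [← Finset.prod_pow, ← Finset.prod_mul_distrib]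
      refine Finset.prod_congr rfl fun i _ => ?_
      rw [← Finset.prod_pow, ← Finset.prod_mul_distrib]
      refine Finset.prod_congr rfl fun j _ => ?_
      ring
    have e2 : (∏ i, (1 + x i) ^ A * (1 - x i) ^ B) =
        (∏ i : Fin m, 2 ^ (A + B + 1)) * ∏ i, om A B (x i) := by
      rw [← Finset.prod_mul_distrib]
      refine Finset.prod_congr rfl fun i _ => ?_
      have hi := h i
      unfold om wI
      have hmem : (1 + x i) / 2 ∈ Set.Icc (0:ℝ) 1 :=
        ⟨by linarith [hi.1], by linarith [hi.2]⟩
      rw [Set.indicator_of_mem hmem]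
      have : 1 - (1 + x i) / 2 = (1 - x i) / 2 := by ring
      rw [this, div_pow, div_pow, pow_succ, pow_add]
      field_simp
    have e3 : (∏ j : Fin m, hh A B j) * (∏ j : Fin m, (Real.sqrt (hh A B j))⁻¹ ^ 2) = 1 := by
      rw [← Finset.prod_mul_distrib]
      refine Finset.prod_eq_one fun j _ => ?_
      rw [inv_pow, Real.sq_sqrt (hp j).le, mul_inv_cancel₀ (hp j).ne']
    rw [e1, e2]
    linear_combination (-(∏ i : Fin m, ∏ j ∈ Ioi i, (4:ℝ)) *
        (∏ i, ∏ j ∈ Ioi i, ((1 + x j) / 2 - (1 + x i) / 2)) ^ 2 *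
        ((∏ i : Fin m, 2 ^ (A + B + 1)) * ∏ i, om A B (x i))) * e3
  · push Not at h
    obtain ⟨i, hi⟩ := h
    have : om A B (x i) = 0 := by
      unfold om wI
      rw [Set.indicator_of_notMem, mul_zero]
      intro h
      exact hi ⟨by linarith [h.1], by linarith [h.2]⟩
    have h0 : ∏ i, om A B (x i) = 0 := Finset.prod_eq_zero (Finset.mem_univ i) this
    rw [h0]
    ring

theorem main_var (m n p : ℕ) :
    ensembleVar (densityB m n p) entS = Cv ((p - m : ℕ) : ℝ) ((n - p : ℕ) : ℝ) m fe fe := by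
  obtain ⟨C, hC, hd⟩ := density_eq m n p
  rw [← det_var_Cv, ← det_variance (phi (p - m) (n - p) m) (om (p - m) (n - p)) vEnt]
  · unfold ensembleVar ensembleAvg entS
    simp only [hd]
    have e1 : ∀ x : Fin m → ℝ, ∀ D : ℝ, (-∑ i, vEnt (x i)) ^ 2 * (C * D) =
        C * ((∑ i, vEnt (x i)) ^ 2 * D) := by intro x D; ring
    have e2 : ∀ x : Fin m → ℝ, ∀ D : ℝ, (-∑ i, vEnt (x i)) * (C * D) =
        -C * ((∑ i, vEnt (x i)) * D) := by intro x D; ring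
    simp only [e1, e2, integral_const_mul]
    rw [mul_div_mul_left _ _ hC, neg_mul, neg_div, mul_div_mul_left _ _ hC, neg_sq]
  · intro j k
    simpa using (phi_core (p - m) (n - p) m j k (Tame.const 1)).1
  · intro j k
    simpa only [vEnt_fe] using (phi_core (p - m) (n - p) m j k Tame.fe).1
  · intro j k
    simpa only [vEnt_fe, sq] using (phi_core (p - m) (n - p) m j k (Tame.fe.mul Tame.fe)).1
  · intro j k
    have := (phi_core (p - m) (n - p) m j k (Tame.const 1)).2
    simp only [one_mul] at this
    rw [this, ip_one (nat_dom _) (nat_dom _)]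
    have hp := hh_pos (nat_dom (p - m)) (nat_dom (n - p)) j
    by_cases h : j = k
    · subst h
      rw [Real.mul_self_sqrt hp.le]
      simp [hp.ne']
    · have : (j : ℕ) ≠ k := fun h' => h (Fin.ext h')
      simp [h, this]

theorem var_vonNeumann_entropy_caseB (m n p : ℕ) (hm : 1 ≤ m) (hmp : m ≤ p) (hpn : p ≤ n) :
    ensembleVar (densityB m n p) entS =
      ((m : ℝ) * (m + n - p) * (m ^ 2 + 2 * m * n + n ^ 2 - n * p - 1)
          / ((m + n - 1) * (m + n) * (m + n + 1))) * psi1 (m + n - p)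
        - ((m : ℝ) + n) * psi1 (m + n) + (n : ℝ) * psi1 n
        + ((m : ℝ) * p * (m ^ 2 + m * n + n * p - 1)
          / ((m + n - 1) * (m + n) * (m + n + 1))) * psi1 p
        + ((m : ℝ) * n * p * (m + n - p)
          / ((m + n) * ((m + n - 1) * (m + n) * (m + n + 1))))
          * (psi0 (m + n - p) - psi0 p) ^ 2
        + (-((m : ℝ) * (m + 1) * (m + n - 2 * p))
          / ((m + n) * ((m + n) * (m + n + 1)))) * (psi0 (m + n - p) - psi0 p)
        - psi0 (m + n) + psi0 n
        + (-((m : ℝ) * (2 * m + n + 2)) / ((m + n) * ((m + n) * (m + n + 1)))) := by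
  rw [main_var]
  exact Cv_nat m n p hm hmp hpn
end

section
/- (Lemma 4) Let m, c, d be positive integers and let a, b be complex numbers such that none of a, b, a+b is a negative integer. Then Σ_{i=1}^m 1/(Γ(c+i)·Γ(a+i)·Γ(d+m−i+1)·Γ(b+m−i+1)) = (1/(Γ(d)·Γ(a+m)·Γ(a+b+m)·Γ(c+d+m))) · Σ_{i=1}^m Γ(c+d+i−1)·Γ(a+b−i+2m)/(Γ(c+i)·Γ(b−i+m+1)) + (1/(Γ(c)·Γ(b+m)·Γ(a+b+m)·Γ(c+d+m))) · Σ_{i=1}^m Γ(c+d+i−1)·Γ(a+b−i+2m)/(Γ(d+i)·Γ(a−i+m+1)). -/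
open Complex Finset

/-- Generalized binomial coefficient `(x+y)! / (x! y!)`. -/
noncomputable def gbin (x y : ℂ) : ℂ :=
  Complex.Gamma (x + y + 1) / (Complex.Gamma (x + 1) * Complex.Gamma (y + 1))

theorem gbin_comm (x y : ℂ) : gbin x y = gbin y x := by
  unfold gbin
  rw [add_comm x y, mul_comm]

theorem gbin_pascal (x y : ℂ) (hx : x ≠ 0) (hy : y ≠ 0) (hxy : x + y ≠ 0) :
    gbin x y = gbin (x - 1) y + gbin x (y - 1) := by
  unfold gbin
  have e1 : x - 1 + y + 1 = x + y := by ring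
  have e2 : x + (y - 1) + 1 = x + y := by ring
  rw [e1, e2, sub_add_cancel, sub_add_cancel, Complex.Gamma_add_one _ hx,
    Complex.Gamma_add_one _ hy, Complex.Gamma_add_one _ hxy]
  by_cases h1 : Complex.Gamma x = 0
  · simp [h1]
  by_cases h2 : Complex.Gamma y = 0
  · simp [h2]
  field_simp

theorem abel_aux (V W : ℕ → ℂ) (m : ℕ) :
    ∑ i ∈ range (m + 1), (V (i + 1) - V i) * W i
      = ∑ i ∈ range m, V (i + 1) * (W i - W (i + 1)) + V (m + 1) * W m - V 0 * W 0 := by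
  induction m with
  | zero => simp; ring
  | succ k ih => rw [sum_range_succ, ih, sum_range_succ _ k]; ring

theorem ne_zero_of_shift (a : ℂ) (ha : ∀ k : ℕ, a ≠ -(k + 1 : ℕ)) (n : ℕ) (hn : 1 ≤ n) :
    a + n ≠ 0 := by
  obtain ⟨k, rfl⟩ : ∃ k, n = k + 1 := ⟨n - 1, by omega⟩
  intro h
  exact ha k (eq_neg_of_add_eq_zero_left h)

theorem gbin_identity (d : ℕ) (hd : 1 ≤ d) (b : ℂ) (hb : ∀ k : ℕ, b ≠ -(k + 1 : ℕ)) (m : ℕ) :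
    ∀ (c : ℕ) (_ : 1 ≤ c) (a : ℂ) (_ : ∀ k : ℕ, a ≠ -(k + 1 : ℕ))
      (_ : ∀ k : ℕ, a + b ≠ -(k + 1 : ℕ)),
    ∑ i ∈ range m, gbin (c + i) (d + m - 1 - i) * gbin (a + i) (b + m - 1 - i)
      = ∑ i ∈ range m, gbin (c + i) (d - 1) * gbin (b + m - 1 - i) (a + m - 1)
        + ∑ i ∈ range m, gbin (d + i) (c - 1) * gbin (a + m - 1 - i) (b + m - 1) := by
  induction m with
  | zero => intros; simp
  | succ m ih =>
    intro c hc a ha hab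
    have ha' : ∀ k : ℕ, a + 1 ≠ -(k + 1 : ℕ) := by
      intro k h
      apply ha (k + 1)
      push_cast at h ⊢
      linear_combination h
    have hab' : ∀ k : ℕ, a + 1 + b ≠ -(k + 1 : ℕ) := by
      intro k h
      apply hab (k + 1)
      push_cast at h ⊢
      linear_combination h
    have IH := ih (c + 1) (by omega) (a + 1) ha' hab'
    have key := abel_aux (fun i => gbin (d + i - 1) c) (fun i => gbin (a + m - i) (b + m)) m
    have h1 : ∑ i ∈ range (m + 1), gbin (d + i) (c - 1) * gbin (a + (m + 1 : ℕ) - 1 - i) (b + (m + 1 : ℕ) - 1)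
        = ∑ i ∈ range (m + 1), (gbin (d + (i + 1 : ℕ) - 1) c - gbin (d + i - 1) c) * gbin (a + m - i) (b + m) := by
      apply sum_congr rfl
      intro i _
      have p := gbin_pascal (d + i) c (by norm_cast; omega) (by norm_cast; omega)
        (by norm_cast; omega)
      have e : (d : ℂ) + (i + 1 : ℕ) - 1 = d + i := by push_cast; ring
      have e2 : a + (m + 1 : ℕ) - 1 - i = a + m - i := by push_cast; ring
      have e3 : b + (m + 1 : ℕ) - 1 = b + m := by push_cast; ring
      rw [e, e2, e3, p]
      ring
    have h2 : ∑ i ∈ range m, gbin (d + i) ((c + 1 : ℕ) - 1) * gbin (a + 1 + m - 1 - i) (b + m - 1)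
        = ∑ i ∈ range m, gbin (d + (i + 1 : ℕ) - 1) c *
          (gbin (a + m - i) (b + m) - gbin (a + m - (i + 1 : ℕ)) (b + m)) := by
      apply sum_congr rfl
      intro i hi
      have hi' : i < m := mem_range.mp hi
      have q1 := ne_zero_of_shift a ha (m - i) (by omega)
      have q2 := ne_zero_of_shift b hb m (by omega)
      have q3 := ne_zero_of_shift (a + b) hab (m - i + m) (by omega)
      push_cast [Nat.cast_sub hi'.le] at q1 q3
      have p := gbin_pascal (a + m - i) (b + m) (by convert q1 using 1; ring) q2
        (by convert q3 using 1; ring)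
      have e : (d : ℂ) + (i + 1 : ℕ) - 1 = d + i := by push_cast; ring
      have e1 : ((c + 1 : ℕ) : ℂ) - 1 = c := by push_cast; ring
      have e2 : a + 1 + m - 1 - i = a + m - i := by ring
      have e3 : a + m - (i + 1 : ℕ) = a + m - i - 1 := by push_cast; ring
      rw [e, e1, e2, e3, p]
      ring
    rw [h1, key, ← h2, sum_range_succ', sum_range_succ' _ m]
    have h3 : ∑ i ∈ range m, gbin (c + (i + 1 : ℕ)) (d + (m + 1 : ℕ) - 1 - (i + 1 : ℕ)) *
          gbin (a + (i + 1 : ℕ)) (b + (m + 1 : ℕ) - 1 - (i + 1 : ℕ))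
        = ∑ i ∈ range m, gbin ((c + 1 : ℕ) + i) (d + m - 1 - i) *
          gbin (a + 1 + i) (b + m - 1 - i) := by
      apply sum_congr rfl
      intro i _
      congr 2 <;> push_cast <;> ring
    have h4 : ∑ i ∈ range m, gbin (c + (i + 1 : ℕ)) (d - 1) *
          gbin (b + (m + 1 : ℕ) - 1 - (i + 1 : ℕ)) (a + (m + 1 : ℕ) - 1)
        = ∑ i ∈ range m, gbin ((c + 1 : ℕ) + i) (d - 1) *
          gbin (b + m - 1 - i) (a + 1 + m - 1) := by
      apply sum_congr rfl
      intro i _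
      congr 2 <;> push_cast <;> ring
    rw [h3, h4, IH]
    have z1 : gbin (c + (0 : ℕ)) (d - 1) = gbin (d + (0 : ℕ) - 1) c := by
      rw [gbin_comm]; simp
    have z2 : gbin (b + (m + 1 : ℕ) - 1 - (0 : ℕ)) (a + (m + 1 : ℕ) - 1)
        = gbin (a + m - (0 : ℕ)) (b + m) := by
      rw [gbin_comm]; congr 1 <;> push_cast <;> ring
    have z3 : gbin (c + (0 : ℕ)) (d + (m + 1 : ℕ) - 1 - (0 : ℕ)) = gbin (d + (m + 1 : ℕ) - 1) c := by
      rw [gbin_comm]; simp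
    have z4 : gbin (a + (0 : ℕ)) (b + (m + 1 : ℕ) - 1 - (0 : ℕ)) = gbin (a + m - m) (b + m) := by
      congr 1 <;> push_cast <;> ring
    rw [z1, z2, z3, z4]
    ring

theorem lemma4_sum_identity (m c d : ℕ) (hm : 1 ≤ m) (hc : 1 ≤ c) (hd : 1 ≤ d) (a b : ℂ)
    (ha : ∀ k : ℕ, a ≠ -(k + 1 : ℕ)) (hb : ∀ k : ℕ, b ≠ -(k + 1 : ℕ))
    (hab : ∀ k : ℕ, a + b ≠ -(k + 1 : ℕ)) :
    ∑ i ∈ Finset.Icc 1 m,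
        1 / (Complex.Gamma ((c : ℂ) + i) * Complex.Gamma (a + i)
          * Complex.Gamma ((d : ℂ) + m - i + 1) * Complex.Gamma (b + m - i + 1)) =
      (1 / (Complex.Gamma (d : ℂ) * Complex.Gamma (a + m) * Complex.Gamma (a + b + m)
          * Complex.Gamma ((c : ℂ) + d + m))) *
        ∑ i ∈ Finset.Icc 1 m,
          Complex.Gamma ((c : ℂ) + d + i - 1) * Complex.Gamma (a + b - i + 2 * m)
            / (Complex.Gamma ((c : ℂ) + i) * Complex.Gamma (b - i + m + 1))
      + (1 / (Complex.Gamma (c : ℂ) * Complex.Gamma (b + m) * Complex.Gamma (a + b + m)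
          * Complex.Gamma ((c : ℂ) + d + m))) *
        ∑ i ∈ Finset.Icc 1 m,
          Complex.Gamma ((c : ℂ) + d + i - 1) * Complex.Gamma (a + b - i + 2 * m)
            / (Complex.Gamma ((d : ℂ) + i) * Complex.Gamma (a - i + m + 1)) := by
  have G := gbin_identity d hd b hb m c hc a ha hab
  have hQ : Complex.Gamma (a + b + m) ≠ 0 := by
    apply Complex.Gamma_ne_zero
    intro k h
    have := ne_zero_of_shift (a + b) hab (m + k) (by omega)
    apply this
    push_cast
    linear_combination h
  have hP : Complex.Gamma ((c : ℂ) + d + m) ≠ 0 := by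
    apply Complex.Gamma_ne_zero
    intro k h
    have h' : ((c + d + m + k : ℕ) : ℂ) = 0 := by push_cast; linear_combination h
    have := Nat.cast_eq_zero.mp h'
    omega
  have hI : ∀ f : ℕ → ℂ, ∑ i ∈ Finset.Icc 1 m, f i = ∑ i ∈ range m, f (i + 1) := by
    intro f
    rw [← Finset.Ico_add_one_right_eq_Icc, Finset.sum_Ico_eq_sum_range]
    simp [add_comm]
  rw [hI, hI, hI]
  have hPQ := mul_ne_zero hQ hP
  apply mul_left_cancel₀ hPQ
  rw [mul_add, ← mul_assoc, ← mul_assoc, mul_sum, mul_sum, mul_sum]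
  convert G using 1
  · apply sum_congr rfl
    intro i _
    unfold gbin
    have e1 : (c : ℂ) + i + (d + m - 1 - i) + 1 = c + d + m := by ring
    have e2 : a + i + (b + m - 1 - i) + 1 = a + b + m := by ring
    rw [e1, e2]
    have e3 : (c : ℂ) + (i + 1 : ℕ) = c + i + 1 := by push_cast; ring
    have e4 : a + (i + 1 : ℕ) = a + i + 1 := by push_cast; ring
    have e5 : (d : ℂ) + m - (i + 1 : ℕ) + 1 = d + m - 1 - i + 1 := by push_cast; ring
    have e6 : b + m - (i + 1 : ℕ) + 1 = b + m - 1 - i + 1 := by push_cast; ring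
    rw [e3, e4, e5, e6, div_mul_div_comm, mul_one_div]
    congr 1 <;> ring
  · have aux : ∀ u v x y z w : ℂ, Complex.Gamma (a + b + m) * Complex.Gamma ((c : ℂ) + d + m) *
        (1 / (u * v * Complex.Gamma (a + b + m) * Complex.Gamma ((c : ℂ) + d + m))) *
        (x * y / (z * w)) = x / (z * u) * (y / (w * v)) := by
      intro u v x y z w
      have : Complex.Gamma (a + b + m) * Complex.Gamma ((c : ℂ) + d + m) *
        (1 / (u * v * Complex.Gamma (a + b + m) * Complex.Gamma ((c : ℂ) + d + m)))
          = 1 / (u * v) := by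
        rw [mul_assoc (u * v), mul_one_div, ← div_div, div_right_comm, div_self hPQ]
      rw [this, div_mul_div_comm, div_mul_div_comm]
      congr 1 <;> ring
    congr 1
    · apply sum_congr rfl
      intro i _
      rw [aux]
      unfold gbin
      congr 2
      · congr 1; push_cast; ring
      · congr 2 <;> push_cast <;> ring
      · congr 1; push_cast; ring
      · congr 2 <;> push_cast <;> ring
    · apply sum_congr rfl
      intro i _
      rw [aux]
      unfold gbin
      congr 2
      · congr 1; push_cast; ring
      · congr 2 <;> push_cast <;> ring
      · congr 1; push_cast; ring
      · congr 2 <;> push_cast <;> ring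
end

section
/- (Lemma 5) Let m be a positive integer and let a, c be complex numbers with Re(a) ≥ 0 and Re(c) ≥ 0. Then Σ_{i=1}^m (−1)^i · (Γ(a−i+m+1)/Γ(m−i+1)) · (1/(a+c−i+2m+1) − 1/(c+i)) = (Γ(a+c+m+1)/Γ(c+m+1)) · Σ_{i=1}^m ( Φ_{0,a+c,a,c}^{(m−i)}/(a+c−2i+2m+1) + a·Φ_{1,a+c+1,a,c}^{(m−i)} − Φ_{1,a+c,a+1,c}^{(m−i)}/(a+c−2i+2m+2) ). -/
open Complex Finset

/-- `Φ_{α,β,γ,δ}^{(x)} = Γ(x+γ+1)·Γ(x+δ+1)/(Γ(x+α+1)·Γ(x+β+1))`. -/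
noncomputable def PhiG (p q r s x : ℂ) : ℂ :=
  Complex.Gamma (x + r + 1) * Complex.Gamma (x + s + 1) /
    (Complex.Gamma (x + p + 1) * Complex.Gamma (x + q + 1))

lemma ne_zero_of_re (z : ℂ) (h : 0 < z.re) : z ≠ 0 := by
  rintro rfl
  simp at h

lemma flip_sum (m : ℕ) (f : ℕ → ℂ) :
    ∑ i ∈ Finset.Icc 1 m, f i = ∑ j ∈ Finset.range m, f (m - j) := by
  apply Finset.sum_bij' (fun i _ => m - i) (fun j _ => m - j)
  · intro i hi
    simp only [Finset.mem_Icc, Finset.mem_range] at *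
    omega
  · intro i hi
    simp only [Finset.mem_Icc, Finset.mem_range] at *
    omega
  · intro i hi
    simp only [Finset.mem_Icc] at *
    omega
  · intro i hi
    simp only [Finset.mem_range] at *
    omega
  · intro i hi
    simp only [Finset.mem_Icc] at *
    congr 1
    omega

/-- `Γ(a+j+1)/j!` -/
noncomputable def gg (a : ℂ) (j : ℕ) : ℂ := Complex.Gamma (a + j + 1) / Complex.Gamma ((j : ℂ) + 1)

lemma gg_succ (a : ℂ) (ha : 0 ≤ a.re) (j : ℕ) :
    gg a (j + 1) = gg a j * ((a + j + 1) / (j + 1)) := by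
  have h1 : a + j + 1 ≠ 0 := ne_zero_of_re _ (by simp; positivity)
  have h2 : (j : ℂ) + 1 ≠ 0 := ne_zero_of_re _ (by simp; positivity)
  unfold gg
  push_cast
  rw [show a + ((j : ℂ) + 1) + 1 = (a + j + 1) + 1 by ring, Complex.Gamma_add_one _ h1,
    Complex.Gamma_add_one _ h2]
  have h3 : Complex.Gamma ((j : ℂ) + 1) ≠ 0 :=
    Complex.Gamma_ne_zero_of_re_pos (by simp; positivity)
  field_simp

/-- the terms on the left-hand side -/
noncomputable def tt (a c : ℂ) (m j : ℕ) : ℂ :=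
  (-1) ^ (m + j) * gg a j * (1 / (a + c + m + 1 + j) - 1 / (c + m - j))

/-- the telescoping certificate -/
noncomputable def GG (a c : ℂ) (m j : ℕ) : ℂ :=
  (-1) ^ (m + j) * gg a j * (j * (-1 / (a + c + m + 1 + j) - 1 / (c + m - j + 1)))

lemma tt_tele (a c : ℂ) (ha : 0 ≤ a.re) (hc : 0 ≤ c.re) (m j : ℕ) (hj : j < m) :
    (c + m + 1) * tt a c (m + 1) j - (a + c + m + 1) * tt a c m j
      = GG a c m (j + 1) - GG a c m j := by
  have hj' : (j : ℝ) < m := by exact_mod_cast hj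
  have h1 : a + c + m + 1 + j ≠ 0 := ne_zero_of_re _ (by simp; positivity)
  have h2 : a + c + m + 1 + j + 1 ≠ 0 := ne_zero_of_re _ (by simp; positivity)
  have h3 : c + m - j ≠ 0 := ne_zero_of_re _ (by simp; linarith)
  have h4 : c + m - j + 1 ≠ 0 := ne_zero_of_re _ (by simp; linarith)
  have h5 : (j : ℂ) + 1 ≠ 0 := ne_zero_of_re _ (by simp; positivity)
  unfold tt GG
  rw [gg_succ a ha]
  push_cast
  rw [show a + c + ((m : ℂ) + 1) + 1 + j = a + c + m + 1 + j + 1 by ring,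
    show c + ((m : ℂ) + 1) - j = c + m - j + 1 by ring,
    show a + c + (m : ℂ) + 1 + (j + 1) = a + c + m + 1 + j + 1 by ring,
    show c + (m : ℂ) - (j + 1) + 1 = c + m - j by ring,
    show m + 1 + j = (m + j) + 1 by ring, show m + (j + 1) = (m + j) + 1 by ring, pow_succ]
  generalize (-1 : ℂ) ^ (m + j) = e
  generalize gg a j = g
  have key : (c + m + 1) * (-(1 / (a + c + m + 1 + j + 1) - 1 / (c + m - j + 1)))
      - (a + c + m + 1) * (1 / (a + c + m + 1 + j) - 1 / (c + m - j))
      = -((a + j + 1) * (-1 / (a + c + m + 1 + j + 1) - 1 / (c + m - j)))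
        - j * (-1 / (a + c + m + 1 + j) - 1 / (c + m - j + 1)) := by
    field_simp
    ring
  have e2 : g * ((a + j + 1) / (j + 1)) * (((j : ℂ) + 1) * (-1 / (a + c + m + 1 + j + 1) - 1 / (c + m - j)))
      = g * ((a + j + 1) * (-1 / (a + c + m + 1 + j + 1) - 1 / (c + m - j))) := by
    generalize (-1 / (a + c + m + 1 + j + 1) - 1 / (c + m - j)) = w
    field_simp
  linear_combination e * g * key + e * e2

/-- the terms on the right-hand side -/
noncomputable def TT (a c : ℂ) (j : ℕ) : ℂ :=
  PhiG 0 (a + c) a c (j : ℂ) / (a + c + 2 * j + 1)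
            + a * PhiG 1 (a + c + 1) a c (j : ℂ)
            - PhiG 1 (a + c) (a + 1) c (j : ℂ) / (a + c + 2 * j + 2)

lemma TT_eq (a c : ℂ) (ha : 0 ≤ a.re) (hc : 0 ≤ c.re) (m : ℕ) :
    Complex.Gamma (a + c + m + 1) / Complex.Gamma (c + m + 1) * TT a c m =
      gg a m * (1 / (a + c + 2 * m + 1) + a / ((m + 1) * (a + c + m + 1))
        - (a + m + 1) / ((m + 1) * (a + c + 2 * m + 2))) := by
  have h1 : a + m + 1 ≠ 0 := ne_zero_of_re _ (by simp; positivity)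
  have h2 : (m : ℂ) + 1 ≠ 0 := ne_zero_of_re _ (by simp; positivity)
  have h3 : a + c + m + 1 ≠ 0 := ne_zero_of_re _ (by simp; positivity)
  have h4 : a + c + 2 * m + 1 ≠ 0 := ne_zero_of_re _ (by simp; positivity)
  have h5 : a + c + 2 * m + 2 ≠ 0 := ne_zero_of_re _ (by simp; positivity)
  have g1 : Complex.Gamma ((m : ℂ) + 1) ≠ 0 :=
    Complex.Gamma_ne_zero_of_re_pos (by simp; positivity)
  have g2 : Complex.Gamma (a + c + m + 1) ≠ 0 :=
    Complex.Gamma_ne_zero_of_re_pos (by simp; positivity)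
  have g3 : Complex.Gamma (c + m + 1) ≠ 0 :=
    Complex.Gamma_ne_zero_of_re_pos (by simp; positivity)
  unfold TT PhiG gg
  rw [show (m : ℂ) + a + 1 = a + m + 1 by ring, show (m : ℂ) + c + 1 = c + m + 1 by ring,
    show (m : ℂ) + 0 + 1 = m + 1 by ring, show (m : ℂ) + (a + c) + 1 = a + c + m + 1 by ring,
    show (m : ℂ) + (a + c + 1) + 1 = a + c + m + 1 + 1 by ring,
    show (m : ℂ) + (a + 1) + 1 = a + m + 1 + 1 by ring,
    Complex.Gamma_add_one _ h1, Complex.Gamma_add_one _ h2, Complex.Gamma_add_one _ h3]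
  generalize Complex.Gamma (a + c + m + 1) = x at *
  generalize Complex.Gamma (c + m + 1) = y at *
  generalize Complex.Gamma ((m : ℂ) + 1) = z at *
  generalize Complex.Gamma (a + m + 1) = w at *
  field_simp

lemma step (a c : ℂ) (ha : 0 ≤ a.re) (hc : 0 ≤ c.re) (m : ℕ) :
    (c + m + 1) * ∑ j ∈ Finset.range (m + 1), tt a c (m + 1) j
      - (a + c + m + 1) * ∑ j ∈ Finset.range m, tt a c m j
     = (a + c + m + 1) * (Complex.Gamma (a + c + m + 1) / Complex.Gamma (c + m + 1) * TT a c m) := by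
  have hsum : ∑ j ∈ Finset.range m, ((c + m + 1) * tt a c (m + 1) j - (a + c + m + 1) * tt a c m j)
      = GG a c m m - GG a c m 0 := by
    rw [← Finset.sum_range_sub]
    exact Finset.sum_congr rfl fun j hj => tt_tele a c ha hc m j (Finset.mem_range.1 hj)
  rw [Finset.sum_sub_distrib, ← Finset.mul_sum, ← Finset.mul_sum] at hsum
  have hG0 : GG a c m 0 = 0 := by simp [GG]
  rw [Finset.sum_range_succ, TT_eq a c ha hc]
  have h2 : (m : ℂ) + 1 ≠ 0 := ne_zero_of_re _ (by simp; positivity)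
  have h3 : a + c + m + 1 ≠ 0 := ne_zero_of_re _ (by simp; positivity)
  have h4 : a + c + 2 * m + 1 ≠ 0 := ne_zero_of_re _ (by simp; positivity)
  have h5 : a + c + 2 * m + 2 ≠ 0 := ne_zero_of_re _ (by simp; positivity)
  have h6 : c + 1 ≠ 0 := ne_zero_of_re _ (by simp; positivity)
  have e1 : (-1 : ℂ) ^ (m + m) = 1 := Even.neg_one_pow ⟨m, rfl⟩
  have key : GG a c m m + (c + m + 1) * tt a c (m + 1) m = (a + c + m + 1) *
     (gg a m * (1 / (a + c + 2 * m + 1) + a / ((m + 1) * (a + c + m + 1))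
        - (a + m + 1) / ((m + 1) * (a + c + 2 * m + 2)))) := by
    unfold GG tt
    rw [show m + 1 + m = (m + m) + 1 by ring, pow_succ, e1]
    push_cast
    rw [show a + c + (m : ℂ) + 1 + m = a + c + 2 * m + 1 by ring,
      show a + c + ((m : ℂ) + 1) + 1 + m = a + c + 2 * m + 2 by ring,
      show c + (m : ℂ) - m + 1 = c + 1 by ring, show c + ((m : ℂ) + 1) - m = c + 1 by ring]
    generalize gg a m = g
    obtain ⟨X, hX⟩ : ∃ X, X = a + c + 2 * (m : ℂ) + 1 := ⟨_, rfl⟩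
    obtain ⟨Y, hY⟩ : ∃ Y, Y = a + c + 2 * (m : ℂ) + 2 := ⟨_, rfl⟩
    rw [← hX] at h4 ⊢
    rw [← hY] at h5 ⊢
    obtain rfl : Y = X + 1 := by rw [hX, hY]; ring
    obtain rfl : a = X - c - 2 * m - 1 := by rw [hX]; ring
    rw [show X - c - 2 * (m : ℂ) - 1 + c + m + 1 = X - m by ring] at h3 ⊢
    field_simp
    ring
  linear_combination hsum + key - hG0

lemma main_ind (a c : ℂ) (ha : 0 ≤ a.re) (hc : 0 ≤ c.re) (m : ℕ) :
    ∑ j ∈ Finset.range m, tt a c m j =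
      Complex.Gamma (a + c + m + 1) / Complex.Gamma (c + m + 1) *
        ∑ j ∈ Finset.range m, TT a c j := by
  induction m with
  | zero => simp
  | succ m ih =>
    have hs := step a c ha hc m
    rw [ih] at hs
    have h1 : c + m + 1 ≠ 0 := ne_zero_of_re _ (by simp; positivity)
    have h3 : a + c + m + 1 ≠ 0 := ne_zero_of_re _ (by simp; positivity)
    have g3 : Complex.Gamma (c + m + 1) ≠ 0 :=
      Complex.Gamma_ne_zero_of_re_pos (by simp; positivity)
    apply mul_left_cancel₀ h1
    rw [Finset.sum_range_succ (fun j => TT a c j)]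
    push_cast
    rw [show a + c + ((m : ℂ) + 1) + 1 = a + c + m + 1 + 1 by ring,
      show c + ((m : ℂ) + 1) + 1 = c + m + 1 + 1 by ring,
      Complex.Gamma_add_one _ h1, Complex.Gamma_add_one _ h3]
    rw [sub_eq_iff_eq_add.1 hs]
    field_simp
    ring

theorem lemma5_sum_identity (m : ℕ) (hm : 1 ≤ m) (a c : ℂ)
    (ha : 0 ≤ a.re) (hc : 0 ≤ c.re) :
    ∑ i ∈ Finset.Icc 1 m,
        (-1 : ℂ) ^ i * (Complex.Gamma (a - i + m + 1) / Complex.Gamma ((m : ℂ) - i + 1))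
          * (1 / (a + c - i + 2 * m + 1) - 1 / (c + i)) =
      (Complex.Gamma (a + c + m + 1) / Complex.Gamma (c + m + 1)) *
        ∑ i ∈ Finset.Icc 1 m,
          (PhiG 0 (a + c) a c ((m : ℂ) - i) / (a + c - 2 * i + 2 * m + 1)
            + a * PhiG 1 (a + c + 1) a c ((m : ℂ) - i)
            - PhiG 1 (a + c) (a + 1) c ((m : ℂ) - i) / (a + c - 2 * i + 2 * m + 2)) := by
  rw [flip_sum, flip_sum]
  have h := main_ind a c ha hc m
  convert h using 2
  · rename_i j hj
    have hj' := Finset.mem_range.1 hj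
    rw [Nat.cast_sub hj'.le]
    unfold tt gg
    have e : (-1 : ℂ) ^ (m - j) = (-1) ^ (m + j) := by
      rw [show m + j = (m - j) + (j + j) by omega, pow_add, Even.neg_one_pow ⟨j, rfl⟩, mul_one]
    rw [e, show a - ((m : ℂ) - j) + m + 1 = a + j + 1 by ring,
      show (m : ℂ) - (m - j) + 1 = j + 1 by ring,
      show a + c - ((m : ℂ) - j) + 2 * m + 1 = a + c + m + 1 + j by ring,
      show c + ((m : ℂ) - j) = c + m - j by ring]
  · apply Finset.sum_congr rfl
    intro j hj
    have hj' := Finset.mem_range.1 hj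
    rw [Nat.cast_sub hj'.le]
    unfold TT
    rw [show (m : ℂ) - (m - j) = j by ring,
      show a + c - 2 * ((m : ℂ) - j) + 2 * m + 1 = a + c + 2 * j + 1 by ring,
      show a + c - 2 * ((m : ℂ) - j) + 2 * m + 2 = a + c + 2 * j + 2 by ring]
end
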